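/- Let c > 1 with c not an integer, let F(t) = t^c and f(n) = ⌊n^c⌋, and for a positive integer Q set S_Q = { ⌊n^c⌋ : n ∈ ℕ, Q < ⌊n^c⌋ ≤ 2Q }. For every A > 1 there exist constants B > 0 and κ > 0 and x₀ ≥ 2 (depending only on c and A) such that for all x ≥ x₀ and all positive integers Q with Q ≤ x (log x)^{−B}, one has Σ_{q ∈ S_Q} Σ_{ℓ=1, gcd(ℓ,q)=1}^{q} E(x; q, ℓ)² ≤ κ |S_Q| x² / ( Q (log x)^{2A} ). -/

import Mathlib

/-- `E(x; h, ℓ) = Σ_{p ≤ x, p ≡ ℓ (mod h)} log p − x/φ(h)`. -/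
noncomputable def Ef (x : ℝ) (h ℓ : ℕ) : ℝ :=
  (∑ p ∈ (Finset.range (⌊x⌋₊ + 1)).filter (fun p => p.Prime ∧ p % h = ℓ % h), Real.log p)
    - x / (Nat.totient h)

/-- `Σ_{ℓ=1, gcd(ℓ,m)=1}^{m} E(x; m, ℓ)²`. -/
noncomputable def varSum (x : ℝ) (m : ℕ) : ℝ :=
  ∑ ℓ ∈ (Finset.Icc 1 m).filter (fun ℓ => Nat.gcd ℓ m = 1), Ef x m ℓ ^ 2

open scoped Classical in
/-- `S_Q = { ⌊n^c⌋ : n ∈ ℕ, Q < ⌊n^c⌋ ≤ 2Q }`. -/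
noncomputable def SQ (c : ℝ) (Q : ℕ) : Finset ℕ :=
  (Finset.Ioc Q (2 * Q)).filter (fun q => ∃ n : ℕ, q = ⌊(n : ℝ) ^ c⌋₊)

open Complex in
lemma norm_natCast_cpow_sub_le {a b : ℝ} (ha : 0 < a) (hab : a ≤ b) {d : ℝ} (hd : b - a ≤ d) {s : ℂ}
    (hs : 0 < s.re) {θ : ℝ} (h0 : 0 ≤ θ) (h1 : θ ≤ 1) :
    ‖(a : ℂ) ^ (-s) - (b : ℂ) ^ (-s)‖ ≤ 2 * a ^ (-s.re - θ) * (d * ‖s‖) ^ θ := by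
  have hb : 0 < b := ha.trans_le hab
  have hd0 : 0 ≤ d := by linarith
  have key1 : ‖(a : ℂ) ^ (-s) - (b : ℂ) ^ (-s)‖ ≤ 2 * a ^ (-s.re) := by
    refine (norm_sub_le _ _).trans ?_
    rw [norm_cpow_eq_rpow_re_of_pos ha, norm_cpow_eq_rpow_re_of_pos hb, neg_re]
    have : b ^ (-s.re) ≤ a ^ (-s.re) := Real.rpow_le_rpow_of_nonpos ha hab (by linarith)
    linarith
  have key2 : ‖(a : ℂ) ^ (-s) - (b : ℂ) ^ (-s)‖ ≤ a ^ (-s.re) * (d * ‖s‖ / a) := by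
    have h := Convex.norm_image_sub_le_of_norm_hasDerivWithin_le (s := Set.Icc a b)
      (f := fun u : ℝ => (u : ℂ) ^ (-s)) (f' := fun u : ℝ => (-s) * (u : ℂ) ^ (-s - 1))
      (C := ‖s‖ * a ^ (-s.re - 1)) (x := b) (y := a) ?_ ?_ (convex_Icc a b)
      (Set.right_mem_Icc.2 hab) (Set.left_mem_Icc.2 hab)
    · refine h.trans ?_
      rw [Real.norm_eq_abs, abs_sub_comm, abs_of_nonneg (by linarith), Real.rpow_sub ha, Real.rpow_one]
      have : 0 ≤ ‖s‖ * (a ^ (-s.re) / a) := by positivity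
      calc _ ≤ ‖s‖ * (a ^ (-s.re) / a) * d := by gcongr
        _ = _ := by ring
    · intro u hu
      have hu0 : 0 < u := ha.trans_le hu.1
      by_cases hs0 : s = 0
      · simp [hs0] at hs
      have := (hasDerivAt_ofReal_cpow_const (x := u) hu0.ne' (r := -s) (by simpa using hs0))
      exact this.hasDerivWithinAt
    · intro u hu
      have hu0 : 0 < u := ha.trans_le hu.1
      rw [norm_mul, norm_neg, norm_cpow_eq_rpow_re_of_pos hu0]
      simp only [sub_re, neg_re, one_re]
      gcongr ?_ * ?_
      exact Real.rpow_le_rpow_of_nonpos ha hu.1 (by linarith)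
  have e : 2 * a ^ (-s.re - θ) * (d * ‖s‖) ^ θ = 2 * a ^ (-s.re) * (d * ‖s‖ / a) ^ θ := by
    rw [Real.rpow_sub ha, Real.div_rpow (by positivity) ha.le]; ring
  rw [e]
  set y := d * ‖s‖ / a
  have hy : 0 ≤ y := by positivity
  have hp : 0 ≤ a ^ (-s.re) := by positivity
  rcases le_total y 1 with h | h
  · have : y ≤ y ^ θ := by
      rcases hy.eq_or_lt with h' | h'
      · rw [← h']; positivity
      · simpa using Real.rpow_le_rpow_of_exponent_ge h' h h1
    nlinarith
  · have : 1 ≤ y ^ θ := Real.one_le_rpow h h0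
    nlinarith

/-- Summands of the regularised Dirichlet series: `n ^ (-s)` is compared with the value at the end of
its period. -/
noncomputable def regTerm {q : ℕ} (χ : DirichletCharacter ℂ q) (n : ℕ) (s : ℂ) : ℂ :=
  χ ((n + 1 : ℕ) : ZMod q) *
    ((((n + 1 : ℕ) : ℝ) : ℂ) ^ (-s) - (((q * (n / q + 1) : ℕ) : ℝ) : ℂ) ^ (-s))

noncomputable def regL {q : ℕ} (χ : DirichletCharacter ℂ q) (s : ℂ) : ℂ := ∑' n, regTerm χ n s

lemma norm_regTerm_le {q : ℕ} [NeZero q] (χ : DirichletCharacter ℂ q) (n : ℕ) {s : ℂ} (hs : 0 < s.re)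
    {θ : ℝ} (h0 : 0 ≤ θ) (h1 : θ ≤ 1) :
    ‖regTerm χ n s‖ ≤ 2 * ((n + 1 : ℕ) : ℝ) ^ (-s.re - θ) * (q * ‖s‖) ^ θ := by
  have hq : 0 < q := Nat.pos_of_ne_zero (NeZero.ne q)
  have h2 : n % q < q := Nat.mod_lt _ hq
  have h3 := Nat.div_add_mod n q
  rw [regTerm, norm_mul]
  refine (mul_le_of_le_one_left (norm_nonneg _) (DirichletCharacter.norm_le_one χ _)).trans ?_
  refine norm_natCast_cpow_sub_le (by positivity) ?_ ?_ hs h0 h1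
  · norm_cast; rw [mul_add]; omega
  · have : q * (n / q + 1) ≤ q + (n + 1) := by rw [mul_add]; omega
    have : ((q * (n / q + 1) : ℕ) : ℝ) ≤ q + (n + 1 : ℕ) := by exact_mod_cast this
    linarith

lemma summable_natSucc_rpow {p : ℝ} (hp : p < -1) : Summable fun n : ℕ => ((n + 1 : ℕ) : ℝ) ^ p :=
  (summable_nat_add_iff 1 (f := fun n : ℕ => (n : ℝ) ^ p)).2 (Real.summable_nat_rpow.2 hp)

lemma norm_regTerm_le' {q : ℕ} [NeZero q] (χ : DirichletCharacter ℂ q) (n : ℕ) {s : ℂ} {η : ℝ}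
    (hη : 0 < η) (hη2 : η ≤ 1 / 2) (hs : 1 - η ≤ s.re) :
    ‖regTerm χ n s‖ ≤ ((n + 1 : ℕ) : ℝ) ^ (-1 - η) * (2 * (q * ‖s‖) ^ (2 * η)) := by
  refine (norm_regTerm_le χ n (by linarith) (θ := 2 * η) (by linarith) (by linarith)).trans ?_
  have : ((n + 1 : ℕ) : ℝ) ^ (-s.re - 2 * η) ≤ ((n + 1 : ℕ) : ℝ) ^ (-1 - η) := by
    apply Real.rpow_le_rpow_of_exponent_le
    · norm_cast; omega
    · linarith
  have h : 0 ≤ ((q : ℝ) * ‖s‖) ^ (2 * η) := by positivity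
  nlinarith

lemma summable_regTerm {q : ℕ} [NeZero q] (χ : DirichletCharacter ℂ q) {s : ℂ} (hs : 0 < s.re) :
    Summable fun n => regTerm χ n s := by
  refine Summable.of_norm_bounded (g := fun n : ℕ => 2 * ((n + 1 : ℕ) : ℝ) ^ (-s.re - 1) * (q * ‖s‖) ^ (1 : ℝ))
    ?_ fun n => norm_regTerm_le χ n hs zero_le_one le_rfl
  exact ((summable_natSucc_rpow (by linarith)).mul_left _).mul_right _

lemma norm_regL_le {η : ℝ} (hη : 0 < η) (hη2 : η ≤ 1 / 2) :
    ∃ C : ℝ, 0 < C ∧ ∀ (q : ℕ) [NeZero q] (χ : DirichletCharacter ℂ q) (s : ℂ), 1 - η ≤ s.re →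
      ‖regL χ s‖ ≤ C * (q * ‖s‖) ^ (2 * η) := by
  have hS := summable_natSucc_rpow (p := -1 - η) (by linarith)
  refine ⟨2 * ∑' n : ℕ, ((n + 1 : ℕ) : ℝ) ^ (-1 - η), ?_, fun q _ χ s hs => ?_⟩
  · have := hS.tsum_pos (fun n => by positivity) 0 (by simp)
    positivity
  · have := tsum_of_norm_bounded (hS.mul_right (2 * (q * ‖s‖) ^ (2 * η))).hasSum
      fun n => norm_regTerm_le' χ n hη hη2 hs
    rw [tsum_mul_right] at this
    refine this.trans (le_of_eq (by ring))

lemma isOpen_re_pos : IsOpen {s : ℂ | 0 < s.re} := isOpen_lt continuous_const Complex.continuous_re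

lemma differentiable_regTerm {q : ℕ} [NeZero q] (χ : DirichletCharacter ℂ q) (n : ℕ) :
    Differentiable ℂ (regTerm χ n) := by
  have hq : 0 < q := Nat.pos_of_ne_zero (NeZero.ne q)
  unfold regTerm
  refine Differentiable.const_mul (Differentiable.sub ?_ ?_) _
  · refine (differentiable_id.neg).const_cpow (Or.inl ?_)
    norm_cast
  · refine (differentiable_id.neg).const_cpow (Or.inl ?_)
    norm_cast; positivity

/-- Local uniform summability in the right half plane from a decay bound on the terms. -/
lemma differentiableOn_tsum_re_pos {F : ℕ → ℂ → ℂ} (hF : ∀ n, Differentiable ℂ (F n)) {B : ℂ → ℝ}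
    (hB : Continuous B) 
    (hle : ∀ n s, 0 < s.re → ‖F n s‖ ≤ ((n + 1 : ℕ) : ℝ) ^ (-s.re - 1) * B s) :
    DifferentiableOn ℂ (fun s => ∑' n, F n s) {s : ℂ | 0 < s.re} := by
  intro s₀ hs₀
  have hs₀ : 0 < s₀.re := hs₀
  set U := {s : ℂ | s₀.re / 2 < s.re} ∩ {s : ℂ | |B s| < |B s₀| + 1}
  have hU : IsOpen U := (isOpen_lt continuous_const Complex.continuous_re).inter
    (isOpen_lt hB.abs continuous_const)
  have hmem : s₀ ∈ U := ⟨by show s₀.re / 2 < s₀.re; linarith, by show |B s₀| < _; linarith⟩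
  have := Complex.differentiableOn_tsum_of_summable_norm (u := fun n : ℕ => ((n + 1 : ℕ) : ℝ) ^ (-(s₀.re / 2) - 1) *
    (|B s₀| + 1)) ((summable_natSucc_rpow (by linarith)).mul_right _) (F := F) (U := U)
    (fun n => (hF n).differentiableOn) hU ?_
  · exact ((this s₀ hmem).differentiableAt (hU.mem_nhds hmem)).differentiableWithinAt
  · rintro n s ⟨h1, h2⟩
    have h1 : s₀.re / 2 < s.re := h1
    have h2 : |B s| < |B s₀| + 1 := h2
    refine (hle n s (by linarith)).trans ?_
    refine mul_le_mul (Real.rpow_le_rpow_of_exponent_le (by norm_cast; omega) (by linarith))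
      ((le_abs_self _).trans h2.le) ?_ (by positivity)
    have := (norm_nonneg _).trans (hle n s (by linarith))
    exact nonneg_of_mul_nonneg_right this (by positivity)

lemma differentiableOn_regL {q : ℕ} [NeZero q] (χ : DirichletCharacter ℂ q) :
    DifferentiableOn ℂ (regL χ) {s : ℂ | 0 < s.re} := by
  refine differentiableOn_tsum_re_pos (B := fun s => 2 * (q * ‖s‖)) (differentiable_regTerm χ) (by fun_prop)
    fun n s hs => ?_
  have := norm_regTerm_le χ n hs zero_le_one le_rfl
  rw [Real.rpow_one] at this
  linarith

lemma tsum_char_block {q : ℕ} [NeZero q] (χ : DirichletCharacter ℂ q) {s : ℂ} (hs : 1 < s.re) :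
    ∑' n : ℕ, χ ((n + 1 : ℕ) : ZMod q) * (((q * (n / q + 1) : ℕ) : ℝ) : ℂ) ^ (-s) =
      (∑ a : ZMod q, χ a) * (q : ℂ) ^ (-s) * riemannZeta s ∧
    Summable fun n : ℕ => χ ((n + 1 : ℕ) : ZMod q) * (((q * (n / q + 1) : ℕ) : ℝ) : ℂ) ^ (-s) := by
  have hq : 0 < q := Nat.pos_of_ne_zero (NeZero.ne q)
  have hsum : Summable fun n : ℕ => χ ((n + 1 : ℕ) : ZMod q) * (((q * (n / q + 1) : ℕ) : ℝ) : ℂ) ^ (-s) := by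
    refine Summable.of_norm_bounded (g := fun n : ℕ => ((n + 1 : ℕ) : ℝ) ^ (-s.re))
      (summable_natSucc_rpow (by linarith)) fun n => ?_
    rw [norm_mul]
    refine (mul_le_of_le_one_left (norm_nonneg _) (DirichletCharacter.norm_le_one χ _)).trans ?_
    rw [Complex.norm_cpow_eq_rpow_re_of_pos (by positivity), Complex.neg_re]
    have h2 : n % q < q := Nat.mod_lt _ hq
    have h3 := Nat.div_add_mod n q
    refine Real.rpow_le_rpow_of_nonpos (by positivity) ?_ (by linarith)
    norm_cast; rw [mul_add]; omega
  refine ⟨?_, hsum⟩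
  rw [← (Nat.divModEquiv q).symm.tsum_eq]
  have hs2 := (Nat.divModEquiv q).symm.summable_iff.2 hsum
  rw [Summable.tsum_prod (by exact hs2)]
  have e : ∀ m : ℕ, ∑' r : Fin q, χ ((((Nat.divModEquiv q).symm (m, r) + 1 : ℕ)) : ZMod q) *
      (((q * ((Nat.divModEquiv q).symm (m, r) / q + 1) : ℕ) : ℝ) : ℂ) ^ (-s) =
      (∑ a : ZMod q, χ a) * (q : ℂ) ^ (-s) * (1 / ((m : ℂ) + 1) ^ s) := by
    intro m
    rw [tsum_fintype]
    have : ∀ r : Fin q, χ ((((Nat.divModEquiv q).symm (m, r) + 1 : ℕ)) : ZMod q) *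
      (((q * ((Nat.divModEquiv q).symm (m, r) / q + 1) : ℕ) : ℝ) : ℂ) ^ (-s) =
        χ ((r : ℕ) + 1 : ZMod q) * ((q : ℂ) ^ (-s) * (1 / ((m : ℂ) + 1) ^ s)) := by
      intro r
      have h1 : (Nat.divModEquiv q).symm (m, r) = m * q + r := rfl
      rw [h1]
      have h2 : (m * q + (r : ℕ)) / q = m := by
        rw [mul_comm, Nat.mul_add_div hq, Nat.div_eq_of_lt r.2, add_zero]
      rw [h2]
      congr 1
      · push_cast; simp
      · push_cast
        rw [show ((q : ℂ) * ((m : ℂ) + 1)) = ((q : ℝ) : ℂ) * (((m : ℝ) + 1 : ℝ) : ℂ) by push_cast; ring,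
          Complex.mul_cpow_ofReal_nonneg (by positivity) (by positivity)]
        simp only [Complex.cpow_neg]
        push_cast; ring
    rw [Finset.sum_congr rfl fun r _ => this r, ← Finset.sum_mul, mul_assoc]
    congr 1
    obtain ⟨k, rfl⟩ := Nat.exists_eq_succ_of_ne_zero (NeZero.ne q)
    rw [← Equiv.sum_comp (Equiv.addRight (1 : ZMod (k+1))) (fun a => χ a)]
    refine Finset.sum_congr rfl fun r _ => ?_
    simp only [Equiv.coe_addRight]
    congr 2
    exact ZMod.natCast_zmod_val (n := k+1) r
  rw [tsum_congr e, tsum_mul_left, zeta_eq_tsum_one_div_nat_add_one_cpow hs]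

lemma LFunction_eq_regL_add {q : ℕ} [NeZero q] (χ : DirichletCharacter ℂ q) {s : ℂ} (hs : 1 < s.re) :
    DirichletCharacter.LFunction χ s = regL χ s + (∑ a : ZMod q, χ a) * (q : ℂ) ^ (-s) * riemannZeta s := by
  obtain ⟨h1, h2⟩ := tsum_char_block χ hs
  have hs0 : s ≠ 0 := by rintro rfl; norm_num at hs
  rw [DirichletCharacter.LFunction_eq_LSeries χ hs, ← h1, regL, ← (summable_regTerm χ (by linarith)).tsum_add h2]
  have h3 : LSeriesSummable (fun n => χ (n : ZMod q)) s := χ.LSeriesSummable_of_one_lt_re hs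
  rw [LSeries, h3.tsum_eq_zero_add, LSeries.term_zero, zero_add]
  refine tsum_congr fun n => ?_
  rw [LSeries.term_of_ne_zero (by omega), regTerm, div_eq_mul_inv, ← Complex.cpow_neg]
  push_cast; ring

lemma eqOn_re_pos {f g : ℂ → ℂ} (hf : DifferentiableOn ℂ f {s : ℂ | 0 < s.re})
    (hg : DifferentiableOn ℂ g {s : ℂ | 0 < s.re}) (h : ∀ s : ℂ, 1 < s.re → f s = g s) {s : ℂ}
    (hs : 0 < s.re) : f s = g s := by
  refine AnalyticOnNhd.eqOn_of_preconnected_of_eventuallyEq (hf.analyticOnNhd isOpen_re_pos)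
    (hg.analyticOnNhd isOpen_re_pos) ?_ (z₀ := 2) (by simp) ?_ hs
  · exact (convex_halfSpace_re_gt 0).isPreconnected
  · have : IsOpen {s : ℂ | 1 < s.re} := isOpen_lt continuous_const Complex.continuous_re
    filter_upwards [this.mem_nhds (show (2 : ℂ) ∈ _ by simp)] with z hz using h z hz

lemma LFunction_eq_regL {q : ℕ} [NeZero q] {χ : DirichletCharacter ℂ q} (hχ : χ ≠ 1) {s : ℂ}
    (hs : 0 < s.re) : DirichletCharacter.LFunction χ s = regL χ s := by
  refine eqOn_re_pos (DirichletCharacter.differentiable_LFunction hχ).differentiableOn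
    (differentiableOn_regL χ) (fun z hz => ?_) hs
  rw [LFunction_eq_regL_add χ hz, MulChar.sum_eq_zero_of_ne_one hχ]
  simp

noncomputable def zetaTerm (n : ℕ) (s : ℂ) : ℂ :=
  (s - 1) * (((n + 1 : ℕ) : ℝ) : ℂ) ^ (-s) + ((((n + 1 : ℕ) : ℝ) + 1 : ℝ) : ℂ) ^ (1 - s)
    - (((n + 1 : ℕ) : ℝ) : ℂ) ^ (1 - s)

lemma norm_zetaTerm_le (n : ℕ) {s : ℂ} (hs : 0 < s.re) {θ : ℝ} (h0 : 0 ≤ θ) (h1 : θ ≤ 1) :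
    ‖zetaTerm n s‖ ≤ ‖s - 1‖ * (2 * ((n + 1 : ℕ) : ℝ) ^ (-s.re - θ) * ‖s‖ ^ θ) := by
  set a : ℝ := ((n + 1 : ℕ) : ℝ) with ha
  have ha0 : 0 < a := by positivity
  by_cases hs1 : s = 1
  · subst hs1; simp [zetaTerm]
  have h := Convex.norm_image_sub_le_of_norm_hasDerivWithin_le (s := Set.Icc a (a+1))
      (f := fun u : ℝ => (s - 1) * (a : ℂ) ^ (-s) * (u : ℂ) + (u : ℂ) ^ (1 - s))
      (f' := fun u : ℝ => (s - 1) * ((a : ℂ) ^ (-s) - (u : ℂ) ^ (-s)))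
      (C := ‖s - 1‖ * (2 * a ^ (-s.re - θ) * ‖s‖ ^ θ)) (x := a) (y := a + 1) ?_ ?_ (convex_Icc _ _)
      (by simp) (by simp)
  · have e : (s - 1) * (a : ℂ) ^ (-s) * ((a + 1 : ℝ) : ℂ) + ((a + 1 : ℝ) : ℂ) ^ (1 - s) -
       ((s - 1) * (a : ℂ) ^ (-s) * (a : ℂ) + (a : ℂ) ^ (1 - s)) = zetaTerm n s := by
      rw [zetaTerm, ← ha]; push_cast; ring
    simp only [e] at h
    simpa using h
  · intro u hu
    have hu0 : 0 < u := ha0.trans_le hu.1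
    have d1 := hasDerivAt_ofReal_cpow_const (x := u) hu0.ne' (r := 1 - s) (by
      intro hh; exact hs1 (by linear_combination -hh))
    have d2 : HasDerivAt (fun u : ℝ => (s - 1) * (a : ℂ) ^ (-s) * (u : ℂ)) ((s - 1) * (a : ℂ) ^ (-s) * 1) u :=
      (Complex.ofRealCLM.hasDerivAt (x := u)).const_mul _
    refine ((d2.add d1).congr_deriv ?_).hasDerivWithinAt
    rw [show 1 - s - 1 = -s by ring]; ring
  · intro u hu
    rw [norm_mul]
    gcongr
    simpa using norm_natCast_cpow_sub_le ha0 hu.1 (d := 1) (by linarith [hu.2]) hs h0 h1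

lemma riemannZeta₁_eq {s : ℂ} (hs : 0 < s.re) : riemannZeta₁ s = 1 + ∑' n, zetaTerm n s := by
  refine eqOn_re_pos (f := riemannZeta₁) (g := fun s => 1 + ∑' n, zetaTerm n s)
    differentiable_riemannZeta₁.differentiableOn ?_ (fun z hz => ?_) hs
  · refine (differentiableOn_const 1).add ?_
    refine differentiableOn_tsum_re_pos (B := fun s => ‖s - 1‖ * (2 * ‖s‖)) (fun n => ?_) (by fun_prop)
      fun n s hs => ?_
    · unfold zetaTerm
      refine Differentiable.sub (Differentiable.add (Differentiable.mul (by fun_prop) ?_) ?_) ?_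
      · exact (differentiable_id.neg).const_cpow (Or.inl (by norm_cast))
      · exact ((differentiable_const 1).sub differentiable_id).const_cpow (Or.inl (by norm_cast))
      · exact ((differentiable_const 1).sub differentiable_id).const_cpow (Or.inl (by norm_cast))
    · have := norm_zetaTerm_le n hs zero_le_one le_rfl
      rw [Real.rpow_one] at this
      linarith
  · have hz1 : z ≠ 1 := by rintro rfl; simp at hz
    have h := riemannZeta_eq_inv_sub_mul hz1
    have h2 : riemannZeta₁ z = (z - 1) * riemannZeta z := by
      rw [h]; field_simp [sub_ne_zero.2 hz1]
    rw [h2, zeta_eq_tsum_one_div_nat_add_one_cpow hz, ← tsum_mul_left]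
    have hA : Summable fun n : ℕ => (z - 1) * (1 / ((n : ℂ) + 1) ^ z) := by
      refine Summable.mul_left _ ?_
      have := (summable_nat_add_iff 1).2 (Complex.summable_one_div_nat_cpow.2 hz)
      simpa using this
    have hB : HasSum (fun n : ℕ => ((((n + 1 : ℕ) : ℝ) + 1 : ℝ) : ℂ) ^ (1 - z)
        - (((n + 1 : ℕ) : ℝ) : ℂ) ^ (1 - z)) (0 - 1) := by
      have ht : Summable (fun n => zetaTerm n z) := by
        refine Summable.of_norm_bounded (g := fun n : ℕ => ‖z - 1‖ * (2 * ((n + 1 : ℕ) : ℝ) ^ (-z.re - 1) * ‖z‖ ^ (1:ℝ)))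
          ?_ fun n => norm_zetaTerm_le n (by linarith) zero_le_one le_rfl
        exact (((summable_natSucc_rpow (by linarith)).mul_left _).mul_right _).mul_left _
      have hs' : Summable (fun n : ℕ => ((((n + 1 : ℕ) : ℝ) + 1 : ℝ) : ℂ) ^ (1 - z)
        - (((n + 1 : ℕ) : ℝ) : ℂ) ^ (1 - z)) := by
        refine (ht.sub hA).congr fun n => ?_
        rw [zetaTerm, Complex.cpow_neg]; push_cast; ring
      refine (hs'.hasSum_iff_tendsto_nat).2 ?_
      have e : ∀ N : ℕ, ∑ n ∈ Finset.range N, (((((n + 1 : ℕ) : ℝ) + 1 : ℝ) : ℂ) ^ (1 - z)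
        - (((n + 1 : ℕ) : ℝ) : ℂ) ^ (1 - z)) = ((((N + 1 : ℕ) : ℝ)) : ℂ) ^ (1 - z) - 1 := by
        intro N
        have := Finset.sum_range_sub (fun n : ℕ => ((((n + 1 : ℕ) : ℝ)) : ℂ) ^ (1 - z)) N
        rw [← Finset.sum_congr rfl (fun n _ => ?_)] at this
        · rw [this]; simp
        · push_cast; ring_nf
      simp only [e]
      refine Filter.Tendsto.sub_const ?_ 1
      rw [tendsto_zero_iff_norm_tendsto_zero]
      have e2 : ∀ N : ℕ, ‖((((N + 1 : ℕ) : ℝ)) : ℂ) ^ (1 - z)‖ = ((N + 1 : ℕ) : ℝ) ^ (-(z.re - 1)) := by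
        intro N
        rw [Complex.norm_cpow_eq_rpow_re_of_pos (by positivity)]; simp
      simp only [e2]
      exact (tendsto_rpow_neg_atTop (by linarith)).comp
        (tendsto_natCast_atTop_atTop.comp (Filter.tendsto_add_atTop_nat 1))
    have : ∀ n : ℕ, zetaTerm n z = (z - 1) * (1 / ((n : ℂ) + 1) ^ z) +
        (((((n + 1 : ℕ) : ℝ) + 1 : ℝ) : ℂ) ^ (1 - z) - (((n + 1 : ℕ) : ℝ) : ℂ) ^ (1 - z)) := by
      intro n
      rw [zetaTerm, Complex.cpow_neg]; push_cast; ring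
    rw [tsum_congr this, hA.tsum_add hB.summable, hB.tsum_eq]
    ring

lemma norm_riemannZeta₁_le {η : ℝ} (hη : 0 < η) (hη2 : η ≤ 1 / 2) :
    ∃ C : ℝ, 0 < C ∧ ∀ s : ℂ, 1 - η ≤ s.re → ‖riemannZeta₁ s - 1‖ ≤ C * ‖s - 1‖ * ‖s‖ ^ (2 * η) := by
  have hS := summable_natSucc_rpow (p := -1 - η) (by linarith)
  refine ⟨2 * ∑' n : ℕ, ((n + 1 : ℕ) : ℝ) ^ (-1 - η), ?_, fun s hs => ?_⟩
  · have := hS.tsum_pos (fun n => by positivity) 0 (by simp)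
    positivity
  · rw [riemannZeta₁_eq (by linarith), add_sub_cancel_left]
    have := tsum_of_norm_bounded (f := fun n => zetaTerm n s)
      (hS.mul_right (‖s - 1‖ * (2 * ‖s‖ ^ (2 * η)))).hasSum fun n => ?_
    · rw [tsum_mul_right] at this
      refine this.trans (le_of_eq (by ring))
    · refine (norm_zetaTerm_le n (by linarith) (θ := 2 * η) (by linarith) (by linarith)).trans ?_
      have : ((n + 1 : ℕ) : ℝ) ^ (-s.re - 2 * η) ≤ ((n + 1 : ℕ) : ℝ) ^ (-1 - η) := by
        apply Real.rpow_le_rpow_of_exponent_le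
        · norm_cast; omega
        · linarith
      calc _ ≤ ‖s - 1‖ * (2 * ((n + 1 : ℕ) : ℝ) ^ (-1 - η) * ‖s‖ ^ (2 * η)) := by gcongr
        _ = _ := by ring

/-- Holomorphic functions on `0 < re s` of subpolynomial growth just to the left of `re s = 1`. -/
structure SubPoly (f : ℂ → ℂ) (N C ε r : ℝ) : Prop where
  diff : DifferentiableOn ℂ f {s : ℂ | 0 < s.re}
  bound : ∀ s : ℂ, 1 - r ≤ s.re → s.re ≤ 3 → ‖f s‖ ≤ C * (N * (|s.im| + 2)) ^ ε

lemma one_le_conductor {N : ℝ} (hN : 1 ≤ N) (t : ℝ) : 1 ≤ N * (|t| + 2) := by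
  nlinarith [abs_nonneg t]

lemma conductor_rpow_le {N ε t u : ℝ} (hN : 1 ≤ N) (hε : 0 ≤ ε) (hε1 : ε ≤ 1) (h : |u| ≤ 2 * |t| + 2) :
    (N * (|u| + 2)) ^ ε ≤ 2 * (N * (|t| + 2)) ^ ε := by
  have e4 : (N * (|u| + 2)) ^ ε ≤ (2 * (N * (|t| + 2))) ^ ε := by
    refine Real.rpow_le_rpow (by positivity) ?_ hε
    nlinarith [abs_nonneg t]
  have e5 : (2 : ℝ) ^ ε ≤ 2 := by
    simpa using Real.rpow_le_rpow_of_exponent_le (by norm_num : (1 : ℝ) ≤ 2) hε1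
  rw [Real.mul_rpow (x := 2) (by norm_num) (by positivity)] at e4
  exact e4.trans (by gcongr)

lemma SubPoly.iteratedDeriv_le {f : ℂ → ℂ} {N C ε r : ℝ} (h : SubPoly f N C ε r) (hN : 1 ≤ N)
    (hC : 0 ≤ C) (hε : 0 ≤ ε) (hε1 : ε ≤ 1) (hr : 0 < r) (hr1 : r ≤ 1 / 2) (k : ℕ) {s : ℂ} (h1 : 1 - r / 2 ≤ s.re)
    (h2 : s.re ≤ 5 / 2) :
    ‖iteratedDeriv k f s‖ ≤ k.factorial * (2 * C * (N * (|s.im| + 2)) ^ ε) / (r / 2) ^ k := by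
  have hsub : Metric.closedBall s (r / 2) ⊆ {s : ℂ | 0 < s.re} := by
    intro z hz
    have := (Complex.abs_re_le_norm (z - s)).trans (by simpa [dist_eq_norm] using hz)
    rw [Complex.sub_re, abs_le] at this
    show 0 < z.re
    linarith [this.1]
  refine Complex.norm_iteratedDeriv_le_of_forall_mem_sphere_norm_le k (by linarith) ?_ ?_
  · refine DifferentiableOn.diffContOnCl ?_
    refine h.diff.mono (Set.Subset.trans ?_ hsub)
    exact Metric.closure_ball_subset_closedBall
  · intro z hz
    have hz : ‖z - s‖ ≤ r / 2 := by rw [mem_sphere_iff_norm] at hz; exact hz.le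
    have e1 := (Complex.abs_re_le_norm (z - s)).trans hz
    have e2 := (Complex.abs_im_le_norm (z - s)).trans hz
    rw [Complex.sub_re, abs_le] at e1
    rw [Complex.sub_im] at e2
    refine (h.bound z (by linarith) (by linarith)).trans ?_
    have e3 : |z.im| ≤ |s.im| + r / 2 := by
      have := abs_add_le (z.im - s.im) s.im
      rw [sub_add_cancel] at this; linarith
    have e4 := conductor_rpow_le (t := s.im) hN hε hε1 (u := z.im) (by linarith [abs_nonneg s.im])
    calc _ ≤ C * (2 * (N * (|s.im| + 2)) ^ ε) := by
          exact mul_le_mul_of_nonneg_left e4 hC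
      _ = _ := by ring

/-- A function with subpolynomial growth that is not too small on `1 < re s` has logarithmic
derivatives of subpolynomial growth. -/
lemma SubPoly.logDeriv_le {C ε r c : ℝ} (hC : 1 ≤ C) (hε : 0 ≤ ε) (hε1 : ε ≤ 1) (hr : 0 < r)
    (hr1 : r ≤ 1 / 2) (hc : 0 < c) (hc1 : c ≤ 1) (k : ℕ) :
    ∃ K : ℝ, 0 < K ∧ ∀ (f : ℂ → ℂ) (N : ℝ), 1 ≤ N → SubPoly f N C ε r →
      (∀ s : ℂ, 1 < s.re → s.re ≤ 2 → c * (N * (|s.im| + 2)) ^ (-ε) ≤ ‖f s‖) →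
      ∀ s : ℂ, 1 < s.re → s.re ≤ 2 →
        ‖iteratedDeriv k (fun z => deriv f z / f z) s‖ ≤ K * (N * (|s.im| + 2)) ^ ((2 * k + 2) * ε) := by
  set C1 := 8 * C / r with hC1
  have hC1r : 8 ≤ C1 * r := by rw [hC1]; field_simp; linarith
  have hC1p : 0 < C1 := by positivity
  refine ⟨k.factorial * (2 * C1 / c) ^ (k + 1), by positivity, ?_⟩
  intro f N hN h hlow s hs1 hs2
  set W := (N * (|s.im| + 2)) ^ ε with hW
  have hW1 : 1 ≤ W := Real.one_le_rpow (one_le_conductor hN _) hε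
  have hn0 : 0 < N * (|s.im| + 2) := by linarith [one_le_conductor hN s.im]
  set ρ := c / (2 * C1 * W ^ 2) with hρ
  have hρ0 : 0 < ρ := by positivity
  have hρr : ρ ≤ r / 2 := by
    rw [hρ, div_le_iff₀ (by positivity)]
    have : 8 ≤ C1 * r * W ^ 2 := by nlinarith
    nlinarith
  have hsub : Metric.closedBall s ρ ⊆ {s : ℂ | 0 < s.re} := by
    intro z hz
    have := (Complex.abs_re_le_norm (z - s)).trans (by simpa [dist_eq_norm] using hz)
    rw [Complex.sub_re, abs_le] at this
    show 0 < z.re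
    linarith [this.1]
  have hd : ∀ z ∈ Metric.closedBall s ρ, ‖deriv f z‖ ≤ C1 * W := by
    intro z hz
    have hz : ‖z - s‖ ≤ ρ := by simpa [dist_eq_norm] using hz
    have e1 := (Complex.abs_re_le_norm (z - s)).trans hz
    have e2 := (Complex.abs_im_le_norm (z - s)).trans hz
    rw [Complex.sub_re, abs_le] at e1
    rw [Complex.sub_im] at e2
    have e3 : |z.im| ≤ |s.im| + r / 2 := by
      have := abs_add_le (z.im - s.im) s.im
      rw [sub_add_cancel] at this; linarith
    have := h.iteratedDeriv_le hN (by linarith) hε hε1 hr hr1 1 (s := z) (by linarith) (by linarith)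
    rw [iteratedDeriv_one] at this
    refine this.trans ?_
    have e6 := conductor_rpow_le (t := s.im) hN hε hε1 (u := z.im) (by linarith [abs_nonneg s.im])
    rw [← hW] at e6
    rw [hC1, pow_one, div_le_iff₀ (by linarith)]
    have e7 : 8 * C / r * W * (r / 2) = 4 * C * W := by field_simp; ring
    rw [e7]
    simp only [Nat.factorial, Nat.cast_one, one_mul, mul_one]
    have := mul_le_mul_of_nonneg_left e6 (by linarith : 0 ≤ 2 * C)
    linarith
  have hf : ∀ z ∈ Metric.closedBall s ρ, c / (2 * W) ≤ ‖f z‖ := by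
    intro z hz
    have hz' : ‖z - s‖ ≤ ρ := by simpa [dist_eq_norm] using hz
    have h1 := hlow s hs1 hs2
    rw [Real.rpow_neg hn0.le, ← hW] at h1
    have h2 := Convex.norm_image_sub_le_of_norm_deriv_le (f := f) (C := C1 * W) (s := Metric.closedBall s ρ)
      (x := s) (y := z) (fun w hw => h.diff.differentiableAt (isOpen_re_pos.mem_nhds (hsub hw))) hd
      (convex_closedBall _ _) (Metric.mem_closedBall_self hρ0.le) hz
    have h3 : C1 * W * ‖z - s‖ ≤ c / (2 * W) := by
      calc _ ≤ C1 * W * ρ := by gcongr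
        _ = _ := by rw [hρ]; field_simp
    have h4 := norm_sub_norm_le (f s) (f z)
    rw [norm_sub_rev] at h4
    have h5 : c * W⁻¹ = c / (2 * W) + c / (2 * W) := by field_simp; ring
    linarith
  have hcw : 0 < c / (2 * W) := by positivity
  have hdiff : DiffContOnCl ℂ (fun z => deriv f z / f z) (Metric.ball s ρ) := by
    refine DifferentiableOn.diffContOnCl ?_
    refine DifferentiableOn.mono ?_ Metric.closure_ball_subset_closedBall
    refine DifferentiableOn.div ((h.diff.deriv isOpen_re_pos).mono hsub) (h.diff.mono hsub) ?_
    intro z hz h0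
    have := hf z hz
    rw [h0, norm_zero] at this
    linarith
  have := Complex.norm_iteratedDeriv_le_of_forall_mem_sphere_norm_le k hρ0 hdiff (C := 2 * C1 * W ^ 2 / c) ?_
  · refine this.trans (le_of_eq ?_)
    have : (N * (|s.im| + 2)) ^ ((2 * k + 2) * ε) = W ^ (2 * k + 2) := by
      rw [hW, ← Real.rpow_natCast, ← Real.rpow_mul hn0.le]
      push_cast; ring_nf
    rw [this, hρ, div_pow c]
    simp only [div_pow, mul_pow, pow_succ, pow_mul]
    field_simp
  · intro z hz
    have hz := Metric.sphere_subset_closedBall hz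
    rw [norm_div]
    have h1 := hd z hz
    have h2 := hf z hz
    calc _ ≤ C1 * W / (c / (2 * W)) := by gcongr
      _ = _ := by field_simp

lemma lower_of_three_quarters {g : ℂ → ℂ} {W : ℝ} (hW : 1 ≤ W) {t : ℝ}
    (hg : DifferentiableOn ℂ g {s : ℂ | 0 < s.re})
    (hd : ∀ σ : ℝ, 1 < σ → σ ≤ 2 → ‖deriv g (σ + t * Complex.I)‖ ≤ W)
    (hl : ∀ σ : ℝ, 1 < σ → σ ≤ 2 → (σ - 1) ^ 3 ≤ (W * ‖g (σ + t * Complex.I)‖) ^ 4)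
    {σ : ℝ} (h1 : 1 < σ) (h2 : σ ≤ 2) : W ^ (-7 : ℤ) / 16 ≤ ‖g (σ + t * Complex.I)‖ := by
  set σ₁ := 1 + 1 / (2 * W ^ 2) ^ 4 with hσ₁
  have hW0 : 0 < W := by linarith
  have hW2 : 1 ≤ 2 * W ^ 2 := by nlinarith
  have hσ₁1 : 1 < σ₁ := by rw [hσ₁]; have : 0 < 1 / (2 * W ^ 2) ^ 4 := by positivity
                           linarith
  have hσ₁2 : σ₁ ≤ 2 := by
    have : 1 / (2 * W ^ 2) ^ 4 ≤ 1 := by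
      rw [div_le_one (by positivity)]; exact one_le_pow₀ hW2
    linarith
  have key : ∀ σ : ℝ, σ₁ ≤ σ → σ ≤ 2 → W ^ (-7 : ℤ) / 8 ≤ ‖g (σ + t * Complex.I)‖ := by
    intro σ h1 h2
    have h3 := hl σ (by linarith) h2
    have h4 : ((1 / (2 * W ^ 2)) ^ 3) ^ 4 ≤ (W * ‖g (σ + t * Complex.I)‖) ^ 4 := by
      refine le_trans ?_ h3
      have : 1 / (2 * W ^ 2) ^ 4 ≤ σ - 1 := by linarith
      calc _ = (1 / (2 * W ^ 2) ^ 4) ^ 3 := by field_simp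
        _ ≤ _ := by gcongr
    have h5 := le_of_pow_le_pow_left₀ (by norm_num) (by positivity) h4
    rw [zpow_neg]
    have : W * ((W ^ (7:ℤ))⁻¹ / 8) ≤ W * ‖g (σ + t * Complex.I)‖ := by
      refine le_trans (le_of_eq ?_) h5
      norm_cast; field_simp; norm_num
    exact le_of_mul_le_mul_left this hW0
  have hp : 0 < W ^ (-7 : ℤ) := by positivity
  rcases le_total σ₁ σ with h | h
  · linarith [key σ h h2]
  · have h3 := key σ₁ le_rfl hσ₁2
    have h4 := Convex.norm_image_sub_le_of_norm_hasDerivWithin_le (s := Set.Icc σ σ₁)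
      (f := fun u : ℝ => g (u + t * Complex.I)) (f' := fun u : ℝ => deriv g (u + t * Complex.I)) (C := W)
      (x := σ) (y := σ₁) ?_ ?_ (convex_Icc _ _) (Set.left_mem_Icc.2 h) (Set.right_mem_Icc.2 h)
    · have h5 : W * ‖σ₁ - σ‖ ≤ W ^ (-7 : ℤ) / 16 := by
        rw [Real.norm_eq_abs, abs_of_nonneg (by linarith)]
        calc W * (σ₁ - σ) ≤ W * (1 / (2 * W ^ 2) ^ 4) := by gcongr; linarith
          _ = _ := by rw [zpow_neg]; norm_cast; field_simp; norm_num
      have h6 := norm_sub_norm_le (g (σ₁ + t * Complex.I)) (g (σ + t * Complex.I))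
      linarith
    · intro u hu
      have hu1 : 1 < u := lt_of_lt_of_le h1 hu.1
      have : HasDerivAt g (deriv g (u + t * Complex.I)) ((u : ℂ) + t * Complex.I) := by
        refine (hg.differentiableAt (isOpen_re_pos.mem_nhds ?_)).hasDerivAt
        simp; linarith
      have h7 : HasDerivAt (fun u : ℝ => (u : ℂ) + t * Complex.I) 1 u :=
        (Complex.ofRealCLM.hasDerivAt (x := u)).add_const _
      have := HasDerivAt.comp (𝕜 := ℝ) (𝕜' := ℂ) u this h7
      rw [mul_one] at this
      exact this.hasDerivWithinAt
    · intro u hu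
      exact hd u (lt_of_lt_of_le h1 hu.1) (hu.2.trans hσ₁2)

section

open DirichletCharacter

lemma norm_riemannZeta₀_le {η : ℝ} (hη : 0 < η) (hη2 : η ≤ 1 / 2) :
    ∃ C : ℝ, 0 < C ∧ ∀ s : ℂ, 1 - η ≤ s.re → ‖riemannZeta₀ s‖ ≤ C * ‖s‖ ^ (2 * η) := by
  obtain ⟨C, hC, h⟩ := norm_riemannZeta₁_le hη hη2
  refine ⟨C + ‖riemannZeta₀ 1‖, by positivity, fun s hs => ?_⟩
  by_cases h1 : s = 1
  · subst h1; simp; linarith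
  · have := h s hs
    rw [riemannZeta₁, add_sub_cancel_left, norm_mul] at this
    have h2 : 0 < ‖s - 1‖ := norm_pos_iff.2 (sub_ne_zero.2 h1)
    have h3 : 0 ≤ ‖s‖ ^ (2 * η) := by positivity
    have h4 : ‖s - 1‖ * ‖riemannZeta₀ s‖ ≤ ‖s - 1‖ * (C * ‖s‖ ^ (2 * η)) := by linarith
    refine (le_of_mul_le_mul_left h4 h2).trans ?_
    gcongr
    linarith [norm_nonneg (riemannZeta₀ 1)]

lemma conductor_norm_le {N ε : ℝ} (hN : 1 ≤ N) {η : ℝ} (hη : 0 < η) (hη2 : 2 * η ≤ 1) (hηε : 2 * η ≤ ε)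
    {s : ℂ} (h1 : 0 ≤ s.re) (h2 : s.re ≤ 3) :
    (N * ‖s‖) ^ (2 * η) ≤ 2 * (N * (|s.im| + 2)) ^ ε := by
  have h3 : ‖s‖ ≤ 2 * (|s.im| + 2) := by
    refine (Complex.norm_le_abs_re_add_abs_im s).trans ?_
    rw [abs_of_nonneg h1]
    linarith [abs_nonneg s.im]
  have h4 := one_le_conductor hN s.im
  calc (N * ‖s‖) ^ (2 * η) ≤ (2 * (N * (|s.im| + 2))) ^ (2 * η) := by
        refine Real.rpow_le_rpow (by positivity) ?_ (by linarith)
        nlinarith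
    _ = 2 ^ (2 * η) * (N * (|s.im| + 2)) ^ (2 * η) := Real.mul_rpow (by norm_num) (by linarith)
    _ ≤ 2 ^ (1 : ℝ) * (N * (|s.im| + 2)) ^ ε := by
        gcongr; norm_num
    _ = _ := by norm_num

lemma subPoly_regL {ε : ℝ} (hε : 0 < ε) : ∃ C : ℝ, 1 ≤ C ∧ ∃ r : ℝ, 0 < r ∧ r ≤ 1 / 2 ∧
    ∀ (q : ℕ) [NeZero q] (χ : DirichletCharacter ℂ q), SubPoly (regL χ) q C ε r := by
  set η := min (ε / 2) (1 / 2)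
  have h0 : 0 < η := by positivity
  have h1 : η ≤ 1 / 2 := min_le_right _ _
  have h2 : η ≤ ε / 2 := min_le_left _ _
  obtain ⟨C, hC, h⟩ := norm_regL_le h0 h1
  refine ⟨2 * C + 1, by linarith, η, h0, h1, fun q _ χ => ⟨differentiableOn_regL χ, fun s hs1 hs2 => ?_⟩⟩
  have hq : (1 : ℝ) ≤ q := by exact_mod_cast Nat.one_le_iff_ne_zero.2 (NeZero.ne q)
  refine (h q χ s hs1).trans ?_
  have h4 := conductor_norm_le hq h0 (by linarith) (by linarith : 2 * η ≤ ε) (s := s) (by linarith) hs2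
  have h5 : 0 ≤ (q * (|s.im| + 2) : ℝ) ^ ε := by positivity
  nlinarith

lemma subPoly_riemannZeta₀ {ε : ℝ} (hε : 0 < ε) : ∃ C : ℝ, 1 ≤ C ∧ ∃ r : ℝ, 0 < r ∧ r ≤ 1 / 2 ∧
    SubPoly riemannZeta₀ 1 C ε r := by
  set η := min (ε / 2) (1 / 2)
  have h0 : 0 < η := by positivity
  have h1 : η ≤ 1 / 2 := min_le_right _ _
  have h2 : η ≤ ε / 2 := min_le_left _ _
  obtain ⟨C, hC, h⟩ := norm_riemannZeta₀_le h0 h1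
  refine ⟨2 * C + 1, by linarith, η, h0, h1, ⟨differentiable_riemannZeta₀.differentiableOn, fun s hs1 hs2 => ?_⟩⟩
  refine (h s hs1).trans ?_
  have h4 := conductor_norm_le le_rfl h0 (by linarith) (by linarith : 2 * η ≤ ε) (s := s) (by linarith) hs2
  have h5 : 0 ≤ (1 * (|s.im| + 2) : ℝ) ^ ε := by positivity
  rw [one_mul] at h4
  nlinarith

lemma riemannZeta₁_ne_zero {s : ℂ} (hs : 1 ≤ s.re) : riemannZeta₁ s ≠ 0 := by
  by_cases h : s = 1
  · rw [h, riemannZeta₁_one]; exact one_ne_zero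
  · intro h0
    have := riemannZeta_ne_zero_of_one_le_re hs
    rw [riemannZeta_eq_inv_sub_mul h, h0, mul_zero] at this
    exact this rfl

lemma norm_riemannZeta_le : ∃ C : ℝ, 1 ≤ C ∧ ∀ σ : ℝ, 1 < σ → σ ≤ 2 → ‖riemannZeta σ‖ ≤ C / (σ - 1) := by
  obtain ⟨C, hC⟩ := (isCompact_Icc (a := (1 : ℝ)) (b := 2)).exists_bound_of_continuousOn
    (f := fun σ : ℝ => riemannZeta₁ σ) (by
      exact (differentiable_riemannZeta₁.continuous.comp Complex.continuous_ofReal).continuousOn)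
  refine ⟨max C 1, le_max_right _ _, fun σ h1 h2 => ?_⟩
  have : (σ : ℂ) ≠ 1 := by norm_cast; linarith
  rw [riemannZeta_eq_inv_sub_mul this, norm_mul, norm_inv, inv_mul_eq_div]
  have e : ‖(σ : ℂ) - 1‖ = σ - 1 := by
    rw [← Complex.ofReal_one, ← Complex.ofReal_sub, Complex.norm_real, Real.norm_of_nonneg (by linarith)]
  rw [e]
  have := hC σ ⟨h1.le, h2⟩
  have h3 : 0 < σ - 1 := by linarith
  gcongr
  exact this.trans (le_max_left _ _)

lemma norm_LSeries_le_of_norm_le_one {a : ℕ → ℂ} (ha : ∀ n, ‖a n‖ ≤ 1) {s : ℂ} (hs : 1 < s.re) :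
    ‖LSeries a s‖ ≤ ‖riemannZeta s.re‖ := by
  have hs' : 1 < ((s.re : ℝ) : ℂ).re := by simpa
  have hsum := (Real.summable_one_div_nat_rpow (p := s.re)).2 hs
  have e : riemannZeta s.re = ((∑' n : ℕ, 1 / (n : ℝ) ^ s.re : ℝ) : ℂ) := by
    rw [zeta_eq_tsum_one_div_nat_cpow hs']
    push_cast
    refine tsum_congr fun n => ?_
    rw [Complex.ofReal_cpow (by positivity)]; simp
  rw [e, Complex.norm_real, Real.norm_of_nonneg (tsum_nonneg fun n => by positivity)]
  refine tsum_of_norm_bounded hsum.hasSum fun n => ?_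
  rw [LSeries.norm_term_eq]
  split_ifs
  · positivity
  · gcongr; exact ha n

lemma three_four_one : ∃ C : ℝ, 1 ≤ C ∧ ∀ (q : ℕ) [NeZero q] (χ : DirichletCharacter ℂ q) (σ t : ℝ),
    1 < σ → σ ≤ 2 → (σ - 1) ^ 3 ≤ C * ‖LFunction χ (σ + t * Complex.I)‖ ^ 4 *
      ‖LFunction (χ ^ 2) (σ + (2 * t : ℝ) * Complex.I)‖ := by
  obtain ⟨C, hC, h⟩ := norm_riemannZeta_le
  refine ⟨C ^ 3, one_le_pow₀ hC, fun q _ χ σ t h1 h2 => ?_⟩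
  have h3 := norm_LSeries_product_ge_one χ (x := σ - 1) (by linarith) t
  have e1 : (1 : ℂ) + (σ - 1 : ℝ) = σ := by push_cast; ring
  have e2 : (1 : ℂ) + (σ - 1 : ℝ) + Complex.I * t = σ + t * Complex.I := by push_cast; ring
  have e3 : (1 : ℂ) + (σ - 1 : ℝ) + 2 * Complex.I * t = σ + (2 * t : ℝ) * Complex.I := by push_cast; ring
  rw [e2, e3, e1, ← LFunction_eq_LSeries χ (s := σ + t * Complex.I) (by simpa), ← LFunction_eq_LSeries (χ ^ 2) (by simpa),
    ← LFunction_eq_LSeries (1 : DirichletCharacter ℂ q) (by simpa), norm_mul, norm_mul,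
    norm_pow, norm_pow] at h3
  have h4 := (norm_LSeries_le_of_norm_le_one (a := fun n : ℕ => (1 : DirichletCharacter ℂ q) n) (s := σ)
    (fun n => DirichletCharacter.norm_le_one _ _) (by simpa)).trans (h σ h1 h2)
  rw [← LFunction_eq_LSeries (1 : DirichletCharacter ℂ q) (by simpa)] at h4
  have hσ : 0 < σ - 1 := by linarith
  have h5 : ‖LFunction (1 : DirichletCharacter ℂ q) σ‖ ^ 3 ≤ (C / (σ - 1)) ^ 3 := by gcongr
  calc (σ - 1) ^ 3 = (σ - 1) ^ 3 * 1 := by ring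
    _ ≤ (σ - 1) ^ 3 * ((C / (σ - 1)) ^ 3 * ‖LFunction χ (σ + t * Complex.I)‖ ^ 4 *
      ‖LFunction (χ ^ 2) (σ + (2 * t : ℝ) * Complex.I)‖) := by
        refine mul_le_mul_of_nonneg_left (h3.le.trans ?_) (by positivity)
        gcongr
    _ = _ := by field_simp

lemma norm_LFunction_le_div : ∃ C : ℝ, 1 ≤ C ∧ ∀ (q : ℕ) [NeZero q] (χ : DirichletCharacter ℂ q) (s : ℂ),
    1 < s.re → s.re ≤ 2 → ‖LFunction χ s‖ ≤ C / (s.re - 1) := by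
  obtain ⟨C, hC, h⟩ := norm_riemannZeta_le
  refine ⟨C, hC, fun q _ χ s h1 h2 => ?_⟩
  rw [LFunction_eq_LSeries χ h1]
  exact (norm_LSeries_le_of_norm_le_one (fun n => DirichletCharacter.norm_le_one _ _) h1).trans (h _ h1 h2)

/-- Far from the real axis, `ζ` and the imprimitive principal `L`-functions are subpolynomial. -/
lemma norm_LFunction_one_le {ε : ℝ} (hε : 0 < ε) : ∃ C : ℝ, 1 ≤ C ∧ ∀ (q : ℕ) [NeZero q]
    (χ : DirichletCharacter ℂ q) (s : ℂ), 1 < s.re → s.re ≤ 2 → s.im ≠ 0 →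
    ‖LFunction χ s‖ ≤ C * (q * (|s.im| + 2)) ^ ε + 1 / |s.im| := by
  obtain ⟨C, hC, r, hr, hr2, h⟩ := subPoly_regL hε
  obtain ⟨C', hC', r', hr', hr2', h'⟩ := subPoly_riemannZeta₀ hε
  refine ⟨C + C', by linarith, fun q _ χ s h1 h2 h3 => ?_⟩
  have hq : (1 : ℝ) ≤ q := by exact_mod_cast Nat.one_le_iff_ne_zero.2 (NeZero.ne q)
  have hq0 : 0 < q := Nat.pos_of_ne_zero (NeZero.ne q)
  rw [LFunction_eq_regL_add χ h1]
  have e1 := (h q χ).bound s (by linarith) (by linarith)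
  have e2 := h'.bound s (by linarith) (by linarith)
  have e3 : (1 * (|s.im| + 2)) ^ ε ≤ (q * (|s.im| + 2)) ^ ε := by gcongr
  have e4 : ‖(∑ a : ZMod q, χ a) * (q : ℂ) ^ (-s)‖ ≤ 1 := by
    rw [norm_mul, ← Complex.ofReal_natCast, Complex.norm_cpow_eq_rpow_re_of_pos (by positivity)]
    have : ‖∑ a : ZMod q, χ a‖ ≤ q := by
      refine (norm_sum_le_of_le _ (fun a _ => DirichletCharacter.norm_le_one χ a)).trans ?_
      simp [ZMod.card]
    calc _ ≤ (q : ℝ) * (q : ℝ) ^ (-s).re := by gcongr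
      _ ≤ (q : ℝ) * (q : ℝ) ^ (-1 : ℝ) := by
        gcongr
        simp; linarith
      _ = 1 := by rw [Real.rpow_neg_one]; field_simp
  have e5 : ‖riemannZeta s‖ ≤ 1 / |s.im| + ‖riemannZeta₀ s‖ := by
    rw [riemannZeta_eq_inv_sub_add (by rintro rfl; simp at h3)]
    refine (norm_add_le _ _).trans ?_
    gcongr
    rw [norm_inv, ← one_div]
    have := Complex.abs_im_le_norm (s - 1)
    simp only [Complex.sub_im, Complex.one_im, sub_zero] at this
    have h4 : 0 < |s.im| := abs_pos.2 h3
    gcongr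
  refine (norm_add_le _ _).trans ?_
  rw [norm_mul]
  have e6 : ‖(∑ a : ZMod q, χ a) * (q : ℂ) ^ (-s)‖ * ‖riemannZeta s‖ ≤ 1 * ‖riemannZeta s‖ := by gcongr
  nlinarith

end

section

open DirichletCharacter ComplexOrder

lemma isOpen_one_lt_re : IsOpen {s : ℂ | 1 < s.re} := isOpen_lt continuous_const Complex.continuous_re

/-- If `-f'/f` is a Dirichlet series with nonnegative coefficients then the derivatives of `f` alternate. -/
lemma alternating_of_deriv_eq {f : ℂ → ℂ} (hf : DifferentiableOn ℂ f {s | 1 < s.re}) {a : ℕ → ℂ} (ha : 0 ≤ a)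
    (hsum : ∀ y : ℝ, 1 < y → LSeriesSummable a y)
    (hd : ∀ s : ℂ, 1 < s.re → deriv f s = -(LSeries a s * f s)) (h2 : 0 ≤ f 2) (k : ℕ) :
    0 ≤ (-1) ^ k * iteratedDeriv k f 2 := by
  have habs : LSeries.abscissaOfAbsConv a ≤ (1 : ℝ) :=
    LSeries.abscissaOfAbsConv_le_of_forall_lt_LSeriesSummable hsum
  have hlt : LSeries.abscissaOfAbsConv a < ((2 : ℝ) : EReal) := habs.trans_lt (by exact_mod_cast one_lt_two)
  have hmem : {s : ℂ | 1 < s.re} ∈ nhds (2 : ℂ) := isOpen_one_lt_re.mem_nhds (by simp)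
  have hfc : ∀ n : ℕ, ContDiffAt ℂ n f 2 := fun n => (hf.analyticAt hmem).contDiffAt
  have hGd : DifferentiableOn ℂ (LSeries a) {s : ℂ | 1 < s.re} := by
    intro s hs
    refine (LSeries_hasDerivAt ?_).differentiableAt.differentiableWithinAt
    exact habs.trans_lt (by exact_mod_cast hs)
  have hGc : ∀ n : ℕ, ContDiffAt ℂ n (LSeries a) 2 := fun n => (hGd.analyticAt hmem).contDiffAt
  induction k using Nat.strong_induction_on with
  | _ k ih =>
    rcases k with _ | k
    · simpa using h2
    · have e : iteratedDeriv (k + 1) f 2 = -iteratedDeriv k (LSeries a * f) 2 := by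
        rw [iteratedDeriv_succ', ← iteratedDeriv_neg]
        refine Filter.EventuallyEq.iteratedDeriv_eq k ?_
        filter_upwards [hmem] with s hs
        rw [hd s hs]; rfl
      rw [e, iteratedDeriv_mul (hGc k) (hfc k), mul_neg, ← neg_mul, ← neg_one_mul ((-1 : ℂ) ^ (k + 1)), ← pow_succ',
        Finset.mul_sum]
      refine Finset.sum_nonneg fun i hi => ?_
      have hi' : i ≤ k := by simpa [Nat.lt_succ_iff] using hi
      have h3 := LSeries.iteratedDeriv_alternating ha hlt i
      have h4 := ih (k - i) (by omega)
      have e2 : (-1 : ℂ) ^ (k + 1 + 1) * ((k.choose i : ℂ) * iteratedDeriv i (LSeries a) 2 *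
          iteratedDeriv (k - i) f 2) = (k.choose i : ℂ) * (((-1) ^ i * iteratedDeriv i (LSeries a) (2 : ℝ)) *
          ((-1) ^ (k - i) * iteratedDeriv (k - i) f 2)) := by
        have : (-1 : ℂ) ^ (k + 1 + 1) = (-1) ^ i * (-1) ^ (k - i) := by
          rw [← pow_add, Nat.add_sub_cancel' hi']; ring
        rw [this]; push_cast; ring
      rw [e2]
      exact mul_nonneg (by exact_mod_cast Nat.zero_le _) (mul_nonneg h3 h4)

lemma iteratedDeriv_inv_sub_one (k : ℕ) :
    iteratedDeriv k (fun s : ℂ => (s - 1)⁻¹) 2 = (-1) ^ k * k.factorial := by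
  have := congrFun (iteratedDeriv_comp_add_const k (Inv.inv : ℂ → ℂ) (-1)) 2
  simp only [← sub_eq_add_neg] at this
  rw [this, iteratedDeriv_eq_iterate, iter_deriv_inv]
  norm_num

lemma estermann : ∃ C : ℝ, 1 ≤ C ∧ ∀ (g : ℂ → ℂ) (a : ℕ → ℂ) (b β M : ℝ),
    DifferentiableOn ℂ g {s | 0 < s.re} → 0 ≤ a → (∀ y : ℝ, 1 < y → LSeriesSummable a y) →
    (∀ s : ℂ, 1 < s.re → deriv (fun s => riemannZeta s * g s) s = -(LSeries a s * (riemannZeta s * g s))) →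
    0 ≤ b → (b : ℂ) ≤ riemannZeta 2 * g 2 → 3 / 4 ≤ β → β < 1 →
    (∀ z : ℂ, ‖z - 2‖ = 3 / 2 → ‖g z‖ ≤ M) → ‖g 1‖ ≤ M → (riemannZeta β * g β).re ≤ 0 → ∀ K : ℕ,
    b ≤ ‖g 1‖ * (2 - β) ^ K / (1 - β) + C * M * (5 / 6) ^ K := by
  obtain ⟨C₀, hC₀⟩ := (isCompact_sphere (2 : ℂ) (3 / 2)).exists_bound_of_continuousOn
    (f := riemannZeta₀) differentiable_riemannZeta₀.continuous.continuousOn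
  refine ⟨6 * (|C₀| + 4) + 1, by linarith [abs_nonneg C₀], ?_⟩
  intro g a b β M hg ha hsum hd hb hb2 hβ hβ1 hM hM1 hneg K
  set h : ℂ → ℂ := fun s => riemannZeta₀ s * g s + dslope g 1 s with hh
  have hU1 : {s : ℂ | 0 < s.re} ∈ nhds (1 : ℂ) := isOpen_re_pos.mem_nhds (by simp)
  have hhd : DifferentiableOn ℂ h {s | 0 < s.re} :=
    (differentiable_riemannZeta₀.differentiableOn.mul hg).add ((Complex.differentiableOn_dslope hU1).2 hg)
  have hheq : ∀ s : ℂ, s ≠ 1 → h s = riemannZeta s * g s - g 1 * (s - 1)⁻¹ := by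
    intro s hs
    rw [hh]
    simp only
    rw [riemannZeta_eq_inv_sub_add hs, dslope_of_ne _ hs, slope_def_field]
    have : s - 1 ≠ 0 := sub_ne_zero.2 hs
    field_simp
    ring
  have hM0 : 0 ≤ M := (norm_nonneg _).trans hM1
  have hsub : Metric.closedBall (2 : ℂ) (3 / 2) ⊆ {s | 0 < s.re} := by
    intro z hz
    have := (Complex.abs_re_le_norm (z - 2)).trans (by simpa [dist_eq_norm] using hz)
    rw [Complex.sub_re, abs_le] at this
    have h2 : (2 : ℂ).re = 2 := rfl
    show 0 < z.re
    linarith [this.1]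
  have hsph : ∀ z ∈ Metric.sphere (2 : ℂ) (3 / 2), ‖h z‖ ≤ (|C₀| + 4) * M := by
    intro z hz
    have hz' : ‖z - 2‖ = 3 / 2 := by simpa using hz
    have hz1 : 1 / 2 ≤ ‖z - 1‖ := by
      have := norm_sub_le (z - 1) 1
      rw [show z - 1 - 1 = z - 2 by ring, norm_one] at this
      linarith
    have hne : z ≠ 1 := by rintro rfl; norm_num at hz1
    have e1 : ‖dslope g 1 z‖ ≤ 4 * M := by
      rw [dslope_of_ne _ hne, slope_def_field, norm_div, div_le_iff₀ (by linarith)]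
      have := norm_sub_le (g z) (g 1)
      have := hM z hz'
      nlinarith
    refine (norm_add_le _ _).trans ?_
    rw [norm_mul]
    have := mul_le_mul ((hC₀ z hz).trans (le_abs_self _)) (hM z hz') (norm_nonneg _) (abs_nonneg _)
    linarith
  have hcoef : ∀ k : ℕ, ‖iteratedDeriv k h 2‖ ≤ k.factorial * ((|C₀| + 4) * M) / (3 / 2) ^ k := fun k =>
    Complex.norm_iteratedDeriv_le_of_forall_mem_sphere_norm_le k (by norm_num)
      ((hhd.mono (Metric.closure_ball_subset_closedBall.trans hsub)).diffContOnCl) hsph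
  have hβmem : (β : ℂ) ∈ Metric.ball (2 : ℂ) (3 / 2) := by
    rw [Metric.mem_ball, dist_eq_norm, show (β : ℂ) - 2 = ((β - 2 : ℝ) : ℂ) by push_cast; ring, Complex.norm_real,
      Real.norm_eq_abs, abs_lt]
    constructor <;> linarith
  have htaylor := Complex.hasSum_taylorSeries_on_ball
    (hhd.mono (Metric.ball_subset_closedBall.trans hsub)) hβmem
  have hβsub : (β : ℂ) - 2 = -((2 - β : ℝ) : ℂ) := by push_cast; ring
  have hterm : ∀ k : ℕ, ‖((k.factorial : ℂ))⁻¹ • ((β : ℂ) - 2) ^ k • iteratedDeriv k h 2‖ ≤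
      ((|C₀| + 4) * M) * (5 / 6) ^ k := by
    intro k
    rw [norm_smul, norm_smul, norm_inv, norm_pow, hβsub, norm_neg, Complex.norm_real, Real.norm_of_nonneg (by linarith),
      Complex.norm_natCast]
    have hk : (0 : ℝ) < k.factorial := by exact_mod_cast Nat.factorial_pos k
    have : (2 - β) ^ k ≤ (5 / 4) ^ k := pow_le_pow_left₀ (by linarith) (by linarith) k
    calc _ ≤ (k.factorial : ℝ)⁻¹ * ((5 / 4) ^ k * (k.factorial * ((|C₀| + 4) * M) / (3 / 2) ^ k)) := by
          gcongr
          exact hcoef k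
      _ = ((|C₀| + 4) * M) * ((5 / 4) ^ k / (3 / 2) ^ k) := by field_simp
      _ = _ := by rw [← div_pow]; norm_num
  have htail := norm_sub_le_of_geometric_bound_of_hasSum (by norm_num) hterm htaylor K
  have hfd : DifferentiableOn ℂ (fun s => riemannZeta s * g s) {s | 1 < s.re} := by
    intro s hs
    have hs : 1 < s.re := hs
    refine (DifferentiableAt.mul (differentiableAt_riemannZeta ?_)
      (hg.differentiableAt (isOpen_re_pos.mem_nhds (by show 0 < s.re; linarith)))).differentiableWithinAt
    rintro rfl; simp at hs
  have hb' : (0 : ℂ) ≤ b := by exact_mod_cast hb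
  have halt := alternating_of_deriv_eq hfd ha hsum hd (hb'.trans hb2)
  have hmem : {s : ℂ | 1 < s.re} ∈ nhds (2 : ℂ) := isOpen_one_lt_re.mem_nhds (by simp)
  have hder : ∀ k : ℕ, iteratedDeriv k h 2 = iteratedDeriv k (fun s => riemannZeta s * g s) 2 -
      g 1 * ((-1) ^ k * k.factorial) := by
    intro k
    have : h =ᶠ[nhds 2] (fun s => riemannZeta s * g s) - fun s => g 1 * (s - 1)⁻¹ := by
      filter_upwards [hmem] with s hs
      have hs : 1 < s.re := hs
      exact hheq s (by rintro rfl; simp at hs)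
    have hcd : ContDiffAt ℂ k (fun s : ℂ => (s - 1)⁻¹) 2 := by
      refine ContDiffAt.inv (by fun_prop) (by norm_num)
    rw [this.iteratedDeriv_eq, iteratedDeriv_sub (hfd.analyticAt hmem).contDiffAt (contDiffAt_const.mul hcd),
      iteratedDeriv_const_mul _ hcd, iteratedDeriv_inv_sub_one]
  set lam := (g 1).re with hlam
  have hre : ∀ k : ℕ, (if k = 0 then b else 0) - lam * (2 - β) ^ k ≤
      (((k.factorial : ℂ))⁻¹ • ((β : ℂ) - 2) ^ k • iteratedDeriv k h 2).re := by
    intro k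
    have hk : (k.factorial : ℂ) ≠ 0 := by exact_mod_cast k.factorial_ne_zero
    have e : ((k.factorial : ℂ))⁻¹ • ((β : ℂ) - 2) ^ k • iteratedDeriv k h 2 =
        (((k.factorial : ℝ)⁻¹ * (2 - β) ^ k : ℝ) : ℂ) * ((-1) ^ k *
          iteratedDeriv k (fun s => riemannZeta s * g s) 2) - (((2 - β) ^ k : ℝ) : ℂ) * g 1 := by
      rw [hder, hβsub, neg_pow, smul_eq_mul, smul_eq_mul]
      have : ((-1 : ℂ) ^ k) * (-1) ^ k = 1 := by rw [← mul_pow]; simp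
      push_cast
      field_simp
      linear_combination (-(g 1) * (2 - β) ^ k * k.factorial) * this
    rw [e, Complex.sub_re, Complex.re_ofReal_mul, Complex.re_ofReal_mul]
    have h1 := halt k
    rw [Complex.le_def] at h1
    have h1 : 0 ≤ ((-1) ^ k * iteratedDeriv k (fun s => riemannZeta s * g s) 2).re := h1.1
    have h2 : (if k = 0 then b else 0) ≤ (k.factorial : ℝ)⁻¹ * (2 - β) ^ k *
        ((-1) ^ k * iteratedDeriv k (fun s => riemannZeta s * g s) 2).re := by
      split_ifs with h0
      · subst h0
        rw [Complex.le_def] at hb2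
        simpa using hb2.1
      · have : 0 ≤ (2 - β) ^ k := pow_nonneg (by linarith) k
        positivity
    linarith
  have hsumre : b * (if K = 0 then 0 else 1) - lam * (((2 - β) ^ K - 1) / (1 - β)) ≤
      (∑ k ∈ Finset.range K, ((k.factorial : ℂ))⁻¹ • ((β : ℂ) - 2) ^ k • iteratedDeriv k h 2).re := by
    rw [Complex.re_sum]
    refine le_trans (le_of_eq ?_) (Finset.sum_le_sum fun k _ => hre k)
    rw [Finset.sum_sub_distrib, ← Finset.mul_sum, geom_sum_eq (by linarith), Finset.sum_ite_eq']
    rw [show 2 - β - 1 = 1 - β by ring]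
    rcases K with _ | K <;> simp
  have hhβ : (h β).re ≤ lam / (1 - β) := by
    have hne : (β : ℂ) ≠ 1 := by norm_cast; exact hβ1.ne
    rw [hheq β hne, Complex.sub_re]
    have : g 1 * ((β : ℂ) - 1)⁻¹ = (((β - 1)⁻¹ : ℝ) : ℂ) * g 1 := by push_cast; ring
    rw [this, Complex.re_ofReal_mul]
    have : (β - 1)⁻¹ * (g 1).re = -(lam / (1 - β)) := by
      rw [hlam, show β - 1 = -(1 - β) by ring, inv_neg]; field_simp
    linarith
  have hKtail := (abs_le.1 ((Complex.abs_re_le_norm _).trans htail)).2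
  rw [Complex.sub_re] at hKtail
  have e1 : (|C₀| + 4) * M * (5 / 6) ^ K / (1 - 5 / 6) = 6 * (|C₀| + 4) * M * (5 / 6) ^ K := by ring
  rw [e1] at hKtail
  have h1β : 0 < 1 - β := by linarith
  have hp : 0 ≤ (2 - β) ^ K := pow_nonneg (by linarith) K
  have hlamle : lam * (2 - β) ^ K / (1 - β) ≤ ‖g 1‖ * (2 - β) ^ K / (1 - β) := by
    gcongr
    exact Complex.re_le_norm _
  have hMK : 0 ≤ M * (5 / 6) ^ K := by positivity
  rcases K with _ | K
  · have hb3 : b ≤ 6 * (|C₀| + 4) * M := by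
      have h0 := hterm 0
      have h1 := hre 0
      have h2 := (Complex.re_le_norm _).trans h0
      simp only [if_true, pow_zero, mul_one] at h1 h2
      have h3 := (Complex.re_le_norm (g 1)).trans hM1
      nlinarith [abs_nonneg C₀]
    have : 0 ≤ ‖g 1‖ * (2 - β) ^ 0 / (1 - β) := by positivity
    simp only [pow_zero] at *
    nlinarith [abs_nonneg C₀]
  · simp only [Nat.succ_ne_zero, if_false, mul_one] at hsumre
    have e2 : lam * (((2 - β) ^ (K + 1) - 1) / (1 - β)) = lam * (2 - β) ^ (K + 1) / (1 - β) - lam / (1 - β) := by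
      ring
    rw [e2] at hsumre
    linarith

end

section

open DirichletCharacter ComplexOrder

lemma siegel_core {b : ℝ} (hb : 0 < b) (hb1 : b ≤ 1) : ∃ c : ℝ, 0 < c ∧ ∀ (g : ℂ → ℂ) (a : ℕ → ℂ) (β M : ℝ),
    DifferentiableOn ℂ g {s | 0 < s.re} → 0 ≤ a → (∀ y : ℝ, 1 < y → LSeriesSummable a y) →
    (∀ s : ℂ, 1 < s.re → deriv (fun s => riemannZeta s * g s) s = -(LSeries a s * (riemannZeta s * g s))) →
    (b : ℂ) ≤ riemannZeta 2 * g 2 → 3 / 4 ≤ β → β < 1 → 1 ≤ M →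
    (∀ z : ℂ, ‖z - 2‖ = 3 / 2 → ‖g z‖ ≤ M) → ‖g 1‖ ≤ M → (riemannZeta β * g β).re ≤ 0 →
    c * (1 - β) * M ^ (-(6 * (1 - β))) ≤ ‖g 1‖ := by
  obtain ⟨C, hC, h⟩ := estermann
  refine ⟨b / 2 / (Real.exp 1 * (2 * C / b) ^ (2 : ℝ)), by positivity, ?_⟩
  intro g a β M h1 h2 h3 h4 h5 h6 h7 hM1 h8 h9 h10
  have hM0 : 0 < M := by linarith
  set Y := 2 * C * M / b with hY
  have hCb : 1 ≤ 2 * C / b := by rw [le_div_iff₀ hb]; linarith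
  have hYe : Y = 2 * C / b * M := by rw [hY]; ring
  have hY1 : 1 ≤ Y := by rw [hYe]; exact one_le_mul_of_one_le_of_one_le hCb hM1
  have hlog : 0 ≤ Real.log Y := Real.log_nonneg hY1
  set K := ⌈6 * Real.log Y⌉₊
  have hK1 : 6 * Real.log Y ≤ K := Nat.le_ceil _
  have hK2 : (K : ℝ) ≤ 6 * Real.log Y + 1 := (Nat.ceil_lt_add_one (by positivity)).le
  have key := h g a b β M h1 h2 h3 h4 hb.le h5 h6 h7 h8 h9 h10 K
  have h1β : 0 < 1 - β := by linarith
  have e1 : (5 / 6 : ℝ) ^ K ≤ b / (2 * C * M) := by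
    have : (5 / 6 : ℝ) ≤ Real.exp (-(1 / 6)) := by
      have := Real.add_one_le_exp (-(1 / 6) : ℝ)
      linarith
    calc (5 / 6 : ℝ) ^ K ≤ Real.exp (-(1 / 6)) ^ K := by gcongr
      _ = Real.exp (-(K / 6)) := by rw [← Real.exp_nat_mul]; ring_nf
      _ ≤ Real.exp (-Real.log Y) := by gcongr; linarith
      _ = b / (2 * C * M) := by rw [Real.exp_neg, Real.exp_log (by linarith), hY, inv_div]
  have e2 : C * M * (5 / 6) ^ K ≤ b / 2 := by
    calc _ ≤ C * M * (b / (2 * C * M)) := by gcongr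
      _ = b / 2 := by field_simp
  have e3 : (2 - β) ^ K ≤ Real.exp 1 * (2 * C / b) ^ (2 : ℝ) * M ^ (6 * (1 - β)) := by
    calc (2 - β) ^ K ≤ Real.exp (1 - β) ^ K := by
          gcongr
          · linarith
          · linarith [Real.add_one_le_exp (1 - β)]
      _ = Real.exp (K * (1 - β)) := by rw [← Real.exp_nat_mul]
      _ ≤ Real.exp (1 + Real.log Y * (6 * (1 - β))) := by
          gcongr
          nlinarith
      _ = Real.exp 1 * Y ^ (6 * (1 - β)) := by
          rw [Real.exp_add, Real.rpow_def_of_pos (by linarith)]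
      _ = Real.exp 1 * ((2 * C / b) ^ (6 * (1 - β)) * M ^ (6 * (1 - β))) := by
          rw [hYe, Real.mul_rpow (by positivity) hM0.le]
      _ ≤ Real.exp 1 * ((2 * C / b) ^ (2 : ℝ) * M ^ (6 * (1 - β))) := by
          gcongr
          linarith
      _ = _ := by ring
  have e4 : b / 2 ≤ ‖g 1‖ * (2 - β) ^ K / (1 - β) := by linarith
  rw [le_div_iff₀ h1β] at e4
  have e5 := e4.trans (mul_le_mul_of_nonneg_left e3 (norm_nonneg _))
  rw [Real.rpow_neg hM0.le]
  have : 0 < M ^ (6 * (1 - β)) := by positivity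
  rw [div_mul_eq_mul_div, ← div_eq_mul_inv, div_div, div_le_iff₀ (by positivity)]
  linarith

section Quadratic

variable {q : ℕ} {χ : DirichletCharacter ℂ q}

lemma conj_apply_of_sq_eq_one (h : χ ^ 2 = 1) (a : ZMod q) : (starRingEnd ℂ) (χ a) = χ a := by
  by_cases ha : IsUnit a
  · have : χ a ^ 2 = 1 := by
      rw [← MulChar.pow_apply' χ two_ne_zero, h, MulChar.one_apply ha]
    rcases mul_self_eq_one_iff.1 ((sq (χ a)).symm.trans this) with h | h <;> simp [h]
  · simp [MulChar.map_nonunit χ ha]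

lemma neg_one_le_apply_of_sq_eq_one (h : χ ^ 2 = 1) (a : ZMod q) : 0 ≤ 1 + χ a := by
  by_cases ha : IsUnit a
  · have : χ a ^ 2 = 1 := by
      rw [← MulChar.pow_apply' χ two_ne_zero, h, MulChar.one_apply ha]
    rcases mul_self_eq_one_iff.1 ((sq (χ a)).symm.trans this) with h | h
    · rw [h]; norm_num
    · simp [h]
  · simp [MulChar.map_nonunit χ ha]

lemma regL_ofReal_im (h : χ ^ 2 = 1) (β : ℝ) : (regL χ β).im = 0 := by
  rw [← Complex.conj_eq_iff_im, regL, Complex.conj_tsum]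
  refine tsum_congr fun n => ?_
  rw [regTerm, map_mul, conj_apply_of_sq_eq_one h, map_sub, ← Complex.ofReal_neg,
    ← Complex.ofReal_cpow (by positivity), ← Complex.ofReal_cpow (by positivity), Complex.conj_ofReal, Complex.conj_ofReal]

end Quadratic

lemma riemannZeta_two_re_lt : ‖riemannZeta 2‖ ≤ 7 / 4 := by
  rw [riemannZeta_two]
  have : (Real.pi : ℂ) ^ 2 / 6 = ((Real.pi ^ 2 / 6 : ℝ) : ℂ) := by push_cast; ring
  rw [this, Complex.norm_real, Real.norm_of_nonneg (by positivity)]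
  have := Real.pi_lt_d2
  have := Real.pi_pos
  nlinarith

lemma quarter_le_LFunction_two {q : ℕ} [NeZero q] {χ : DirichletCharacter ℂ q} (h : χ ^ 2 = 1) (h1 : χ ≠ 1) :
    (1 / 4 : ℂ) ≤ LFunction χ 2 := by
  have him : (LFunction χ 2).im = 0 := by
    rw [LFunction_eq_regL h1 (by simp)]
    exact_mod_cast regL_ofReal_im h 2
  have hre : 1 / 4 ≤ (LFunction χ 2).re := by
    have e1 : LFunction χ 2 + riemannZeta 2 = LSeries (fun n => 1 + χ n) 2 := by
      rw [LFunction_eq_LSeries χ (by simp), ← LSeries_one_eq_riemannZeta (by simp)]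
      rw [add_comm, ← LSeries_add]
      · rfl
      · exact LSeriesSummable_one_iff.2 (by simp)
      · exact LSeriesSummable_of_one_lt_re χ (by simp)
    have hs : LSeriesSummable (fun n => 1 + χ n) 2 := by
      exact LSeriesSummable.add (LSeriesSummable_one_iff.2 (by simp)) (LSeriesSummable_of_one_lt_re χ (by simp))
    have e2 : 2 ≤ (LSeries (fun n => 1 + χ n) 2).re := by
      rw [LSeries, Complex.re_tsum hs]
      have hs' : Summable fun n : ℕ => (LSeries.term (fun n => 1 + χ n) 2 n).re := by
        exact Complex.reCLM.summable hs
      have hnn : ∀ n : ℕ, 0 ≤ (LSeries.term (fun n => 1 + χ n) 2 n).re := by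
        intro n
        have : 0 ≤ LSeries.term (fun n => 1 + χ n) 2 n := by
          have := LSeries.term_nonneg (a := fun n : ℕ => 1 + χ n) (n := n) (neg_one_le_apply_of_sq_eq_one h _) 2
          exact_mod_cast this
        rw [Complex.le_def] at this
        exact this.1
      refine le_trans (le_of_eq ?_) (hs'.le_tsum 1 fun n _ => hnn n)
      simp [LSeries.term]; norm_num
    have e3 := congrArg Complex.re e1
    rw [Complex.add_re] at e3
    have := (Complex.re_le_norm _).trans riemannZeta_two_re_lt
    linarith
  rw [Complex.le_def]
  constructor
  · norm_num at hre ⊢; exact hre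
  · rw [him]; simp

end

section

open DirichletCharacter ComplexOrder ArithmeticFunction

/-- The coefficients `χ(n) Λ(n)`. -/
noncomputable def twistLambda {q : ℕ} (χ : DirichletCharacter ℂ q) : ℕ → ℂ :=
  (fun n : ℕ => χ n) * fun n : ℕ => (vonMangoldt n : ℂ)

noncomputable def cLambda : ℕ → ℂ := fun n => (vonMangoldt n : ℂ)

lemma deriv_LFunction_eq {q : ℕ} [NeZero q] (χ : DirichletCharacter ℂ q) {s : ℂ} (hs : 1 < s.re) :
    deriv (LFunction χ) s = -(LSeries (twistLambda χ) s * LFunction χ s) := by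
  rw [twistLambda, LSeries_twist_vonMangoldt_eq χ hs, LFunction_eq_LSeries χ hs,
    deriv_LFunction_eq_deriv_LSeries χ hs]
  have := LSeries_ne_zero_of_one_lt_re χ hs
  field_simp

lemma deriv_riemannZeta_eq {s : ℂ} (hs : 1 < s.re) :
    deriv riemannZeta s = -(LSeries cLambda s * riemannZeta s) := by
  rw [show LSeries cLambda s = _ from LSeries_vonMangoldt_eq_deriv_riemannZeta_div hs]
  have := riemannZeta_ne_zero_of_one_le_re hs.le
  field_simp

lemma differentiableAt_riemannZeta_of_one_lt {s : ℂ} (hs : 1 < s.re) : DifferentiableAt ℂ riemannZeta s :=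
  differentiableAt_riemannZeta (by rintro rfl; simp at hs)

lemma lseriesSummable_cLambda {s : ℂ} (hs : 1 < s.re) : LSeriesSummable cLambda s :=
  LSeriesSummable_vonMangoldt hs

lemma lseriesSummable_twistLambda {q : ℕ} (χ : DirichletCharacter ℂ q) {s : ℂ} (hs : 1 < s.re) :
    LSeriesSummable (twistLambda χ) s := LSeriesSummable_twist_vonMangoldt χ hs

lemma norm_LFunction_le_level : ∃ C : ℝ, 1 ≤ C ∧ ∀ (q : ℕ) [NeZero q] (χ : DirichletCharacter ℂ q), χ ≠ 1 →
    (∀ z : ℂ, ‖z - 2‖ = 3 / 2 → ‖LFunction χ z‖ ≤ C * q) ∧ ‖LFunction χ 1‖ ≤ C * q := by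
  obtain ⟨C, hC, h⟩ := norm_regL_le (η := 1 / 2) (by norm_num) le_rfl
  have key : ∀ (q : ℕ) [NeZero q] (χ : DirichletCharacter ℂ q), χ ≠ 1 → ∀ z : ℂ, ‖z - 2‖ ≤ 3 / 2 →
      ‖LFunction χ z‖ ≤ (4 * C + 1) * q := by
    intro q _ χ hχ z hz
    have h1 := (Complex.abs_re_le_norm (z - 2)).trans hz
    rw [Complex.sub_re, abs_le, show (2 : ℂ).re = 2 from rfl] at h1
    rw [LFunction_eq_regL hχ (by linarith [h1.1])]
    refine (h q χ z (by linarith [h1.1])).trans ?_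
    have h2 : ‖z‖ ≤ 4 := by
      have := norm_add_le (z - 2) 2
      rw [sub_add_cancel, Complex.norm_ofNat] at this
      linarith
    norm_num
    have hq : (0 : ℝ) ≤ q := by positivity
    have : (q : ℝ) * ‖z‖ ≤ q * 4 := by gcongr
    nlinarith
  refine ⟨4 * C + 1, by linarith, fun q _ χ hχ => ⟨fun z hz => key q χ hχ z hz.le, key q χ hχ 1 ?_⟩⟩
  norm_num

/-- Siegel's bound conditionally on a sign change (or zero) of `ζ L` near `1`. -/
lemma siegel_two_factor : ∃ c C : ℝ, 0 < c ∧ 1 ≤ C ∧ ∀ (q : ℕ) [NeZero q] (χ : DirichletCharacter ℂ q), χ ≠ 1 →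
    χ ^ 2 = 1 → ∀ β : ℝ, 3 / 4 ≤ β → β < 1 → (riemannZeta β * LFunction χ β).re ≤ 0 →
    c * (1 - β) * (C * q) ^ (-(6 * (1 - β))) ≤ ‖LFunction χ 1‖ := by
  obtain ⟨c, hc, h⟩ := siegel_core (b := 1 / 4) (by norm_num) (by norm_num)
  obtain ⟨C, hC, hM⟩ := norm_LFunction_le_level
  refine ⟨c, C, hc, hC, fun q _ χ hχ h2 β hβ hβ1 hneg => ?_⟩
  have hq : (1 : ℝ) ≤ q := by exact_mod_cast Nat.one_le_iff_ne_zero.2 (NeZero.ne q)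
  refine h (LFunction χ) (cLambda + twistLambda χ) β (C * q) (differentiable_LFunction hχ).differentiableOn ?_ ?_ ?_
    ?_ hβ hβ1 (by nlinarith) (hM q χ hχ).1 (hM q χ hχ).2 hneg
  · intro n
    have h3 := neg_one_le_apply_of_sq_eq_one h2 (n : ZMod q)
    have h4 : (0 : ℂ) ≤ vonMangoldt n := by exact_mod_cast vonMangoldt_nonneg
    have : (cLambda + twistLambda χ) n = (1 + χ n) * vonMangoldt n := by
      simp [cLambda, twistLambda]; ring
    rw [this]; exact mul_nonneg h3 h4
  · intro y hy
    exact (lseriesSummable_cLambda (by simpa)).add (lseriesSummable_twistLambda χ (by simpa))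
  · intro s hs
    rw [LSeries_add (lseriesSummable_cLambda hs) (lseriesSummable_twistLambda χ hs)]
    rw [deriv_fun_mul (differentiableAt_riemannZeta_of_one_lt hs) (differentiable_LFunction hχ s),
      deriv_LFunction_eq χ hs, deriv_riemannZeta_eq hs]
    ring
  · have h3 := quarter_le_LFunction_two h2 hχ
    have h4 : (1 : ℂ) ≤ riemannZeta 2 := by
      rw [riemannZeta_two, show (Real.pi : ℂ) ^ 2 / 6 = ((Real.pi ^ 2 / 6 : ℝ) : ℂ) by push_cast; ring]
      have := Real.pi_gt_three
      have : 1 ≤ Real.pi ^ 2 / 6 := by nlinarith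
      exact_mod_cast this
    have h5 : (0 : ℂ) ≤ LFunction χ 2 := le_trans (by positivity) h3
    calc ((1 / 4 : ℝ) : ℂ) = 1 / 4 := by push_cast; rfl
      _ ≤ LFunction χ 2 := h3
      _ = 1 * LFunction χ 2 := (one_mul _).symm
      _ ≤ _ := mul_le_mul_of_nonneg_right h4 h5

/-- Product of two characters at the product level. -/
noncomputable def prodChar {q₁ q₂ : ℕ} (χ₁ : DirichletCharacter ℂ q₁) (χ₂ : DirichletCharacter ℂ q₂) :
    DirichletCharacter ℂ (q₁ * q₂) :=
  changeLevel (dvd_mul_right q₁ q₂) χ₁ * changeLevel (dvd_mul_left q₂ q₁) χ₂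

lemma prodChar_apply {q₁ q₂ : ℕ} (χ₁ : DirichletCharacter ℂ q₁) (χ₂ : DirichletCharacter ℂ q₂) (n : ℕ) :
    prodChar χ₁ χ₂ n = χ₁ n * χ₂ n := by
  by_cases h : IsUnit (n : ZMod (q₁ * q₂))
  · obtain ⟨u, hu⟩ := h
    rw [prodChar, MulChar.mul_apply, ← hu, changeLevel_eq_cast_of_dvd, changeLevel_eq_cast_of_dvd, hu,
      ZMod.cast_natCast (dvd_mul_right q₁ q₂), ZMod.cast_natCast (dvd_mul_left q₂ q₁)]
  · rw [MulChar.map_nonunit _ h]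
    rw [ZMod.isUnit_iff_coprime, Nat.coprime_mul_iff_right] at h
    by_cases h1 : n.Coprime q₁
    · have h2 : ¬ IsUnit (n : ZMod q₂) := by
        rw [ZMod.isUnit_iff_coprime]; tauto
      rw [MulChar.map_nonunit _ h2, mul_zero]
    · have h2 : ¬ IsUnit (n : ZMod q₁) := by
        rw [ZMod.isUnit_iff_coprime]; tauto
      rw [MulChar.map_nonunit _ h2, zero_mul]

lemma prodChar_ne_one {q₁ q₂ : ℕ} [NeZero q₁] [NeZero q₂] {χ₁ : DirichletCharacter ℂ q₁}
    {χ₂ : DirichletCharacter ℂ q₂} (h1 : χ₁ ≠ 1) (h2 : χ₂ ≠ 1) (hsq : χ₂ ^ 2 = 1) {β : ℝ} (hβ : 0 < β)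
    (h0 : LFunction χ₁ β = 0) (h0' : LFunction χ₂ β ≠ 0) : prodChar χ₁ χ₂ ≠ 1 := by
  intro h
  have e : changeLevel (dvd_mul_right q₁ q₂) χ₁ = changeLevel (dvd_mul_left q₂ q₁) χ₂ := by
    have h3 : changeLevel (dvd_mul_left q₂ q₁) χ₂ * changeLevel (dvd_mul_left q₂ q₁) χ₂ = 1 := by
      rw [← map_mul, ← sq, hsq, map_one]
    calc _ = changeLevel (dvd_mul_right q₁ q₂) χ₁ * (changeLevel (dvd_mul_left q₂ q₁) χ₂ *
          changeLevel (dvd_mul_left q₂ q₁) χ₂) := by rw [h3, mul_one]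
      _ = prodChar χ₁ χ₂ * changeLevel (dvd_mul_left q₂ q₁) χ₂ := by rw [prodChar, mul_assoc]
      _ = _ := by rw [h, one_mul]
  have e1 := LFunction_changeLevel (dvd_mul_right q₁ q₂) χ₁ (s := β) (Or.inl h1)
  have e2 := LFunction_changeLevel (dvd_mul_left q₂ q₁) χ₂ (s := β) (Or.inl h2)
  rw [e, e2, h0, zero_mul, mul_eq_zero] at e1
  rcases e1 with e1 | e1
  · exact h0' e1
  · rw [Finset.prod_eq_zero_iff] at e1
    obtain ⟨p, hp, hp0⟩ := e1
    have hp1 : p.Prime := Nat.prime_of_mem_primeFactors hp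
    have h5 : ‖χ₂ p * (p : ℂ) ^ (-(β : ℂ))‖ < 1 := by
      rw [norm_mul]
      have h6 : ‖(p : ℂ) ^ (-(β : ℂ))‖ < 1 := by
        rw [← Complex.ofReal_natCast, Complex.norm_cpow_eq_rpow_re_of_pos (by exact_mod_cast hp1.pos)]
        apply Real.rpow_lt_one_of_one_lt_of_neg
        · exact_mod_cast hp1.one_lt
        · simpa
      exact (mul_le_of_le_one_left (norm_nonneg _) (DirichletCharacter.norm_le_one _ _)).trans_lt h6
    rw [sub_eq_zero] at hp0
    rw [← hp0, norm_one] at h5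
    exact lt_irrefl _ h5

lemma siegel_four_factor : ∃ c C : ℝ, 0 < c ∧ 1 ≤ C ∧ ∀ (q₁ q₂ : ℕ) [NeZero q₁] [NeZero q₂]
    (χ₁ : DirichletCharacter ℂ q₁) (χ₂ : DirichletCharacter ℂ q₂), χ₁ ≠ 1 → χ₂ ≠ 1 → prodChar χ₁ χ₂ ≠ 1 →
    χ₁ ^ 2 = 1 → χ₂ ^ 2 = 1 → ∀ β : ℝ, 3 / 4 ≤ β → β < 1 → LFunction χ₁ β = 0 →
    c * (1 - β) * (C * (q₁ * q₂) ^ 2) ^ (-(6 * (1 - β))) ≤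
      ‖LFunction χ₁ 1‖ * ‖LFunction χ₂ 1‖ * ‖LFunction (prodChar χ₁ χ₂) 1‖ := by
  obtain ⟨c, hc, h⟩ := siegel_core (b := 1 / 64) (by norm_num) (by norm_num)
  obtain ⟨C, hC, hM⟩ := norm_LFunction_le_level
  refine ⟨c, C ^ 3, hc, one_le_pow₀ hC, fun q₁ q₂ _ _ χ₁ χ₂ h1 h2 h3 hs1 hs2 β hβ hβ1 h0 => ?_⟩
  have hq1 : (1 : ℝ) ≤ q₁ := by exact_mod_cast Nat.one_le_iff_ne_zero.2 (NeZero.ne q₁)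
  have hq2 : (1 : ℝ) ≤ q₂ := by exact_mod_cast Nat.one_le_iff_ne_zero.2 (NeZero.ne q₂)
  set χ₃ := prodChar χ₁ χ₂ with hχ₃
  have hs3 : χ₃ ^ 2 = 1 := by
    rw [hχ₃, prodChar, mul_pow, ← map_pow, ← map_pow, hs1, hs2, map_one, map_one, one_mul]
  rw [← norm_mul, ← norm_mul]
  have eM : C ^ 3 * ((q₁ : ℝ) * q₂) ^ 2 = C * q₁ * (C * q₂) * (C * (q₁ * q₂ : ℕ)) := by push_cast; ring
  have hbound : ∀ z : ℂ, ‖LFunction χ₁ z‖ ≤ C * q₁ → ‖LFunction χ₂ z‖ ≤ C * q₂ →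
      ‖LFunction χ₃ z‖ ≤ C * (q₁ * q₂ : ℕ) →
      ‖LFunction χ₁ z * LFunction χ₂ z * LFunction χ₃ z‖ ≤ C ^ 3 * ((q₁ : ℝ) * q₂) ^ 2 := by
    intro z h1 h2 h3
    rw [eM, norm_mul, norm_mul]
    gcongr
  have d1 := differentiable_LFunction h1
  have d2 := differentiable_LFunction h2
  have d3 := differentiable_LFunction h3
  refine h (fun s => LFunction χ₁ s * LFunction χ₂ s * LFunction χ₃ s)
    (cLambda + twistLambda χ₁ + twistLambda χ₂ + twistLambda χ₃) β _
    ((d1.mul d2).mul d3).differentiableOn ?_ ?_ ?_ ?_ hβ hβ1 ?_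
    (fun z hz => hbound z ((hM q₁ χ₁ h1).1 z hz) ((hM q₂ χ₂ h2).1 z hz) ((hM _ χ₃ h3).1 z hz))
    (hbound 1 (hM q₁ χ₁ h1).2 (hM q₂ χ₂ h2).2 (hM _ χ₃ h3).2) ?_
  · intro n
    have h3 := neg_one_le_apply_of_sq_eq_one hs1 (n : ZMod q₁)
    have h3' := neg_one_le_apply_of_sq_eq_one hs2 (n : ZMod q₂)
    have h4 : (0 : ℂ) ≤ vonMangoldt n := by exact_mod_cast vonMangoldt_nonneg
    have : (cLambda + twistLambda χ₁ + twistLambda χ₂ + twistLambda χ₃) n =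
        (1 + χ₁ n) * (1 + χ₂ n) * vonMangoldt n := by
      simp only [Pi.add_apply, cLambda, twistLambda, Pi.mul_apply]
      rw [hχ₃, prodChar_apply]; ring
    rw [this]; exact mul_nonneg (mul_nonneg h3 h3') h4
  · intro y hy
    exact (((lseriesSummable_cLambda (by simpa)).add (lseriesSummable_twistLambda χ₁ (by simpa))).add
      (lseriesSummable_twistLambda χ₂ (by simpa))).add (lseriesSummable_twistLambda χ₃ (by simpa))
  · intro s hs
    have l0 := lseriesSummable_cLambda hs
    have l1 := lseriesSummable_twistLambda χ₁ hs
    have l2 := lseriesSummable_twistLambda χ₂ hs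
    have l3 := lseriesSummable_twistLambda χ₃ hs
    rw [LSeries_add ((l0.add l1).add l2) l3, LSeries_add (l0.add l1) l2, LSeries_add l0 l1]
    rw [deriv_fun_mul (differentiableAt_riemannZeta_of_one_lt hs) (((d1 s).fun_mul (d2 s)).fun_mul (d3 s)),
      deriv_fun_mul ((d1 s).fun_mul (d2 s)) (d3 s), deriv_fun_mul (d1 s) (d2 s),
      deriv_LFunction_eq χ₁ hs, deriv_LFunction_eq χ₂ hs, deriv_LFunction_eq χ₃ hs, deriv_riemannZeta_eq hs]
    ring
  · have i1 := quarter_le_LFunction_two hs1 h1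
    have i2 := quarter_le_LFunction_two hs2 h2
    have i3 := quarter_le_LFunction_two hs3 h3
    have h4 : (1 : ℂ) ≤ riemannZeta 2 := by
      rw [riemannZeta_two, show (Real.pi : ℂ) ^ 2 / 6 = ((Real.pi ^ 2 / 6 : ℝ) : ℂ) by push_cast; ring]
      have := Real.pi_gt_three
      have : 1 ≤ Real.pi ^ 2 / 6 := by nlinarith
      exact_mod_cast this
    have hq : (0 : ℂ) ≤ 1 / 4 := by positivity
    have j1 := mul_le_mul i1 i2 hq (hq.trans i1)
    have j2 := mul_le_mul j1 i3 hq (mul_nonneg (hq.trans i1) (hq.trans i2))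
    have j3 := mul_le_mul h4 j2 (mul_nonneg (mul_nonneg hq hq) hq) (zero_le_one.trans h4)
    refine le_trans (le_of_eq ?_) j3
    push_cast; norm_num
  · rw [← one_mul (1 : ℝ)]
    refine mul_le_mul (one_le_pow₀ hC) (one_le_pow₀ ?_) zero_le_one (by positivity)
    nlinarith
  · simp [h0]

end

section

open DirichletCharacter

lemma riemannZeta_re_nonpos : ∃ δ : ℝ, 0 < δ ∧ ∀ β : ℝ, 1 - δ ≤ β → β < 1 → (riemannZeta β).re ≤ 0 := by
  obtain ⟨C, hC, h⟩ := norm_riemannZeta₁_le (η := 1 / 2) (by norm_num) le_rfl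
  refine ⟨min (1 / 2) (1 / C), by positivity, fun β h1 h2 => ?_⟩
  have h3 : 1 - β ≤ 1 / C := by linarith [min_le_right (1 / 2) (1 / C)]
  have h4 : 1 - β ≤ 1 / 2 := by linarith [min_le_left (1 / 2) (1 / C)]
  have h5 := h β (by rw [Complex.ofReal_re]; linarith)
  have hβ : 0 < β := by linarith
  have h6 : ‖(β : ℂ) - 1‖ = 1 - β := by
    rw [← Complex.ofReal_one, ← Complex.ofReal_sub, Complex.norm_real, Real.norm_of_nonpos (by linarith)]; ring
  rw [h6, Complex.norm_real, Real.norm_of_nonneg hβ.le, show (2 : ℝ) * (1 / 2) = 1 by norm_num, Real.rpow_one] at h5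
  have h7 : ‖riemannZeta₁ β - 1‖ ≤ 1 := by
    refine h5.trans ?_
    have : C * (1 - β) ≤ 1 := by rwa [le_div_iff₀' hC] at h3
    have h8 : 0 ≤ C * (1 - β) := mul_nonneg hC.le (by linarith)
    nlinarith
  have h8 : 0 ≤ (riemannZeta₁ β).re := by
    have := (abs_le.1 ((Complex.abs_re_le_norm _).trans h7)).1
    rw [Complex.sub_re, Complex.one_re] at this
    linarith
  have h9 : riemannZeta₁ β = ((β - 1 : ℝ) : ℂ) * riemannZeta β := by
    have hz1 : (β : ℂ) ≠ 1 := by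
      intro h; rw [← Complex.ofReal_one, Complex.ofReal_inj] at h; linarith
    rw [riemannZeta_eq_inv_sub_mul hz1]
    push_cast
    rw [← mul_assoc, mul_inv_cancel₀ (sub_ne_zero.2 hz1), one_mul]
  rw [h9, Complex.re_ofReal_mul] at h8
  by_contra! h10
  nlinarith

lemma LFunction_ofReal_im {q : ℕ} [NeZero q] {χ : DirichletCharacter ℂ q} (h1 : χ ≠ 1) (h : χ ^ 2 = 1) {β : ℝ}
    (hβ : 0 < β) : (LFunction χ β).im = 0 := by
  rw [LFunction_eq_regL h1 (by simpa)]; exact regL_ofReal_im h β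

/-- A quadratic `L`-function without zeros on `[β, 1)` is nonnegative at `β`. -/
lemma LFunction_re_nonneg {q : ℕ} [NeZero q] {χ : DirichletCharacter ℂ q} (h1 : χ ≠ 1) (h : χ ^ 2 = 1) {β : ℝ}
    (hβ : 0 < β) (hβ2 : β ≤ 2) (hz : ∀ σ : ℝ, β ≤ σ → σ < 1 → LFunction χ σ ≠ 0) : 0 ≤ (LFunction χ β).re := by
  by_contra! hneg
  have hcont : ContinuousOn (fun σ : ℝ => (LFunction χ σ).re) (Set.Icc β 2) :=
    (Complex.continuous_re.comp ((differentiable_LFunction h1).continuous.comp Complex.continuous_ofReal)).continuousOn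
  have h2 : 0 ≤ (LFunction χ (2 : ℝ)).re := by
    have := (Complex.le_def.1 (quarter_le_LFunction_two h h1)).1
    rw [Complex.ofReal_ofNat]
    refine le_trans ?_ this
    norm_num
  obtain ⟨σ, hσ, h0⟩ := intermediate_value_Icc hβ2 hcont ⟨hneg.le, h2⟩
  have h3 : LFunction χ σ = 0 := Complex.ext h0 (LFunction_ofReal_im h1 h (by linarith [hσ.1]))
  rcases lt_or_ge σ 1 with h4 | h4
  · exact hz σ hσ.1 h4 h3
  · exact LFunction_ne_zero_of_one_le_re χ (Or.inl h1) (by simpa) h3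

lemma siegel {ε : ℝ} (hε : 0 < ε) : ∃ c : ℝ, 0 < c ∧ ∀ (q : ℕ) [NeZero q] (χ : DirichletCharacter ℂ q), χ ≠ 1 →
    χ ^ 2 = 1 → c * (q : ℝ) ^ (-ε) ≤ ‖LFunction χ 1‖ := by
  obtain ⟨δ0, hδ0, hζ⟩ := riemannZeta_re_nonpos
  obtain ⟨c2, C2, hc2, hC2, h2⟩ := siegel_two_factor
  obtain ⟨c4, C4, hc4, hC4, h4⟩ := siegel_four_factor
  obtain ⟨C3, hC3, r, hr, hr1, h3⟩ := subPoly_regL (half_pos hε)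
  set δ := min δ0 (min (1 / 4) (ε / 24)) with hδd
  have hδ : 0 < δ := by positivity
  have hδ1 : δ ≤ δ0 := min_le_left _ _
  have hδ2 : δ ≤ 1 / 4 := (min_le_right _ _).trans (min_le_left _ _)
  have hδ3 : δ ≤ ε / 24 := (min_le_right _ _).trans (min_le_right _ _)
  have hpow : ∀ (β : ℝ) (q : ℕ) [NeZero q], 1 - δ ≤ β → β < 1 → c2 * (1 - β) * C2 ^ (-(6 * (1 - β))) * (q : ℝ) ^ (-ε) ≤
      c2 * (1 - β) * (C2 * q) ^ (-(6 * (1 - β))) := by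
    intro β q _ h h'
    have hq : (1 : ℝ) ≤ q := by exact_mod_cast Nat.one_le_iff_ne_zero.2 (NeZero.ne q)
    have hβ : 0 < 1 - β := by linarith
    rw [Real.mul_rpow (by positivity) (by positivity), ← mul_assoc]
    refine mul_le_mul_of_nonneg_left (Real.rpow_le_rpow_of_exponent_le hq ?_) (by positivity)
    linarith
  by_cases hcase : ∃ (q₁ : ℕ) (_ : NeZero q₁) (χ₁ : DirichletCharacter ℂ q₁) (β : ℝ), χ₁ ≠ 1 ∧ χ₁ ^ 2 = 1 ∧
      1 - δ ≤ β ∧ β < 1 ∧ LFunction χ₁ β = 0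
  · obtain ⟨q₁, _, χ₁, β, hχ₁, hs₁, hβ, hβ1, h0⟩ := hcase
    have hβ' : 0 < 1 - β := by linarith
    have hq1 : (1 : ℝ) ≤ q₁ := by exact_mod_cast Nat.one_le_iff_ne_zero.2 (NeZero.ne q₁)
    have hL1 : 0 < ‖LFunction χ₁ 1‖ :=
      norm_pos_iff.2 (LFunction_ne_zero_of_one_le_re χ₁ (Or.inl hχ₁) (by simp))
    set a := c2 * (1 - β) * C2 ^ (-(6 * (1 - β))) with ha
    set b := c4 * (1 - β) * (C4 * q₁ ^ 2) ^ (-(6 * (1 - β))) / (‖LFunction χ₁ 1‖ * (C3 * (q₁ * 2) ^ (ε / 2))) with hb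
    refine ⟨min a b, by positivity, fun q _ χ hχ hs => ?_⟩
    have hq : (1 : ℝ) ≤ q := by exact_mod_cast Nat.one_le_iff_ne_zero.2 (NeZero.ne q)
    by_cases hz : LFunction χ β = 0
    · calc min a b * (q : ℝ) ^ (-ε) ≤ a * (q : ℝ) ^ (-ε) := by gcongr; exact min_le_left _ _
        _ ≤ _ := hpow β q hβ hβ1
        _ ≤ _ := h2 q χ hχ hs β (by linarith) hβ1 (by simp [hz])
    · have hne := prodChar_ne_one hχ₁ hχ hs (by linarith) h0 hz
      have h5 := h4 q₁ q χ₁ χ hχ₁ hχ hne hs₁ hs β (by linarith) hβ1 h0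
      have h6 : ‖LFunction (prodChar χ₁ χ) 1‖ ≤ C3 * (q₁ * 2) ^ (ε / 2) * (q : ℝ) ^ (ε / 2) := by
        rw [LFunction_eq_regL hne (by simp)]
        refine ((h3 _ (prodChar χ₁ χ)).bound 1 (by simp [hr.le]) (by simp)).trans_eq ?_
        rw [mul_assoc, ← Real.mul_rpow (by positivity) (by positivity)]
        congr 2
        push_cast
        simp; ring
      have h7 : c4 * (1 - β) * (C4 * (q₁ * q) ^ 2) ^ (-(6 * (1 - β))) ≤
          ‖LFunction χ 1‖ * ((‖LFunction χ₁ 1‖ * (C3 * (q₁ * 2) ^ (ε / 2))) * (q : ℝ) ^ (ε / 2)) := by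
        refine h5.trans ?_
        calc _ ≤ ‖LFunction χ₁ 1‖ * ‖LFunction χ 1‖ * (C3 * (q₁ * 2) ^ (ε / 2) * (q : ℝ) ^ (ε / 2)) := by gcongr
          _ = ‖LFunction χ 1‖ * ((‖LFunction χ₁ 1‖ * (C3 * (q₁ * 2) ^ (ε / 2))) * (q : ℝ) ^ (ε / 2)) := by ring
      have h8 : c4 * (1 - β) * (C4 * q₁ ^ 2) ^ (-(6 * (1 - β))) * (q : ℝ) ^ (-(ε / 2)) ≤
          c4 * (1 - β) * (C4 * (q₁ * q) ^ 2) ^ (-(6 * (1 - β))) := by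
        rw [show C4 * ((q₁ : ℝ) * q) ^ 2 = C4 * q₁ ^ 2 * q ^ 2 by ring,
          Real.mul_rpow (x := C4 * q₁ ^ 2) (y := (q : ℝ) ^ 2) (by positivity) (by positivity), ← mul_assoc]
        refine mul_le_mul_of_nonneg_left ?_ (by positivity)
        rw [← Real.rpow_natCast, ← Real.rpow_mul (by positivity)]
        refine Real.rpow_le_rpow_of_exponent_le hq ?_
        push_cast; linarith
      have h9 : (q : ℝ) ^ (ε / 2) * (q : ℝ) ^ (-(ε / 2)) = 1 := by
        rw [← Real.rpow_add (by positivity)]; simp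
      have h10 : (q : ℝ) ^ (-ε) = (q : ℝ) ^ (-(ε / 2)) * (q : ℝ) ^ (-(ε / 2)) := by
        rw [← Real.rpow_add (by positivity)]; ring_nf
      have h11 := h8.trans h7
      set D := ‖LFunction χ₁ 1‖ * (C3 * (q₁ * 2) ^ (ε / 2)) with hD
      have hDpos : 0 < D := by positivity
      have h12 : b * (q : ℝ) ^ (-(ε / 2)) ≤ ‖LFunction χ 1‖ * (q : ℝ) ^ (ε / 2) := by
        rw [hb, div_mul_eq_mul_div, div_le_iff₀ hDpos]
        linarith
      calc min a b * (q : ℝ) ^ (-ε) ≤ b * (q : ℝ) ^ (-ε) := by gcongr; exact min_le_right _ _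
        _ = b * (q : ℝ) ^ (-(ε / 2)) * (q : ℝ) ^ (-(ε / 2)) := by rw [h10, mul_assoc]
        _ ≤ ‖LFunction χ 1‖ * (q : ℝ) ^ (ε / 2) * (q : ℝ) ^ (-(ε / 2)) := by gcongr
        _ = _ := by rw [mul_assoc, h9, mul_one]
  · push Not at hcase
    refine ⟨c2 * (1 - (1 - δ)) * C2 ^ (-(6 * (1 - (1 - δ)))), ?_, fun q _ χ hχ hs => ?_⟩
    · rw [sub_sub_cancel]; positivity
    · refine (hpow (1 - δ) q le_rfl (by linarith)).trans
        (h2 q χ hχ hs (1 - δ) (by linarith) (by linarith) ?_)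
      have hpos : 0 < 1 - δ := by linarith
      have i1 := LFunction_ofReal_im hχ hs hpos
      have i2 := LFunction_re_nonneg hχ hs hpos (by linarith)
        (fun σ hσ hσ1 => hcase q inferInstance χ σ hχ hs hσ hσ1)
      rw [Complex.mul_re, i1, mul_zero, sub_zero]
      exact mul_nonpos_of_nonpos_of_nonneg (hζ _ (by linarith) (by linarith)) i2

end

section

open DirichletCharacter

lemma one_le_natCast_of_neZero (q : ℕ) [NeZero q] : (1 : ℝ) ≤ q := by
  exact_mod_cast Nat.one_le_iff_ne_zero.2 (NeZero.ne q)

lemma deriv_regL_le {ε : ℝ} (hε : 0 < ε) (hε1 : ε ≤ 1) : ∃ C : ℝ, 1 ≤ C ∧ ∀ (q : ℕ) [NeZero q]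
    (χ : DirichletCharacter ℂ q) (s : ℂ), 1 ≤ s.re → s.re ≤ 2 →
    ‖deriv (regL χ) s‖ ≤ C * (q * (|s.im| + 2)) ^ ε := by
  obtain ⟨C, hC, r, hr, hr2, h⟩ := subPoly_regL hε
  refine ⟨2 * C / (r / 2), ?_, fun q _ χ s h1 h2 => ?_⟩
  · rw [le_div_iff₀ (by positivity)]; linarith
  · have := (h q χ).iteratedDeriv_le (one_le_natCast_of_neZero q) (by linarith) hε.le hε1 hr hr2 1 (s := s)
      (by linarith) (by linarith)
    rw [iteratedDeriv_one] at this
    refine this.trans_eq ?_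
    simp; ring

lemma lower_of_sq_bound {ε : ℝ} (hε : 0 < ε) (hε1 : ε ≤ 1) : ∃ K : ℝ, 1 ≤ K ∧ ∀ (q : ℕ) [NeZero q]
    (χ : DirichletCharacter ℂ q) (t U : ℝ), χ ≠ 1 → (q * (|t| + 2)) ^ ε ≤ U →
    (∀ σ : ℝ, 1 < σ → σ ≤ 2 → ‖LFunction (χ ^ 2) (σ + (2 * t : ℝ) * Complex.I)‖ ≤ U) →
    ∀ σ : ℝ, 1 < σ → σ ≤ 2 → (K * U) ^ (-7 : ℤ) / 16 ≤ ‖LFunction χ (σ + t * Complex.I)‖ := by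
  obtain ⟨C0, hC0, h0⟩ := three_four_one
  obtain ⟨C1, hC1, h1⟩ := deriv_regL_le hε hε1
  refine ⟨C0 * C1, by nlinarith, fun q _ χ t U hχ hU hb σ hσ1 hσ2 => ?_⟩
  have hU1 : 1 ≤ U := (Real.one_le_rpow (one_le_conductor (one_le_natCast_of_neZero q) t) hε.le).trans hU
  have e : ∀ σ : ℝ, 1 < σ → LFunction χ (σ + t * Complex.I) = regL χ (σ + t * Complex.I) :=
    fun σ h => LFunction_eq_regL hχ (by simp; linarith)
  have hC01 : C1 ≤ C0 * C1 := by nlinarith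
  have hC01' : C0 ≤ C0 * C1 := by nlinarith
  rw [e σ hσ1]
  refine lower_of_three_quarters (by nlinarith) (differentiableOn_regL χ) (fun σ h h' => ?_) (fun σ h h' => ?_) hσ1 hσ2
  · refine (h1 q χ _ (by simp; linarith) (by simpa)).trans ?_
    simp only [Complex.add_im, Complex.ofReal_im, Complex.mul_im, Complex.ofReal_re, Complex.I_im, mul_one,
      Complex.I_re, mul_zero, add_zero, zero_add]
    calc C1 * (q * (|t| + 2)) ^ ε ≤ C1 * U := by gcongr
      _ ≤ _ := by gcongr
  · have h2 := h0 q χ σ t h h'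
    rw [e σ h] at h2
    refine h2.trans ?_
    rw [mul_pow]
    have hW : C0 * U ≤ (C0 * C1 * U) ^ 4 := by
      calc C0 * U ≤ C0 * C1 * U := by gcongr
        _ ≤ _ := le_self_pow₀ (by nlinarith) (by norm_num)
    calc _ ≤ C0 * ‖regL χ (σ + t * Complex.I)‖ ^ 4 * U := by gcongr; exact hb σ h h'
      _ = C0 * U * ‖regL χ (σ + t * Complex.I)‖ ^ 4 := by ring
      _ ≤ _ := by gcongr

/-- Lower bound in the nonreal case or away from the real axis, up to `ε`. -/
lemma lower_of_abs_im {ε : ℝ} (hε : 0 < ε) (hε1 : ε ≤ 1) : ∃ K : ℝ, 1 ≤ K ∧ ∀ (q : ℕ) [NeZero q]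
    (χ : DirichletCharacter ℂ q) (t τ : ℝ), χ ≠ 1 → 0 < τ → τ ≤ 1 → (χ ^ 2 ≠ 1 ∨ τ ≤ |t|) →
    ∀ σ : ℝ, 1 < σ → σ ≤ 2 → (K * ((q * (|t| + 2)) ^ ε / τ)) ^ (-7 : ℤ) / 16 ≤ ‖LFunction χ (σ + t * Complex.I)‖ := by
  obtain ⟨K, hK, h⟩ := lower_of_sq_bound hε hε1
  obtain ⟨C, hC, r, hr, hr2, h1⟩ := subPoly_regL hε
  obtain ⟨C', hC', h2⟩ := norm_LFunction_one_le hε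
  refine ⟨K * (2 * C + 2 * C' + 1), by nlinarith, fun q _ χ t τ hχ hτ hτ1 hor σ hσ1 hσ2 => ?_⟩
  have hq := one_le_natCast_of_neZero q
  have hT : (1 : ℝ) ≤ (q * (|t| + 2)) ^ ε := Real.one_le_rpow (one_le_conductor hq t) hε.le
  rw [mul_assoc K]
  set X := (q * (|t| + 2)) ^ ε with hX
  have hτX : X ≤ X / τ := le_div_self (by linarith) hτ hτ1
  have h2t : (q * (|2 * t| + 2)) ^ ε ≤ 2 * X :=
    conductor_rpow_le hq hε.le hε1 (by rw [abs_mul, abs_two]; linarith)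
  refine h q χ t _ hχ ?_ (fun σ hσ1 hσ2 => ?_) σ hσ1 hσ2
  · nlinarith
  · have him : ((σ : ℂ) + (2 * t : ℝ) * Complex.I).im = 2 * t := by simp
    have hre : ((σ : ℂ) + (2 * t : ℝ) * Complex.I).re = σ := by simp
    by_cases h3 : χ ^ 2 = 1
    · have ht : τ ≤ |t| := by tauto
      refine (h2 q (χ ^ 2) _ (by rw [hre]; exact hσ1) (by rw [hre]; exact hσ2) ?_).trans ?_
      · rw [him]; intro h0
        have : t = 0 := by linarith
        rw [this, abs_zero] at ht; linarith
      · rw [him]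
        have e1 : 1 / |2 * t| ≤ 1 / τ := by
          apply one_div_le_one_div_of_le hτ
          rw [abs_mul, abs_two]; linarith
        have e2 : 1 / τ ≤ X / τ := by gcongr
        have e3 : C' * (q * (|2 * t| + 2)) ^ ε ≤ C' * (2 * (X / τ)) := by gcongr; linarith
        have : 0 ≤ X / τ := by positivity
        nlinarith
    · rw [LFunction_eq_regL h3 (by rw [hre]; linarith)]
      refine ((h1 q (χ ^ 2)).bound _ (by rw [hre]; linarith) (by rw [hre]; linarith)).trans ?_
      rw [him]
      have e3 : C * (q * (|2 * t| + 2)) ^ ε ≤ C * (2 * (X / τ)) := by gcongr; linarith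
      have : 0 ≤ X / τ := by positivity
      nlinarith

/-- Lower bound for quadratic characters near `1`. -/
lemma lower_near_one {ε : ℝ} (hε : 0 < ε) (hε1 : ε ≤ 1) : ∃ c : ℝ, 0 < c ∧ c ≤ 1 ∧ ∀ (q : ℕ) [NeZero q]
    (χ : DirichletCharacter ℂ q), χ ≠ 1 → χ ^ 2 = 1 → ∀ s : ℂ, 1 < s.re → s.re ≤ 2 →
    |s.im| ≤ c * (q : ℝ) ^ (-(2 * ε)) → c * (q : ℝ) ^ (-(2 * ε)) ≤ ‖LFunction χ s‖ := by
  obtain ⟨c0, hc0, h0⟩ := siegel hε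
  obtain ⟨C1, hC1, h1⟩ := deriv_regL_le hε hε1
  obtain ⟨C2, hC2, h2⟩ := three_four_one
  obtain ⟨C3, hC3, h3⟩ := norm_LFunction_le_div
  set κ := min 1 (c0 / (12 * C1)) with hκ
  have hκ0 : 0 < κ := by positivity
  have hκ1 : κ ≤ 1 := min_le_left _ _
  have hκ2 : κ * (12 * C1) ≤ c0 := by
    rw [← le_div_iff₀ (by positivity)]; exact min_le_right _ _
  refine ⟨min κ (min (c0 / 2) (κ / (C2 * C3))), by positivity, (min_le_left _ _).trans hκ1,
    fun q _ χ hχ hs s hs1 hs2 ht => ?_⟩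
  set c := min κ (min (c0 / 2) (κ / (C2 * C3))) with hc
  have hq := one_le_natCast_of_neZero q
  have hq0 : (0 : ℝ) < q := by linarith
  have hQ : 0 < (q : ℝ) ^ (-(2 * ε)) := by positivity
  have hQ1 : (q : ℝ) ^ (-(2 * ε)) ≤ 1 := Real.rpow_le_one_of_one_le_of_nonpos hq (by linarith)
  have htκ : |s.im| ≤ κ * (q : ℝ) ^ (-(2 * ε)) := ht.trans (by gcongr; exact min_le_left _ _)
  rcases le_or_gt (s.re - 1) (κ * (q : ℝ) ^ (-(2 * ε))) with hσ | hσ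
  · have hQ2 : (q : ℝ) ^ (-(2 * ε)) ≤ (q : ℝ) ^ (-ε) := Real.rpow_le_rpow_of_exponent_le hq (by linarith)
    have e1 := h0 q χ hχ hs
    rw [LFunction_eq_regL hχ (by simp)] at e1
    rw [LFunction_eq_regL hχ (by linarith)]
    set D := {z : ℂ | z.re ∈ Set.Icc (1 : ℝ) 2} ∩ {z : ℂ | z.im ∈ Set.Icc (-1 : ℝ) 1} with hD
    have hconv : Convex ℝ D := by
      refine Convex.inter ?_ ?_
      · exact (convex_Icc (1 : ℝ) 2).linear_preimage Complex.reLm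
      · exact (convex_Icc (-1 : ℝ) 1).linear_preimage Complex.imLm
    have e2 := hconv.norm_image_sub_le_of_norm_deriv_le (f := regL χ) (C := C1 * (3 * (q : ℝ) ^ ε)) (x := 1) (y := s)
      (fun z hz => (differentiableOn_regL χ).differentiableAt
        (isOpen_re_pos.mem_nhds (by have := hz.1.1; show 0 < z.re; linarith)))
      (fun z hz => by
        refine (h1 q χ z hz.1.1 hz.1.2).trans ?_
        have : |z.im| ≤ 1 := abs_le.2 hz.2
        have e3 : ((q : ℝ) * (|z.im| + 2)) ^ ε ≤ 3 * (q : ℝ) ^ ε := by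
          calc ((q : ℝ) * (|z.im| + 2)) ^ ε ≤ (q * 3) ^ ε := by gcongr; linarith
            _ = (q : ℝ) ^ ε * 3 ^ ε := Real.mul_rpow hq0.le (by norm_num)
            _ ≤ (q : ℝ) ^ ε * 3 ^ (1 : ℝ) := by gcongr; norm_num
            _ = _ := by rw [Real.rpow_one]; ring
        gcongr) (by simp [hD]) ⟨⟨hs1.le, hs2⟩, by
          refine abs_le.1 (htκ.trans ?_); nlinarith⟩
    have e4 : ‖s - 1‖ ≤ 2 * (κ * (q : ℝ) ^ (-(2 * ε))) := by
      refine (Complex.norm_le_abs_re_add_abs_im _).trans ?_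
      simp only [Complex.sub_re, Complex.one_re, Complex.sub_im, Complex.one_im, sub_zero]
      rw [abs_of_pos (by linarith)]; linarith
    have e5 : (q : ℝ) ^ ε * (q : ℝ) ^ (-(2 * ε)) = (q : ℝ) ^ (-ε) := by
      rw [← Real.rpow_add hq0]; ring_nf
    have e6 : ‖regL χ s - regL χ 1‖ ≤ c0 / 2 * (q : ℝ) ^ (-ε) := by
      calc _ ≤ C1 * (3 * (q : ℝ) ^ ε) * (2 * (κ * (q : ℝ) ^ (-(2 * ε)))) := e2.trans (by gcongr)
        _ = (κ * (12 * C1)) / 2 * ((q : ℝ) ^ ε * (q : ℝ) ^ (-(2 * ε))) := by ring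
        _ ≤ _ := by rw [e5]; gcongr
    have e7 : ‖regL χ 1‖ ≤ ‖regL χ s‖ + ‖regL χ s - regL χ 1‖ := by
      rw [norm_sub_rev]
      have := norm_add_le (regL χ s) (regL χ 1 - regL χ s)
      rwa [add_sub_cancel] at this
    calc c * (q : ℝ) ^ (-(2 * ε)) ≤ c0 / 2 * (q : ℝ) ^ (-ε) := by
          gcongr; exact (min_le_right _ _).trans (min_le_left _ _)
      _ ≤ _ := by linarith
  · have e1 := h2 q χ s.re s.im hs1 hs2
    have e2 := h3 q (χ ^ 2) (s.re + (2 * s.im : ℝ) * Complex.I) (by simpa) (by simpa)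
    have e0 : ((s.re : ℂ) + s.im * Complex.I) = s := Complex.re_add_im s
    have e3 : ((s.re : ℂ) + (2 * s.im : ℝ) * Complex.I).re = s.re := by simp
    rw [e0] at e1
    rw [e3] at e2
    have hp : 0 < s.re - 1 := by linarith
    have e4 : (s.re - 1) ^ 4 ≤ (C2 * C3 * ‖LFunction χ s‖) ^ 4 := by
      calc (s.re - 1) ^ 4 = (s.re - 1) ^ 3 * (s.re - 1) := by ring
        _ ≤ C2 * ‖LFunction χ s‖ ^ 4 * (C3 / (s.re - 1)) * (s.re - 1) := by
          gcongr
          exact e1.trans (by gcongr)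
        _ = C2 * C3 * ‖LFunction χ s‖ ^ 4 := by field_simp
        _ ≤ (C2 * C3) ^ 4 * ‖LFunction χ s‖ ^ 4 := by
          gcongr; exact le_self_pow₀ (by nlinarith) (by norm_num)
        _ = _ := by ring
    have e5 : s.re - 1 ≤ C2 * C3 * ‖LFunction χ s‖ := le_of_pow_le_pow_left₀ (by norm_num) (by positivity) e4
    calc c * (q : ℝ) ^ (-(2 * ε)) ≤ κ / (C2 * C3) * (q : ℝ) ^ (-(2 * ε)) := by
          gcongr; exact (min_le_right _ _).trans (min_le_right _ _)
      _ = κ * (q : ℝ) ^ (-(2 * ε)) / (C2 * C3) := by ring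
      _ ≤ _ := by rw [div_le_iff₀' (by positivity)]; linarith

lemma norm_LFunction_lower {ε : ℝ} (hε : 0 < ε) : ∃ c : ℝ, 0 < c ∧ c ≤ 1 ∧ ∀ (q : ℕ) [NeZero q]
    (χ : DirichletCharacter ℂ q), χ ≠ 1 → ∀ s : ℂ, 1 < s.re → s.re ≤ 2 →
    c * (q * (|s.im| + 2)) ^ (-ε) ≤ ‖LFunction χ s‖ := by
  set ε0 := min 1 (ε / 21) with hε0
  have hε_pos : 0 < ε0 := by positivity
  have hε01 : ε0 ≤ 1 := min_le_left _ _
  have hε02 : 21 * ε0 ≤ ε := by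
    have := min_le_right 1 (ε / 21)
    rw [← hε0] at this; linarith
  obtain ⟨K, hK, h1⟩ := lower_of_abs_im hε_pos hε01
  obtain ⟨c, hc, hc1, h2⟩ := lower_near_one hε_pos hε01
  refine ⟨min c ((K / c) ^ (-7 : ℤ) / 16), by positivity, (min_le_left _ _).trans hc1, fun q _ χ hχ s hs1 hs2 => ?_⟩
  have hq := one_le_natCast_of_neZero q
  have hq0 : (0 : ℝ) < q := by linarith
  have hT := one_le_conductor hq s.im
  set T := (q : ℝ) * (|s.im| + 2) with hTd
  have hqT : (q : ℝ) ≤ T := by rw [hTd]; nlinarith [abs_nonneg s.im]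
  by_cases hor : χ ^ 2 ≠ 1 ∨ c * (q : ℝ) ^ (-(2 * ε0)) ≤ |s.im|
  · have hQ1 : (q : ℝ) ^ (-(2 * ε0)) ≤ 1 := Real.rpow_le_one_of_one_le_of_nonpos hq (by linarith)
    have h3 := h1 q χ s.im (c * (q : ℝ) ^ (-(2 * ε0))) hχ (by positivity)
      (by nlinarith [Real.rpow_pos_of_pos hq0 (-(2 * ε0))]) hor s.re hs1 hs2
    rw [Complex.re_add_im, ← hTd] at h3
    refine le_trans ?_ h3
    have e1 : K * (T ^ ε0 / (c * (q : ℝ) ^ (-(2 * ε0)))) ≤ K / c * T ^ (3 * ε0) := by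
      have : ((q : ℝ) ^ (-(2 * ε0)))⁻¹ ≤ T ^ (2 * ε0) := by
        rw [Real.rpow_neg hq0.le, inv_inv]; gcongr
      calc K * (T ^ ε0 / (c * (q : ℝ) ^ (-(2 * ε0)))) = K / c * (T ^ ε0 * ((q : ℝ) ^ (-(2 * ε0)))⁻¹) := by
            field_simp
        _ ≤ K / c * (T ^ ε0 * T ^ (2 * ε0)) := by gcongr
        _ = _ := by rw [← Real.rpow_add (by linarith)]; ring_nf
    have e2 : (K / c * T ^ (3 * ε0)) ^ (-7 : ℤ) ≤ (K * (T ^ ε0 / (c * (q : ℝ) ^ (-(2 * ε0))))) ^ (-7 : ℤ) := by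
      rw [zpow_neg, zpow_neg]
      apply inv_anti₀ (by positivity)
      exact_mod_cast pow_le_pow_left₀ (by positivity) e1 7
    have e3 : (K / c * T ^ (3 * ε0)) ^ (-7 : ℤ) = (K / c) ^ (-7 : ℤ) * T ^ (-(21 * ε0)) := by
      rw [mul_zpow, ← Real.rpow_intCast (T ^ (3 * ε0)), ← Real.rpow_mul (by linarith)]
      congr 2
      push_cast; ring
    calc _ ≤ (K / c) ^ (-7 : ℤ) / 16 * T ^ (-ε) := by gcongr; exact min_le_right _ _
      _ ≤ (K / c) ^ (-7 : ℤ) / 16 * T ^ (-(21 * ε0)) := by gcongr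
      _ = (K / c * T ^ (3 * ε0)) ^ (-7 : ℤ) / 16 := by rw [e3]; ring
      _ ≤ _ := by gcongr
  · push Not at hor
    refine le_trans ?_ (h2 q χ hχ hor.1 s hs1 hs2 hor.2.le)
    have e4 : T ^ (-ε) ≤ (q : ℝ) ^ (-(2 * ε0)) := by
      calc T ^ (-ε) ≤ (q : ℝ) ^ (-ε) := Real.rpow_le_rpow_of_nonpos hq0 hqT (by linarith)
        _ ≤ _ := Real.rpow_le_rpow_of_exponent_le hq (by linarith)
    gcongr
    exact min_le_left _ _

end

section

open DirichletCharacter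

/-- `(s - 1) ζ(s) / s`. -/
noncomputable def zetaV (s : ℂ) : ℂ := riemannZeta₁ s / s

lemma zetaV_eq {s : ℂ} (hs : s ≠ 0) (h1 : s ≠ 1) : zetaV s = (s - 1) / s * riemannZeta s := by
  rw [zetaV, riemannZeta_eq_inv_sub_mul h1]
  have := sub_ne_zero.2 h1
  field_simp

lemma ne_zero_of_re_pos {s : ℂ} (hs : 0 < s.re) : s ≠ 0 := by rintro rfl; simp at hs

lemma zetaV_ne_zero {s : ℂ} (hs : 1 ≤ s.re) : zetaV s ≠ 0 :=
  div_ne_zero (riemannZeta₁_ne_zero hs) (ne_zero_of_re_pos (by linarith))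

lemma differentiableOn_zetaV : DifferentiableOn ℂ zetaV {s : ℂ | 0 < s.re} :=
  differentiable_riemannZeta₁.differentiableOn.div differentiableOn_id fun _ hs => ne_zero_of_re_pos hs

lemma subPoly_zetaV {ε : ℝ} (hε : 0 < ε) : ∃ C : ℝ, 1 ≤ C ∧ ∃ r : ℝ, 0 < r ∧ r ≤ 1 / 2 ∧ SubPoly zetaV 1 C ε r := by
  obtain ⟨C, hC, r, hr, hr2, h⟩ := subPoly_riemannZeta₀ hε
  refine ⟨3 * C + 2, by linarith, r, hr, hr2, differentiableOn_zetaV, fun s h1 h2 => ?_⟩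
  have hre : 1 / 2 ≤ s.re := by linarith
  have hs0 : s ≠ 0 := ne_zero_of_re_pos (by linarith)
  have hn : 1 / 2 ≤ ‖s‖ := hre.trans ((le_abs_self _).trans (Complex.abs_re_le_norm s))
  have hi : ‖s⁻¹‖ ≤ 2 := by
    rw [norm_inv, inv_le_comm₀ (by linarith) (by norm_num)]; linarith
  have e : zetaV s = s⁻¹ + (1 - s⁻¹) * riemannZeta₀ s := by
    rw [zetaV, riemannZeta₁]; field_simp
  have hX : 1 ≤ (1 * (|s.im| + 2)) ^ ε := Real.one_le_rpow (one_le_conductor le_rfl _) hε.le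
  have h3 := h.bound s h1 h2
  set X := (1 * (|s.im| + 2)) ^ ε
  have h4 : ‖1 - s⁻¹‖ ≤ 3 := (norm_sub_le _ _).trans (by rw [norm_one]; linarith)
  rw [e]
  calc _ ≤ ‖s⁻¹‖ + ‖1 - s⁻¹‖ * ‖riemannZeta₀ s‖ := by rw [← norm_mul]; exact norm_add_le _ _
    _ ≤ 2 + 3 * (C * X) := by gcongr
    _ ≤ _ := by nlinarith

lemma norm_zetaV_lower {ε : ℝ} (hε : 0 < ε) : ∃ c : ℝ, 0 < c ∧ c ≤ 1 ∧ ∀ s : ℂ, 1 < s.re → s.re ≤ 2 →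
    c * (1 * (|s.im| + 2)) ^ (-ε) ≤ ‖zetaV s‖ := by
  set ε0 := min 1 (ε / 7) with hε0
  have hε_pos : 0 < ε0 := by positivity
  have hε01 : ε0 ≤ 1 := min_le_left _ _
  have hε02 : 7 * ε0 ≤ ε := by
    have := min_le_right 1 (ε / 7)
    rw [← hε0] at this; linarith
  obtain ⟨C0, hC0, h0⟩ := three_four_one
  obtain ⟨C, hC, r, hr, hr2, h1⟩ := subPoly_zetaV hε_pos
  obtain ⟨C', hC', h2⟩ := norm_LFunction_one_le hε_pos
  set C1 := 2 * C / (r / 2) with hC1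
  have hC11 : 1 ≤ C1 := by rw [hC1, le_div_iff₀ (by positivity)]; linarith
  obtain ⟨m, hm, hmin⟩ : ∃ m : ℝ, 0 < m ∧ ∀ s ∈ Set.Icc (1 : ℝ) 2 ×ℂ Set.Icc (-1 : ℝ) 1, m ≤ ‖zetaV s‖ := by
    have hcpt : IsCompact (Set.Icc (1 : ℝ) 2 ×ℂ Set.Icc (-1 : ℝ) 1) := isCompact_Icc.reProdIm isCompact_Icc
    have hcont : ContinuousOn (fun s => ‖zetaV s‖) (Set.Icc (1 : ℝ) 2 ×ℂ Set.Icc (-1 : ℝ) 1) :=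
      (differentiableOn_zetaV.continuousOn.mono fun z hz => by
        show 0 < z.re
        have : 1 ≤ z.re := hz.1.1
        linarith).norm
    obtain ⟨z, hz, hz'⟩ := hcpt.exists_isMinOn ⟨1, by simp [Complex.mem_reProdIm]⟩ hcont
    exact ⟨‖zetaV z‖, norm_pos_iff.2 (zetaV_ne_zero hz.1.1), fun s hs => hz' hs⟩
  set K := 16 * C0 * C1 * (2 * C' + 1) with hK
  have hK1 : 1 ≤ K := by
    have : 1 ≤ C0 * C1 := by nlinarith
    have : 1 ≤ C0 * C1 * (2 * C' + 1) := by nlinarith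
    rw [hK]; nlinarith
  refine ⟨min (min m 1) (K ^ (-7 : ℤ) / 16), by positivity, (min_le_left _ _).trans (min_le_right _ _),
    fun s hs1 hs2 => ?_⟩
  have hT := one_le_conductor (le_refl (1 : ℝ)) s.im
  set T := (1 : ℝ) * (|s.im| + 2) with hTd
  rcases le_or_gt |s.im| 1 with ht | ht
  · refine le_trans ?_ (hmin s ⟨⟨hs1.le, hs2⟩, abs_le.1 ht⟩)
    have : T ^ (-ε) ≤ 1 := Real.rpow_le_one_of_one_le_of_nonpos hT (by linarith)
    calc _ ≤ m * 1 := by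
          gcongr; exact (min_le_left _ _).trans (min_le_left _ _)
      _ = m := mul_one m
  · set X := T ^ ε0 with hX
    have hX1 : 1 ≤ X := Real.one_le_rpow hT hε_pos.le
    have hKC1 : C1 ≤ K := by
      have : 1 ≤ 16 * C0 * (2 * C' + 1) := by nlinarith
      calc C1 ≤ C1 * (16 * C0 * (2 * C' + 1)) := le_mul_of_one_le_right (by linarith) this
        _ = K := by rw [hK]; ring
    have h3 := lower_of_three_quarters (g := zetaV) (W := K * X) (t := s.im) (by nlinarith) differentiableOn_zetaV
      (fun σ h h' => by
        have := h1.iteratedDeriv_le le_rfl (by linarith) hε_pos.le hε01 hr hr2 1 (s := σ + s.im * Complex.I)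
          (by simp; linarith) (by simp; linarith)
        rw [iteratedDeriv_one] at this
        refine this.trans ?_
        simp only [Complex.add_im, Complex.ofReal_im, Complex.mul_im, Complex.ofReal_re, Complex.I_im, mul_one,
          Complex.I_re, mul_zero, add_zero, zero_add, ← hTd, ← hX, Nat.factorial_one, Nat.cast_one, one_mul, pow_one]
        calc 2 * C * X / (r / 2) = C1 * X := by rw [hC1]; ring
          _ ≤ _ := by gcongr)
      (fun σ h h' => by
        have h4 := h0 1 1 σ s.im h h'
        rw [one_pow, LFunction_modOne_eq] at h4
        have him : ((σ : ℂ) + (2 * s.im : ℝ) * Complex.I).im = 2 * s.im := by simp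
        have hre : ((σ : ℂ) + (2 * s.im : ℝ) * Complex.I).re = σ := by simp
        have h5 := h2 1 1 (σ + (2 * s.im : ℝ) * Complex.I) (by rw [hre]; exact h) (by rw [hre]; exact h') (by
          rw [him]; intro h0
          have : s.im = 0 := by linarith
          rw [this, abs_zero] at ht; linarith)
        rw [LFunction_modOne_eq, him, Nat.cast_one] at h5
        have h6 : (1 * (|2 * s.im| + 2)) ^ ε0 ≤ 2 * X :=
          conductor_rpow_le le_rfl hε_pos.le hε01 (by rw [abs_mul, abs_two]; linarith)
        have h7 : 1 / |2 * s.im| ≤ 1 := by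
          rw [div_le_one (by rw [abs_mul, abs_two]; linarith), abs_mul, abs_two]; linarith
        have h8 : ‖riemannZeta (σ + (2 * s.im : ℝ) * Complex.I)‖ ≤ (2 * C' + 1) * X := by
          refine h5.trans ?_
          have : C' * (1 * (|2 * s.im| + 2)) ^ ε0 ≤ C' * (2 * X) := by gcongr
          nlinarith
        set z : ℂ := σ + s.im * Complex.I with hz
        have hzre : z.re = σ := by simp [hz]
        have hzim : z.im = s.im := by simp [hz]
        have hz1 : z - 1 ≠ 0 := by
          intro h0
          have := congrArg Complex.im h0
          rw [Complex.sub_im, hzim] at this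
          simp at this
          rw [this, abs_zero] at ht; linarith
        have hz0 : z ≠ 0 := ne_zero_of_re_pos (by rw [hzre]; linarith)
        have h9 : ‖riemannZeta z‖ ≤ 2 * ‖zetaV z‖ := by
          have e1 : riemannZeta z = z / (z - 1) * zetaV z := by
            rw [zetaV_eq hz0 (sub_ne_zero.1 hz1)]; field_simp
          have e2 : ‖z / (z - 1)‖ ≤ 2 := by
            have : 1 ≤ ‖z - 1‖ := by
              refine le_trans ?_ (Complex.abs_im_le_norm _)
              rw [Complex.sub_im, hzim]; simpa using ht.le
            rw [norm_div, div_le_iff₀ (by linarith)]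
            have := norm_add_le (z - 1) 1
            rw [sub_add_cancel, norm_one] at this
            linarith
          rw [e1, norm_mul]; gcongr
        calc (σ - 1) ^ 3 ≤ C0 * ‖riemannZeta z‖ ^ 4 * ‖riemannZeta (σ + (2 * s.im : ℝ) * Complex.I)‖ := h4
          _ ≤ C0 * (2 * ‖zetaV z‖) ^ 4 * ((2 * C' + 1) * X) := by gcongr
          _ = 16 * C0 * (2 * C' + 1) * X * ‖zetaV z‖ ^ 4 := by ring
          _ ≤ (K * X) * ‖zetaV z‖ ^ 4 := by
            gcongr
            calc 16 * C0 * (2 * C' + 1) ≤ 16 * C0 * (2 * C' + 1) * C1 := le_mul_of_one_le_right (by positivity) hC11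
              _ = K := by rw [hK]; ring
          _ ≤ (K * X) ^ 4 * ‖zetaV z‖ ^ 4 := by
            gcongr; exact le_self_pow₀ (by nlinarith) (by norm_num)
          _ = _ := by ring) hs1 hs2
    rw [Complex.re_add_im] at h3
    refine le_trans ?_ h3
    have e3 : (K * X) ^ (-7 : ℤ) = K ^ (-7 : ℤ) * T ^ (-(7 * ε0)) := by
      rw [mul_zpow, hX, ← Real.rpow_intCast (T ^ ε0), ← Real.rpow_mul (by linarith)]
      congr 2
      push_cast; ring
    calc _ ≤ K ^ (-7 : ℤ) / 16 * T ^ (-ε) := by gcongr; exact min_le_right _ _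
      _ ≤ K ^ (-7 : ℤ) / 16 * T ^ (-(7 * ε0)) := by gcongr
      _ = _ := by rw [e3]; ring

end

section

open MeasureTheory Complex

/-- The triangle weight `(1 - u)₊` on `(0, ∞)`. -/
noncomputable def triWeight (u : ℝ) : ℂ :=
  (Set.Ioc 0 1).indicator (fun _ : ℝ => (1 : ℂ)) u - (Set.Ioc 0 1).indicator (fun t : ℝ => (t : ℂ) ^ (1 : ℂ)) u

lemma triWeight_eq {u : ℝ} (hu : 0 < u) : triWeight u = ((max (1 - u) 0 : ℝ) : ℂ) := by
  rw [triWeight]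
  by_cases h : u ≤ 1
  · have hm : u ∈ Set.Ioc (0 : ℝ) 1 := ⟨hu, h⟩
    rw [Set.indicator_of_mem hm, Set.indicator_of_mem hm, max_eq_left (by linarith)]
    simp
  · rw [Set.indicator_of_notMem (fun h' => h h'.2), Set.indicator_of_notMem (fun h' => h h'.2),
      max_eq_right (by linarith)]
    simp

lemma mellin_triWeight {s : ℂ} (hs : 0 < s.re) : MellinConvergent triWeight s ∧ mellin triWeight s = 1 / (s * (s + 1)) := by
  have h1 := hasMellin_one_Ioc hs
  have h2 := hasMellin_cpow_Ioc 1 (s := s) (by simp; linarith)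
  have h3 := hasMellin_sub h1.1 h2.1
  refine ⟨h3.1, h3.2.trans ?_⟩
  rw [h1.2, h2.2]
  have e1 : s ≠ 0 := by rintro rfl; simp at hs
  have e2 : s + 1 ≠ 0 := by
    intro h; have := congrArg re h; simp at this; linarith
  field_simp; ring

lemma norm_mul_add_one_ge {σ : ℝ} (hσ : 1 ≤ σ) (y : ℝ) :
    1 + y ^ 2 ≤ ‖((σ : ℂ) + y * I) * (σ + y * I + 1)‖ := by
  have h : ∀ z : ℂ, 1 ≤ z.re → z.im = y → 1 + y ^ 2 ≤ ‖z‖ ^ 2 := by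
    intro z h1 h2
    rw [← Complex.normSq_eq_norm_sq, Complex.normSq_apply, h2]; nlinarith
  have h1 := h (σ + y * I) (by simpa) (by simp)
  have h2 := h (σ + y * I + 1) (by simp; linarith) (by simp)
  rw [norm_mul]
  refine le_of_sq_le_sq ?_ (by positivity)
  rw [mul_pow]
  have : 0 ≤ 1 + y ^ 2 := by positivity
  calc (1 + y ^ 2) ^ 2 = (1 + y ^ 2) * (1 + y ^ 2) := sq _
    _ ≤ _ := by gcongr

lemma integrable_kernel {σ : ℝ} (hσ : 1 ≤ σ) :
    Integrable fun y : ℝ => 1 / (((σ : ℂ) + y * I) * (σ + y * I + 1)) := by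
  refine integrable_inv_one_add_sq.mono' ?_ (Filter.Eventually.of_forall fun y => ?_)
  · refine Continuous.aestronglyMeasurable ?_
    refine continuous_const.div (by fun_prop) fun y h => ?_
    have := norm_mul_add_one_ge hσ y
    rw [h, norm_zero] at this
    nlinarith [sq_nonneg y]
  · rw [norm_div, norm_one, one_div]
    exact inv_anti₀ (by positivity) (norm_mul_add_one_ge hσ y)

lemma triWeight_inversion {σ : ℝ} (hσ : 1 ≤ σ) {u : ℝ} (hu : 0 < u) :
    ((max (1 - u) 0 : ℝ) : ℂ) = (1 / (2 * Real.pi)) •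
      ∫ y : ℝ, (u : ℂ) ^ (-((σ : ℂ) + y * I)) * (1 / (((σ : ℂ) + y * I) * (σ + y * I + 1))) := by
  have hm : ∀ y : ℝ, mellin triWeight (σ + y * I) = 1 / (((σ : ℂ) + y * I) * (σ + y * I + 1)) :=
    fun y => (mellin_triWeight (by simp; linarith)).2
  have hc : ContinuousAt triWeight u := by
    have : ContinuousAt (fun u : ℝ => ((max (1 - u) 0 : ℝ) : ℂ)) u := by fun_prop
    refine this.congr ?_
    filter_upwards [lt_mem_nhds hu] with v hv using (triWeight_eq hv).symm
  have := mellinInv_mellin_eq σ triWeight hu (mellin_triWeight (by simp; linarith)).1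
    (by
      unfold VerticalIntegrable
      simp_rw [hm]
      exact integrable_kernel hσ) hc
  rw [triWeight_eq hu, mellinInv] at this
  rw [← this]
  simp_rw [hm, smul_eq_mul]

lemma integrable_weight : Integrable fun y : ℝ => (1 + ‖y‖ ^ 2) ^ (-(3 / 2 : ℝ) / 2) :=
  integrable_rpow_neg_one_add_norm_sq (by simp; norm_num)

lemma sqrt_div_le_weight (y : ℝ) : (|y| + 2) ^ (1 / 2 : ℝ) / (1 + y ^ 2) ≤ 2 * (1 + ‖y‖ ^ 2) ^ (-(3 / 2 : ℝ) / 2) := by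
  have hp : (0 : ℝ) < 1 + y ^ 2 := by positivity
  have e1 : (|y| + 2) ^ (1 / 2 : ℝ) ≤ 2 * (1 + y ^ 2) ^ (1 / 4 : ℝ) := by
    calc (|y| + 2) ^ (1 / 2 : ℝ) = ((|y| + 2) ^ 2) ^ (1 / 4 : ℝ) := by
          rw [← Real.rpow_natCast, ← Real.rpow_mul (by positivity)]; norm_num
      _ ≤ (2 ^ 4 * (1 + y ^ 2)) ^ (1 / 4 : ℝ) := by
          gcongr
          rw [← sq_abs y]; nlinarith [abs_nonneg y, sq_nonneg (|y| - 1)]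
      _ = _ := by
          rw [Real.mul_rpow (by positivity) hp.le, ← Real.rpow_natCast, ← Real.rpow_mul (by positivity)]; norm_num
  rw [div_le_iff₀ hp, Real.norm_eq_abs, sq_abs]
  refine e1.trans_eq ?_
  rw [mul_assoc]
  congr 1
  conv_rhs => rw [← Real.rpow_one (1 + y ^ 2), ← Real.rpow_mul hp.le, ← Real.rpow_add hp]
  norm_num

/-- A smoothed truncated Perron bound. -/
lemma perron_smooth : ∃ C : ℝ, 0 < C ∧ ∀ (b : ℕ → ℂ) (P : ℝ), b 0 = 0 → 0 ≤ P →
    (∀ s : ℂ, 1 < s.re → LSeriesSummable b s) →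
    (∀ s : ℂ, 1 < s.re → s.re ≤ 2 → ‖LSeries b s‖ ≤ P * (|s.im| + 2) ^ (1 / 2 : ℝ)) →
    ∀ x : ℝ, 3 ≤ x → ‖∑ n ∈ Finset.range (⌊x⌋₊ + 1), b n * ((x - n : ℝ) : ℂ)‖ ≤ C * P * x ^ 2 := by
  set J := ∫ y : ℝ, (1 + ‖y‖ ^ 2) ^ (-(3 / 2 : ℝ) / 2) with hJ
  have hJ0 : 0 ≤ J := integral_nonneg fun y => by positivity
  refine ⟨Real.exp 1 * (2 * J) + 1, by positivity, fun b P hb hP hsum hbd x hx => ?_⟩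
  have hx0 : 0 < x := by linarith
  have hlog : 1 ≤ Real.log x := by
    rw [Real.le_log_iff_exp_le hx0]
    linarith [Real.exp_one_lt_d9]
  set σ := 1 + 1 / Real.log x with hσ
  have hσ1 : 1 < σ := by rw [hσ]; have : 0 < 1 / Real.log x := by positivity
                         linarith
  have hσ2 : σ ≤ 2 := by
    rw [hσ]; have : 1 / Real.log x ≤ 1 := by rw [div_le_one (by linarith)]; exact hlog
    linarith
  have hxσ : x ^ σ = x * Real.exp 1 := by
    rw [hσ, Real.rpow_add hx0, Real.rpow_one, Real.rpow_def_of_pos hx0, mul_one_div_cancel (by linarith)]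
  set ker : ℝ → ℂ := fun y => 1 / (((σ : ℂ) + y * I) * (σ + y * I + 1)) with hker
  have hkint : Integrable ker := integrable_kernel hσ1.le
  set F : ℕ → ℝ → ℂ := fun n y => LSeries.term b (σ + y * I) n * ((x : ℂ) ^ ((σ : ℂ) + y * I) * ker y) with hF
  have hxn : ∀ y : ℝ, ‖(x : ℂ) ^ ((σ : ℂ) + y * I)‖ = x ^ σ := fun y => by
    rw [norm_cpow_eq_rpow_re_of_pos hx0]; simp
  have hterm : ∀ n (y : ℝ), ‖LSeries.term b (σ + y * I) n‖ = ‖LSeries.term b σ n‖ := fun n y => by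
    rw [LSeries.norm_term_eq, LSeries.norm_term_eq]; simp
  have hFnorm : ∀ n y, ‖F n y‖ = ‖LSeries.term b σ n‖ * x ^ σ * ‖ker y‖ := fun n y => by
    rw [hF]; simp only [norm_mul, hterm, hxn]; ring
  have hFint : ∀ n, Integrable (F n) := by
    intro n
    refine (hkint.norm.const_mul (‖LSeries.term b σ n‖ * x ^ σ)).mono' ?_
      (Filter.Eventually.of_forall fun y => (hFnorm n y).le)
    refine AEStronglyMeasurable.mul ?_ (AEStronglyMeasurable.mul ?_ hkint.1)
    · refine Continuous.aestronglyMeasurable ?_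
      unfold LSeries.term
      by_cases hn : n = 0
      · simp only [hn, if_true]; exact continuous_const
      · simp only [hn, if_false]
        have hn' : (n : ℂ) ≠ 0 := by exact_mod_cast hn
        refine continuous_const.div ?_ fun y => by simp [cpow_eq_zero_iff, hn']
        exact Continuous.const_cpow (by fun_prop) (Or.inl hn')
    · exact (Continuous.const_cpow (by fun_prop) (Or.inl (by exact_mod_cast hx0.ne'))).aestronglyMeasurable
  have hs := hasSum_integral_of_summable_integral_norm hFint (by
    simp_rw [hFnorm, integral_const_mul]
    refine Summable.mul_right _ (Summable.mul_right _ ?_)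
    exact (hsum σ (by simpa)).norm)
  have hFn : ∀ n, ∫ y, F n y = (2 * Real.pi : ℝ) • (b n * ((max (1 - n / x) 0 : ℝ) : ℂ)) := by
    intro n
    by_cases hn : n = 0
    · simp [hF, hn, hb]
    · have hn0 : (0 : ℝ) < n := by exact_mod_cast Nat.pos_of_ne_zero hn
      rw [triWeight_inversion hσ1.le (u := n / x) (by positivity), mul_smul_comm, smul_smul,
        mul_one_div_cancel (by positivity), one_smul, ← integral_const_mul]
      refine integral_congr_ae (Filter.Eventually.of_forall fun y => ?_)
      simp only [hF, hker, LSeries.term_of_ne_zero hn]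
      have e : ((n / x : ℝ) : ℂ) ^ (-((σ : ℂ) + y * I)) =
          (x : ℂ) ^ ((σ : ℂ) + y * I) / (n : ℂ) ^ ((σ : ℂ) + y * I) := by
        rw [div_eq_mul_inv, Complex.ofReal_mul, mul_cpow_ofReal_nonneg hn0.le (by positivity), cpow_neg, cpow_neg,
          ofReal_inv, inv_cpow _ _ (by rw [arg_ofReal_of_nonneg hx0.le]; exact Real.pi_pos.ne), inv_inv]
        rw [ofReal_natCast]; ring
      rw [e]; ring
  have htsum : ∀ y : ℝ, ∑' n, F n y = LSeries b (σ + y * I) * ((x : ℂ) ^ ((σ : ℂ) + y * I) * ker y) := by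
    intro y
    simp only [hF]; rw [tsum_mul_right]; rfl
  simp_rw [hFn, htsum] at hs
  have hs2 := hasSum_sum_of_ne_finset_zero (L := .unconditional ℕ) (f := fun n : ℕ => (2 * Real.pi : ℝ) • (b n * ((max (1 - n / x) 0 : ℝ) : ℂ)))
    (s := Finset.range (⌊x⌋₊ + 1)) (by
      intro n hn
      rw [Finset.mem_range, not_lt] at hn
      have : x < n := (Nat.lt_floor_add_one x).trans_le (by exact_mod_cast hn)
      have h2 : 1 ≤ n / x := by rw [le_div_iff₀ hx0]; linarith
      simp only [max_eq_right (show 1 - n / x ≤ 0 by linarith), ofReal_zero, mul_zero, smul_zero])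
  have heq := hs2.unique hs
  have hle : ‖∫ y : ℝ, LSeries b (σ + y * I) * ((x : ℂ) ^ ((σ : ℂ) + y * I) * ker y)‖ ≤ P * x ^ σ * 2 * J := by
    rw [hJ, ← integral_const_mul]
    refine norm_integral_le_of_norm_le (integrable_weight.const_mul _) (Filter.Eventually.of_forall fun y => ?_)
    rw [norm_mul, norm_mul, hxn]
    have h1 := hbd (σ + y * I) (by simpa) (by simpa)
    simp only [add_im, ofReal_im, mul_im, ofReal_re, I_im, mul_one, I_re, mul_zero, add_zero, zero_add] at h1
    have h2 : ‖ker y‖ ≤ 1 / (1 + y ^ 2) := by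
      rw [hker]; simp only; rw [norm_div, norm_one]
      exact one_div_le_one_div_of_le (by positivity) (norm_mul_add_one_ge hσ1.le y)
    calc _ ≤ P * (|y| + 2) ^ (1 / 2 : ℝ) * (x ^ σ * (1 / (1 + y ^ 2))) := by gcongr
      _ = P * x ^ σ * ((|y| + 2) ^ (1 / 2 : ℝ) / (1 + y ^ 2)) := by ring
      _ ≤ P * x ^ σ * (2 * (1 + ‖y‖ ^ 2) ^ (-(3 / 2 : ℝ) / 2)) := by gcongr; exact sqrt_div_le_weight y
      _ = _ := by ring
  rw [← heq, ← Finset.smul_sum, norm_smul, Real.norm_of_nonneg (by positivity)] at hle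
  have e1 : ∑ n ∈ Finset.range (⌊x⌋₊ + 1), b n * ((x - n : ℝ) : ℂ) =
      x * ∑ n ∈ Finset.range (⌊x⌋₊ + 1), b n * ((max (1 - n / x) 0 : ℝ) : ℂ) := by
    rw [Finset.mul_sum]
    refine Finset.sum_congr rfl fun n hn => ?_
    have h3 : (n : ℝ) ≤ x := (Nat.le_floor_iff hx0.le).1 (Nat.lt_succ_iff.1 (Finset.mem_range.1 hn))
    have h4 : n / x ≤ 1 := by rw [div_le_one hx0]; exact h3
    rw [max_eq_left (by linarith)]
    push_cast
    have : (x : ℂ) ≠ 0 := by exact_mod_cast hx0.ne'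
    field_simp
  rw [e1, norm_mul, norm_real, Real.norm_of_nonneg hx0.le]
  set S := ‖∑ n ∈ Finset.range (⌊x⌋₊ + 1), b n * ((max (1 - n / x) 0 : ℝ) : ℂ)‖ with hS
  have hS0 : 0 ≤ S := norm_nonneg _
  have h5 : S ≤ P * x ^ σ * 2 * J := by
    refine le_trans ?_ hle
    have : 1 ≤ 2 * Real.pi := by linarith [Real.pi_gt_three]
    nlinarith
  rw [hxσ] at h5
  calc x * S ≤ x * (P * (x * Real.exp 1) * 2 * J) := by gcongr
    _ = (Real.exp 1 * (2 * J)) * P * x ^ 2 := by ring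
    _ ≤ _ := by gcongr; linarith

end

section

open Finset

lemma eventually_log_pow_le (n : ℕ) (c : ℝ) (hc : 0 < c) : ∀ᶠ x : ℝ in Filter.atTop, Real.log x ^ n ≤ c * x := by
  have := (Real.isLittleO_pow_log_id_atTop (n := n)).bound hc
  filter_upwards [this, Filter.eventually_gt_atTop 0] with x hx hx0
  simp only [id, Real.norm_eq_abs, abs_of_pos hx0] at hx
  exact (le_abs_self _).trans hx

lemma norm_sum_mul_le_of_antitone {g : ℕ → ℝ} {b : ℕ → ℂ} {M : ℝ} (n : ℕ) (hg : ∀ i, i + 1 < n → g (i + 1) ≤ g i)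
    (hg0 : ∀ i < n, 0 ≤ g i) (hb : ∀ i ≤ n, ‖∑ j ∈ range i, b j‖ ≤ M) (h0 : 0 ≤ g 0) :
    ‖∑ i ∈ range n, (g i : ℂ) * b i‖ ≤ g 0 * M := by
  have hM : 0 ≤ M := (norm_nonneg _).trans (hb 0 (Nat.zero_le _))
  rcases Nat.eq_zero_or_pos n with rfl | hn
  · simpa using mul_nonneg h0 hM
  have := sum_range_by_parts (fun i => (g i : ℂ)) b n
  simp only [smul_eq_mul] at this
  rw [this]
  refine (norm_sub_le _ _).trans ?_
  have e1 : ‖(g (n - 1) : ℂ) * ∑ i ∈ range n, b i‖ ≤ g (n - 1) * M := by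
    rw [norm_mul, Complex.norm_real, Real.norm_of_nonneg (hg0 _ (by omega))]
    exact mul_le_mul_of_nonneg_left (hb n le_rfl) (hg0 _ (by omega))
  have e2 : ‖∑ i ∈ range (n - 1), ((g (i + 1) : ℂ) - g i) * ∑ i ∈ range (i + 1), b i‖ ≤
      ∑ i ∈ range (n - 1), (g i - g (i + 1)) * M := by
    refine norm_sum_le_of_le _ fun i hi => ?_
    rw [mem_range] at hi
    have h := hg i (by omega)
    rw [norm_mul, ← Complex.ofReal_sub, Complex.norm_real, Real.norm_of_nonpos (by linarith), neg_sub]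
    exact mul_le_mul_of_nonneg_left (hb _ (by omega)) (by linarith)
  rw [← sum_mul, sum_range_sub'] at e2
  linarith

lemma logMul_iterate (a : ℕ → ℂ) (k n : ℕ) : LSeries.logMul^[k] a n = Complex.log n ^ k * a n := by
  induction k with
  | zero => simp
  | succ k ih => rw [Function.iterate_succ_apply', LSeries.logMul, ih]; ring

lemma norm_clog_natCast (n : ℕ) : ‖Complex.log n‖ = Real.log n := by
  rw [← Complex.natCast_log, Complex.norm_real, Real.norm_of_nonneg (Real.log_natCast_nonneg n)]

lemma perron_log_weighted (m : ℕ) (hm : 1 ≤ m) : ∃ C : ℝ, 0 < C ∧ ∃ x₁ : ℝ, ∀ (a : ℕ → ℂ) (P : ℝ), 1 ≤ P → a 0 = 0 →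
    (∀ n : ℕ, 1 ≤ n → ‖a n‖ ≤ 1 + Real.log n) → (∀ s : ℂ, 1 < s.re → LSeriesSummable a s) →
    (∀ s : ℂ, 1 < s.re → s.re ≤ 2 → ‖iteratedDeriv (2 * m - 1) (LSeries a) s‖ ≤ P * (|s.im| + 2) ^ (1 / 2 : ℝ)) →
    ∀ x : ℝ, x₁ ≤ x → ‖∑ n ∈ range (⌊x⌋₊ + 1), Complex.log n ^ (2 * m - 1) * a n‖ ≤ C * P * x * Real.log x ^ m := by
  obtain ⟨C0, hC0, h0⟩ := perron_smooth
  obtain ⟨x1, hx1⟩ := Filter.eventually_atTop.1 (eventually_log_pow_le m 1 one_pos)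
  refine ⟨5 * C0 + 2 * 9 ^ m, by positivity, max x1 3, fun a P hP ha0 ha hsum hbd x hx => ?_⟩
  have hx3 : 3 ≤ x := (le_max_right _ _).trans hx
  have hx0 : 0 < x := by linarith
  have hL : 1 ≤ Real.log x := by
    rw [Real.le_log_iff_exp_le hx0]; linarith [Real.exp_one_lt_d9]
  have hLm : Real.log x ^ m ≤ x := by simpa using hx1 x ((le_max_left _ _).trans hx)
  set L := Real.log x with hLd
  set b : ℕ → ℂ := LSeries.logMul^[2 * m - 1] a with hb
  have hbn : ∀ n, b n = Complex.log n ^ (2 * m - 1) * a n := logMul_iterate a _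
  have habs : LSeries.abscissaOfAbsConv a ≤ (1 : ℝ) :=
    LSeries.abscissaOfAbsConv_le_of_forall_lt_LSeriesSummable fun y hy => hsum y (by simpa)
  have habs' : ∀ s : ℂ, 1 < s.re → LSeries.abscissaOfAbsConv a < s.re := fun s hs =>
    habs.trans_lt (by exact_mod_cast hs)
  have key := h0 b P (by rw [hbn, ha0, mul_zero]) (by linarith)
    (fun s hs => LSeriesSummable_of_abscissaOfAbsConv_lt_re (by
      rw [hb, LSeries.absicssaOfAbsConv_logPowMul]; exact habs' s hs))
    (fun s hs hs2 => by
      have := hbd s hs hs2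
      rw [LSeries_iteratedDeriv _ (habs' s hs), norm_mul, norm_pow, norm_neg, norm_one, one_pow, one_mul] at this
      exact this)
  set y := x / L ^ m with hy
  have hLm1 : 1 ≤ L ^ m := one_le_pow₀ hL
  have hy1 : 1 ≤ y := by rw [hy, le_div_iff₀ (by linarith)]; linarith
  have hyx : y ≤ x := div_le_self hx0.le hLm1
  have k1 := key x hx3
  have k2 := key (x + y) (by linarith)
  have hfl : ⌊x⌋₊ + 1 ≤ ⌊x + y⌋₊ + 1 := by
    have := Nat.floor_le_floor (show x ≤ x + y by linarith)
    omega
  rw [← sum_range_add_sum_Ico _ hfl] at k2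
  have esplit : ∑ n ∈ range (⌊x⌋₊ + 1), b n * ((x + y - n : ℝ) : ℂ) =
      ∑ n ∈ range (⌊x⌋₊ + 1), b n * ((x - n : ℝ) : ℂ) + y * ∑ n ∈ range (⌊x⌋₊ + 1), b n := by
    rw [mul_sum, ← sum_add_distrib]
    refine sum_congr rfl fun n _ => ?_
    push_cast; ring
  rw [esplit] at k2
  have htail : ‖∑ n ∈ Ico (⌊x⌋₊ + 1) (⌊x + y⌋₊ + 1), b n * ((x + y - n : ℝ) : ℂ)‖ ≤ 2 * y * ((3 * L) ^ (2 * m) * y) := by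
    have hcard : ((Ico (⌊x⌋₊ + 1) (⌊x + y⌋₊ + 1)).card : ℝ) ≤ 2 * y := by
      rw [Nat.card_Ico, Nat.cast_sub hfl]
      push_cast
      have e1 := Nat.floor_le (show 0 ≤ x + y by linarith)
      have e2 := Nat.lt_floor_add_one x
      linarith
    have hb2 : ∀ n ∈ Ico (⌊x⌋₊ + 1) (⌊x + y⌋₊ + 1), ‖b n * ((x + y - n : ℝ) : ℂ)‖ ≤ (3 * L) ^ (2 * m) * y := by
      intro n hn
      rw [mem_Ico] at hn
      have hn1 : x < n := (Nat.lt_floor_add_one x).trans_le (by exact_mod_cast hn.1)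
      have hn2 : (n : ℝ) ≤ x + y := (Nat.le_floor_iff (by linarith)).1 (Nat.lt_succ_iff.1 hn.2)
      have hn0 : (0 : ℝ) < n := by linarith
      have hlogn : Real.log n ≤ 2 * L := by
        have : (n : ℝ) ≤ x ^ 2 := by nlinarith
        calc Real.log n ≤ Real.log (x ^ 2) := Real.log_le_log hn0 this
          _ = _ := by rw [Real.log_pow]; push_cast; rfl
      have hlog0 : 0 ≤ Real.log n := Real.log_natCast_nonneg n
      rw [norm_mul, Complex.norm_real, Real.norm_of_nonneg (by linarith), hbn, norm_mul, norm_pow, norm_clog_natCast]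
      have h1 := ha n (by exact_mod_cast Nat.pos_of_ne_zero (by rintro rfl; simp at hn0))
      calc Real.log n ^ (2 * m - 1) * ‖a n‖ * (x + y - n) ≤ (3 * L) ^ (2 * m - 1) * (3 * L) * y := by
            gcongr <;> linarith
        _ = _ := by rw [← pow_succ, Nat.sub_add_cancel (by omega)]
    refine (norm_sum_le_of_le _ hb2).trans ?_
    rw [sum_const, nsmul_eq_mul]
    gcongr
  have hB : ∑ n ∈ range (⌊x⌋₊ + 1), Complex.log n ^ (2 * m - 1) * a n = ∑ n ∈ range (⌊x⌋₊ + 1), b n :=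
    sum_congr rfl fun n _ => (hbn n).symm
  rw [hB]
  set B := ∑ n ∈ range (⌊x⌋₊ + 1), b n with hBd
  set B1 := ∑ n ∈ range (⌊x⌋₊ + 1), b n * ((x - n : ℝ) : ℂ) with hB1
  set R := ∑ n ∈ Ico (⌊x⌋₊ + 1) (⌊x + y⌋₊ + 1), b n * ((x + y - n : ℝ) : ℂ) with hR
  have h1 : y * ‖B‖ ≤ 5 * C0 * P * x ^ 2 + 2 * y * ((3 * L) ^ (2 * m) * y) := by
    have e : (y : ℂ) * B = (B1 + y * B + R) - B1 - R := by ring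
    have e2 : ‖(y : ℂ) * B‖ = y * ‖B‖ := by
      rw [norm_mul, Complex.norm_real, Real.norm_of_nonneg (by linarith)]
    rw [← e2, e]
    have e3 : C0 * P * (x + y) ^ 2 ≤ C0 * P * (4 * x ^ 2) := by gcongr; nlinarith
    have e4 := norm_sub_le ((B1 + y * B + R) - B1) R
    have e5 := norm_sub_le (B1 + y * B + R) B1
    linarith
  have h2 : 5 * C0 * P * x ^ 2 + 2 * y * ((3 * L) ^ (2 * m) * y) = y * (5 * C0 * P * x * L ^ m + 2 * 9 ^ m * (x * L ^ m)) := by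
    have hL0 : L ≠ 0 := by linarith
    rw [hy, pow_mul, mul_pow, mul_pow]
    field_simp
    norm_num
    ring
  rw [h2] at h1
  have h3 := le_of_mul_le_mul_left h1 (by linarith)
  refine h3.trans ?_
  have h4 : 2 * 9 ^ m * (x * L ^ m) ≤ P * (2 * 9 ^ m * (x * L ^ m)) := le_mul_of_one_le_left (by positivity) hP
  nlinarith

/-- Perron-type estimate from bounds for a high derivative of the Dirichlet series on `Re s > 1`. -/
lemma perron_bound (m : ℕ) (hm : 1 ≤ m) : ∃ C : ℝ, 0 < C ∧ ∃ x₁ : ℝ, ∀ (a : ℕ → ℂ) (P : ℝ), 1 ≤ P → a 0 = 0 →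
    (∀ n : ℕ, 1 ≤ n → ‖a n‖ ≤ 1 + Real.log n) → (∀ s : ℂ, 1 < s.re → LSeriesSummable a s) →
    (∀ s : ℂ, 1 < s.re → s.re ≤ 2 → ‖iteratedDeriv (2 * m - 1) (LSeries a) s‖ ≤ P * (|s.im| + 2) ^ (1 / 2 : ℝ)) →
    ∀ x : ℝ, x₁ ≤ x → ‖∑ n ∈ range (⌊x⌋₊ + 1), a n‖ ≤ C * P * x / Real.log x ^ (m - 1) := by
  obtain ⟨C, hC, x1, h⟩ := perron_log_weighted m hm
  obtain ⟨x2, hx2⟩ := Filter.eventually_atTop.1 (eventually_log_pow_le (2 * m) 1 one_pos)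
  refine ⟨4 + 2 * (2 ^ (2 * m - 1) * C), by positivity, max x2 (max 9 ((|x1| + 1) ^ 2)),
    fun a P hP ha0 ha hsum hbd x hx => ?_⟩
  have hx9 : 9 ≤ x := (le_max_left _ _).trans ((le_max_right _ _).trans hx)
  have hxx1 : (|x1| + 1) ^ 2 ≤ x := (le_max_right _ _).trans ((le_max_right _ _).trans hx)
  have hx0 : 0 < x := by linarith
  have hL : 1 ≤ Real.log x := by
    rw [Real.le_log_iff_exp_le hx0]; linarith [Real.exp_one_lt_d9]
  have hLm : Real.log x ^ (2 * m) ≤ x := by simpa using hx2 x ((le_max_left _ _).trans hx)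
  have hB := h a P hP ha0 ha hsum hbd
  set L := Real.log x with hLd
  set b : ℕ → ℂ := fun n => Complex.log n ^ (2 * m - 1) * a n with hb
  set N := ⌊x⌋₊ with hN
  set M0 := ⌊√x⌋₊ + 1 with hM0
  have hs3 : 3 ≤ √x := Real.le_sqrt_of_sq_le (by norm_num; exact hx9)
  have hsx : √x * √x = x := Real.mul_self_sqrt hx0.le
  have hsxx : √x + 1 ≤ x := by nlinarith
  have hMN : M0 ≤ N + 1 := by
    have := Nat.floor_le_floor (show √x ≤ x by linarith)
    omega
  have hM0s : √x < M0 := by rw [hM0]; push_cast; exact Nat.lt_floor_add_one _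
  have hM0s' : (M0 : ℝ) ≤ √x + 1 := by
    rw [hM0]; push_cast; linarith [Nat.floor_le (show 0 ≤ √x by positivity)]
  have hBn : ∀ n : ℕ, ⌊√x⌋₊ ≤ n → n ≤ N → ‖∑ j ∈ range (n + 1), b j‖ ≤ C * P * x * L ^ m := by
    intro n h1 h2
    have h3 : x1 ≤ n := by
      have e1 : |x1| + 1 ≤ √x := Real.le_sqrt_of_sq_le hxx1
      have e2 := Nat.lt_floor_add_one √x
      have e3 : (⌊√x⌋₊ : ℝ) ≤ n := by exact_mod_cast h1
      linarith [le_abs_self x1]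
    have h4 : (n : ℝ) ≤ x := (Nat.le_floor_iff hx0.le).1 h2
    have h6 : 1 ≤ n := by
      refine le_trans ?_ h1
      rw [Nat.one_le_floor_iff]; linarith
    have h7 : (1 : ℝ) ≤ n := by exact_mod_cast h6
    have h5 := hB n h3
    rw [Nat.floor_natCast] at h5
    refine h5.trans ?_
    have h8 : Real.log n ≤ L := Real.log_le_log (by linarith) h4
    have h9 : 0 ≤ Real.log n := Real.log_natCast_nonneg n
    gcongr
  rw [← sum_range_add_sum_Ico _ hMN]
  have hsmall : ‖∑ n ∈ range M0, a n‖ ≤ 4 * (√x * L) := by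
    have h1 : ∀ n ∈ range M0, ‖a n‖ ≤ 2 * L := by
      intro n hn
      rw [mem_range] at hn
      rcases Nat.eq_zero_or_pos n with rfl | hn0
      · rw [ha0, norm_zero]; linarith
      · have h2 : (n : ℝ) ≤ x := by
          have : (n : ℝ) ≤ M0 := by exact_mod_cast hn.le
          linarith
        have := Real.log_le_log (by exact_mod_cast hn0) h2
        linarith [ha n hn0]
    refine (norm_sum_le_of_le _ h1).trans ?_
    rw [sum_const, card_range, nsmul_eq_mul]
    have : (M0 : ℝ) ≤ 2 * √x := by linarith
    nlinarith
  set g : ℕ → ℝ := fun i => ((Real.log ((M0 + i : ℕ) : ℝ)) ^ (2 * m - 1))⁻¹ with hg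
  have hM01 : (1 : ℝ) < M0 := by linarith
  have hlogpos : ∀ i : ℕ, 0 < Real.log ((M0 + i : ℕ) : ℝ) := fun i => Real.log_pos (by push_cast; linarith [Nat.cast_nonneg (α := ℝ) i])
  have hlarge : ‖∑ n ∈ Ico M0 (N + 1), a n‖ ≤ g 0 * (2 * (C * P * x * L ^ m)) := by
    have e : ∑ n ∈ Ico M0 (N + 1), a n = ∑ i ∈ range (N + 1 - M0), (g i : ℂ) * b (M0 + i) := by
      rw [sum_Ico_eq_sum_range]
      refine sum_congr rfl fun i _ => ?_
      have h1 : Complex.log ((M0 + i : ℕ) : ℂ) ≠ 0 := by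
        rw [← Complex.natCast_log]; exact_mod_cast (hlogpos i).ne'
      simp only [hg, hb, Complex.ofReal_inv, Complex.ofReal_pow, Complex.natCast_log]
      field_simp
    rw [e]
    refine norm_sum_mul_le_of_antitone (b := fun i => b (M0 + i)) _ (fun i _ => ?_) (fun i _ => ?_) (fun i hi => ?_) ?_
    · simp only [hg]
      have h1 := hlogpos i
      refine inv_anti₀ (by positivity) ?_
      have : Real.log ((M0 + i : ℕ) : ℝ) ≤ Real.log ((M0 + (i + 1) : ℕ) : ℝ) :=
        Real.log_le_log (by push_cast; linarith [Nat.cast_nonneg (α := ℝ) i]) (by push_cast; linarith)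
      gcongr
    · have := hlogpos i; simp only [hg]; positivity
    · rcases Nat.eq_zero_or_pos i with rfl | hi0
      · simp; positivity
      · have e1 : ∑ j ∈ range i, b (M0 + j) = ∑ j ∈ range (M0 + i), b j - ∑ j ∈ range M0, b j := by
          rw [sum_range_add]; ring
        rw [e1]
        have e2 := hBn (M0 + i - 1) (by omega) (by omega)
        rw [Nat.sub_add_cancel (by omega)] at e2
        have e3 := hBn ⌊√x⌋₊ le_rfl (by omega)
        linarith [norm_sub_le (∑ j ∈ range (M0 + i), b j) (∑ j ∈ range M0, b j)]
    · have := hlogpos 0; simp only [hg]; positivity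
  have hg0 : g 0 ≤ 2 ^ (2 * m - 1) / L ^ (2 * m - 1) := by
    have h1 : L / 2 ≤ Real.log (M0 : ℝ) := by
      have := Real.log_le_log (by positivity) hM0s.le
      rwa [Real.log_sqrt hx0.le] at this
    simp only [hg, add_zero]
    rw [← div_pow, ← inv_pow]
    refine pow_le_pow_left₀ (by have := hlogpos 0; positivity) ?_ _
    rw [← inv_div]
    exact inv_anti₀ (by linarith) h1
  have hsl : √x * L ≤ x / L ^ (m - 1) := by
    rw [le_div_iff₀ (by positivity), mul_assoc, ← pow_succ', Nat.sub_add_cancel hm]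
    have : L ^ m ≤ √x := Real.le_sqrt_of_sq_le (by rw [← pow_mul, mul_comm m]; exact hLm)
    calc √x * L ^ m ≤ √x * √x := by gcongr
      _ = x := hsx
  have hl2 : g 0 * (2 * (C * P * x * L ^ m)) ≤ 2 * (2 ^ (2 * m - 1) * C) * P * x / L ^ (m - 1) := by
    calc g 0 * (2 * (C * P * x * L ^ m)) ≤ 2 ^ (2 * m - 1) / L ^ (2 * m - 1) * (2 * (C * P * x * L ^ m)) := by gcongr
      _ = _ := by
        rw [show 2 * m - 1 = m + (m - 1) by omega, pow_add L]
        have hL0 : L ≠ 0 := by linarith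
        field_simp
  have h5 : 4 * (x / L ^ (m - 1)) ≤ P * (4 * (x / L ^ (m - 1))) := le_mul_of_one_le_left (by positivity) hP
  calc _ ≤ ‖∑ n ∈ range M0, a n‖ + ‖∑ n ∈ Ico M0 (N + 1), a n‖ := norm_add_le _ _
    _ ≤ 4 * (√x * L) + 2 * (2 ^ (2 * m - 1) * C) * P * x / L ^ (m - 1) := by linarith
    _ ≤ P * (4 * (x / L ^ (m - 1))) + 2 * (2 ^ (2 * m - 1) * C) * P * x / L ^ (m - 1) := by linarith
    _ = _ := by ring

end

section

open DirichletCharacter ArithmeticFunction Filter Topology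

lemma eventually_one_lt_re {s : ℂ} (hs : 1 < s.re) : ∀ᶠ z : ℂ in 𝓝 s, 1 < z.re :=
  (isOpen_lt continuous_const Complex.continuous_re).mem_nhds hs

lemma iteratedDeriv_LSeries_twistLambda_le (k : ℕ) : ∃ K : ℝ, 1 ≤ K ∧ ∀ (q : ℕ) [NeZero q]
    (χ : DirichletCharacter ℂ q), χ ≠ 1 → ∀ s : ℂ, 1 < s.re → s.re ≤ 2 →
    ‖iteratedDeriv k (LSeries (twistLambda χ)) s‖ ≤ K * q * (|s.im| + 2) ^ (1 / 2 : ℝ) := by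
  set ε : ℝ := 1 / (2 * (2 * k + 2)) with hε
  have hεp : 0 < ε := by positivity
  have hk0 : (0 : ℝ) ≤ k := by positivity
  have hε1 : ε ≤ 1 := by rw [hε, div_le_one (by positivity)]; linarith
  have hke : (2 * k + 2) * ε = 1 / 2 := by rw [hε]; field_simp
  obtain ⟨C, hC, r, hr, hr2, h⟩ := subPoly_regL hεp
  obtain ⟨c, hc, hc1, hlow⟩ := norm_LFunction_lower hεp
  obtain ⟨K, hK, hb⟩ := SubPoly.logDeriv_le hC hεp.le hε1 hr hr2 hc hc1 k
  refine ⟨max K 1, le_max_right _ _, fun q _ χ hχ s hs1 hs2 => ?_⟩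
  have hq := one_le_natCast_of_neZero q
  have e : LSeries (twistLambda χ) =ᶠ[𝓝 s] fun z => -(deriv (regL χ) z / regL χ z) := by
    filter_upwards [eventually_one_lt_re hs1] with z hz
    have e1 : LFunction χ =ᶠ[𝓝 z] regL χ := by
      filter_upwards [eventually_one_lt_re hz] with w hw
      exact LFunction_eq_regL hχ (by linarith)
    have h2 := LFunction_ne_zero_of_one_le_re χ (s := z) (Or.inl hχ) hz.le
    rw [← e1.deriv_eq, ← e1.eq_of_nhds, deriv_LFunction_eq χ hz]
    field_simp
  rw [e.iteratedDeriv_eq, iteratedDeriv_fun_neg, norm_neg]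
  refine (hb (regL χ) q hq (h q χ) (fun z h1 h2 => ?_) s hs1 hs2).trans ?_
  · rw [← LFunction_eq_regL hχ (by linarith)]
    exact hlow q χ hχ z h1 h2
  · rw [hke, Real.mul_rpow (by positivity) (by positivity), ← mul_assoc]
    have : (q : ℝ) ^ (1 / 2 : ℝ) ≤ q := by
      calc (q : ℝ) ^ (1 / 2 : ℝ) ≤ (q : ℝ) ^ (1 : ℝ) := Real.rpow_le_rpow_of_exponent_le hq (by norm_num)
        _ = q := Real.rpow_one _
    gcongr
    exact le_max_left _ _

/-- The coefficients `Λ(n) - 1`, vanishing at `0`. -/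
noncomputable def cLambdaSub : ℕ → ℂ := cLambda - fun n => if n = 0 then 0 else 1

lemma lseries_one_eq {s : ℂ} (hs : 1 < s.re) :
    LSeriesSummable (fun n : ℕ => if n = 0 then (0 : ℂ) else 1) s ∧
    LSeries (fun n : ℕ => if n = 0 then (0 : ℂ) else 1) s = riemannZeta s := by
  have e : ∀ n : ℕ, n ≠ 0 → (1 : ℕ → ℂ) n = if n = 0 then (0 : ℂ) else 1 := by
    intro n hn; simp [hn]
  refine ⟨(LSeriesSummable_congr s (fun {n} hn => e n hn)).1 (LSeriesSummable_one_iff.2 hs), ?_⟩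
  rw [← LSeries_congr (fun {n} hn => e n hn) s, LSeries_one_eq_riemannZeta hs]

lemma lseries_cLambdaSub_eq {s : ℂ} (hs : 1 < s.re) :
    LSeries cLambdaSub s = -(deriv zetaV s / zetaV s) - (riemannZeta₀ s + s⁻¹) := by
  obtain ⟨h1, h2⟩ := lseries_one_eq hs
  rw [cLambdaSub, LSeries_sub (lseriesSummable_cLambda hs) h1, h2]
  have hs0 : s ≠ 0 := ne_zero_of_re_pos (by linarith)
  have hs1 : s ≠ 1 := by rintro rfl; simp at hs
  have hs1' := sub_ne_zero.2 hs1
  have hz := riemannZeta_ne_zero_of_one_le_re hs.le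
  have e : zetaV =ᶠ[𝓝 s] fun z => (z - 1) / z * riemannZeta z := by
    filter_upwards [eventually_one_lt_re hs] with z hz
    exact zetaV_eq (ne_zero_of_re_pos (by linarith)) (by rintro rfl; simp at hz)
  have hd : HasDerivAt (fun z : ℂ => (z - 1) / z * riemannZeta z)
      ((1 * s - (s - 1) * 1) / s ^ 2 * riemannZeta s + (s - 1) / s * deriv riemannZeta s) s :=
    (((hasDerivAt_id s).sub_const 1).div (hasDerivAt_id s) hs0).mul
      (differentiableAt_riemannZeta_of_one_lt hs).hasDerivAt
  rw [e.deriv_eq, e.eq_of_nhds, hd.deriv, deriv_riemannZeta_eq hs]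
  have hz2 : riemannZeta s = 1 / (s - 1) + riemannZeta₀ s := by
    rw [riemannZeta_eq_inv_sub_mul hs1, riemannZeta₁]; field_simp
  have hz3 : riemannZeta₀ s = riemannZeta s - 1 / (s - 1) := by rw [hz2]; ring
  rw [hz3]
  field_simp
  ring

lemma iteratedDeriv_LSeries_cLambdaSub_le (k : ℕ) : ∃ K : ℝ, 1 ≤ K ∧ ∀ s : ℂ, 1 < s.re → s.re ≤ 2 →
    ‖iteratedDeriv k (LSeries cLambdaSub) s‖ ≤ K * (|s.im| + 2) ^ (1 / 2 : ℝ) := by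
  set ε : ℝ := 1 / (2 * (2 * k + 2)) with hε
  have hεp : 0 < ε := by positivity
  have hk0 : (0 : ℝ) ≤ k := by positivity
  have hε1 : ε ≤ 1 := by rw [hε, div_le_one (by positivity)]; linarith
  have hε2 : ε ≤ 1 / 2 := by rw [hε]; gcongr; linarith
  have hke : (2 * k + 2) * ε = 1 / 2 := by rw [hε]; field_simp
  obtain ⟨C, hC, r, hr, hr2, h⟩ := subPoly_zetaV hεp
  obtain ⟨c, hc, hc1, hlow⟩ := norm_zetaV_lower hεp
  obtain ⟨K, hK, hb⟩ := SubPoly.logDeriv_le hC hεp.le hε1 hr hr2 hc hc1 k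
  obtain ⟨C', hC', r', hr', hr2', h'⟩ := subPoly_riemannZeta₀ hεp
  have hg : SubPoly (fun s => riemannZeta₀ s + s⁻¹) 1 (C' + 2) ε r' := by
    refine ⟨h'.diff.add (differentiableOn_inv.mono fun z hz => ne_zero_of_re_pos hz), fun s h1 h2 => ?_⟩
    have hX : 1 ≤ (1 * (|s.im| + 2)) ^ ε := Real.one_le_rpow (one_le_conductor le_rfl _) hεp.le
    have hre : 1 / 2 ≤ s.re := by linarith
    have hn : 1 / 2 ≤ ‖s‖ := hre.trans ((le_abs_self _).trans (Complex.abs_re_le_norm s))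
    have hi : ‖s⁻¹‖ ≤ 2 := by
      rw [norm_inv, inv_le_comm₀ (by linarith) (by norm_num)]; linarith
    have := h'.bound s h1 h2
    have := norm_add_le (riemannZeta₀ s) s⁻¹
    nlinarith
  refine ⟨max (K + k.factorial * (2 * (C' + 2)) / (r' / 2) ^ k) 1, le_max_right _ _, fun s hs1 hs2 => ?_⟩
  have e : LSeries cLambdaSub =ᶠ[𝓝 s] fun z => -(deriv zetaV z / zetaV z) - (riemannZeta₀ z + z⁻¹) := by
    filter_upwards [eventually_one_lt_re hs1] with z hz
    exact lseries_cLambdaSub_eq hz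
  have hU : {s : ℂ | 0 < s.re} ∈ 𝓝 s := isOpen_re_pos.mem_nhds (show 0 < s.re by linarith)
  have c1 : ContDiffAt ℂ k (fun z => deriv zetaV z / zetaV z) s := by
    have a1 : ContDiffAt ℂ k (deriv zetaV) s :=
      ((differentiableOn_zetaV.deriv isOpen_re_pos).analyticAt hU).contDiffAt
    exact a1.div (differentiableOn_zetaV.analyticAt hU).contDiffAt (zetaV_ne_zero hs1.le)
  have c2 : ContDiffAt ℂ k (fun z => riemannZeta₀ z + z⁻¹) s := (hg.diff.analyticAt hU).contDiffAt
  rw [e.iteratedDeriv_eq, iteratedDeriv_fun_sub c1.neg c2, iteratedDeriv_fun_neg]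
  refine (norm_sub_le _ _).trans ?_
  rw [norm_neg]
  have b1 := hb zetaV 1 le_rfl h hlow s hs1 hs2
  have b2 := hg.iteratedDeriv_le le_rfl (by linarith) hεp.le hε1 hr' hr2' k (s := s) (by linarith) (by linarith)
  rw [hke, one_mul] at b1
  have hY : (1 * (|s.im| + 2)) ^ ε ≤ (|s.im| + 2) ^ (1 / 2 : ℝ) := by
    rw [one_mul]; exact Real.rpow_le_rpow_of_exponent_le (by linarith [abs_nonneg s.im]) hε2
  calc _ ≤ K * (|s.im| + 2) ^ (1 / 2 : ℝ)
        + k.factorial * (2 * (C' + 2) * (|s.im| + 2) ^ (1 / 2 : ℝ)) / (r' / 2) ^ k :=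
        add_le_add b1 (b2.trans (by gcongr))
    _ = (K + k.factorial * (2 * (C' + 2)) / (r' / 2) ^ k) * (|s.im| + 2) ^ (1 / 2 : ℝ) := by ring
    _ ≤ _ := by gcongr; exact le_max_left _ _

lemma twistLambda_sum_bound (m : ℕ) (hm : 1 ≤ m) : ∃ C : ℝ, 0 < C ∧ ∃ x₁ : ℝ, ∀ (q : ℕ) [NeZero q]
    (χ : DirichletCharacter ℂ q), χ ≠ 1 → ∀ x : ℝ, x₁ ≤ x →
    ‖∑ n ∈ Finset.range (⌊x⌋₊ + 1), twistLambda χ n‖ ≤ C * q * x / Real.log x ^ (m - 1) := by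
  obtain ⟨C, hC, x1, h⟩ := perron_bound m hm
  obtain ⟨K, hK, hb⟩ := iteratedDeriv_LSeries_twistLambda_le (2 * m - 1)
  refine ⟨C * K, by positivity, x1, fun q _ χ hχ x hx => ?_⟩
  have hq := one_le_natCast_of_neZero q
  have := h (twistLambda χ) (K * q) (by nlinarith) (by simp [twistLambda]) (fun n hn => ?_)
    (fun s hs => lseriesSummable_twistLambda χ hs) (hb q χ hχ) x hx
  · rwa [← mul_assoc C K] at this
  · have h1 := χ.norm_le_one (n : ZMod q)
    have h2 := vonMangoldt_le_log (n := n)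
    have h3 := vonMangoldt_nonneg (n := n)
    rw [twistLambda, Pi.mul_apply, norm_mul, Complex.norm_real, Real.norm_of_nonneg h3]
    nlinarith

lemma cLambdaSub_sum_bound (m : ℕ) (hm : 1 ≤ m) : ∃ C : ℝ, 0 < C ∧ ∃ x₁ : ℝ, ∀ x : ℝ, x₁ ≤ x →
    ‖∑ n ∈ Finset.range (⌊x⌋₊ + 1), cLambdaSub n‖ ≤ C * x / Real.log x ^ (m - 1) := by
  obtain ⟨C, hC, x1, h⟩ := perron_bound m hm
  obtain ⟨K, hK, hb⟩ := iteratedDeriv_LSeries_cLambdaSub_le (2 * m - 1)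
  refine ⟨C * K, by positivity, x1, fun x hx => ?_⟩
  refine h cLambdaSub K hK (by simp [cLambdaSub, cLambda]) (fun n hn => ?_)
    (fun s hs => (lseriesSummable_cLambda hs).sub (lseries_one_eq hs).1) hb x hx
  have h2 := vonMangoldt_le_log (n := n)
  have h3 := vonMangoldt_nonneg (n := n)
  have h4 : n ≠ 0 := by omega
  rw [cLambdaSub, Pi.sub_apply, cLambda, if_neg h4]
  refine (norm_sub_le _ _).trans ?_
  rw [Complex.norm_real, Real.norm_of_nonneg h3, norm_one]
  linarith

end

section

open DirichletCharacter ArithmeticFunction Filter Topology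

/-- The primes up to `x`. -/
noncomputable def primesLe (x : ℝ) : Finset ℕ := (Finset.range (⌊x⌋₊ + 1)).filter Nat.Prime

lemma mem_primesLe {x : ℝ} (hx : 0 ≤ x) {p : ℕ} : p ∈ primesLe x ↔ (p : ℝ) ≤ x ∧ p.Prime := by
  rw [primesLe, Finset.mem_filter, Finset.mem_range, Nat.lt_succ_iff, Nat.le_floor_iff hx]

lemma sum_vonMangoldt_eq_psi (x : ℝ) :
    ∑ n ∈ Finset.range (⌊x⌋₊ + 1), vonMangoldt n = Chebyshev.psi x := by
  rw [Chebyshev.psi, Finset.range_eq_Ico, Finset.sum_eq_sum_Ico_succ_bot (by omega)]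
  simp only [ArithmeticFunction.map_zero, zero_add]
  rfl

lemma sum_primesLe_log_eq_theta (x : ℝ) : ∑ p ∈ primesLe x, Real.log p = Chebyshev.theta x := by
  rw [Chebyshev.theta]
  refine Finset.sum_congr (Finset.ext fun p => ?_) fun _ _ => rfl
  simp only [primesLe, Finset.mem_filter, Finset.mem_range, Finset.mem_Ioc, Nat.lt_succ_iff]
  exact ⟨fun h => ⟨⟨h.2.pos, h.1⟩, h.2⟩, fun h => ⟨h.1.2, h.2⟩⟩

lemma norm_sum_mul_vonMangoldt_sub_le {x : ℝ} (hx : 1 ≤ x) {b : ℕ → ℂ} (hb : ∀ n, ‖b n‖ ≤ 1) :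
    ‖∑ n ∈ Finset.range (⌊x⌋₊ + 1), b n * (vonMangoldt n : ℂ) - ∑ p ∈ primesLe x, b p * (Real.log p : ℂ)‖
      ≤ 2 * √x * Real.log x := by
  have e1 := Finset.sum_filter_add_sum_filter_not (Finset.range (⌊x⌋₊ + 1)) Nat.Prime
    (fun n => b n * (vonMangoldt n : ℂ))
  have e2 := Finset.sum_filter_add_sum_filter_not (Finset.range (⌊x⌋₊ + 1)) Nat.Prime
    (fun n => vonMangoldt n)
  have e3 : ∑ p ∈ primesLe x, b p * (Real.log p : ℂ) = ∑ p ∈ primesLe x, b p * (vonMangoldt p : ℂ) :=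
    Finset.sum_congr rfl fun p hp => by rw [vonMangoldt_apply_prime (Finset.mem_filter.1 hp).2]
  have e4 : ∑ p ∈ primesLe x, vonMangoldt p = Chebyshev.theta x := by
    rw [← sum_primesLe_log_eq_theta]
    exact Finset.sum_congr rfl fun p hp => by rw [vonMangoldt_apply_prime (Finset.mem_filter.1 hp).2]
  rw [sum_vonMangoldt_eq_psi] at e2
  rw [primesLe] at e3 e4 ⊢
  rw [e3, ← e1, add_sub_cancel_left]
  refine le_trans ?_ (Chebyshev.psi_sub_theta_le hx)
  rw [← e2, ← e4, add_sub_cancel_left]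
  refine norm_sum_le_of_le _ fun n _ => ?_
  rw [norm_mul, Complex.norm_real, Real.norm_of_nonneg vonMangoldt_nonneg]
  exact mul_le_of_le_one_left vonMangoldt_nonneg (hb n)

lemma theta_sub_bound (m : ℕ) (hm : 1 ≤ m) : ∃ C : ℝ, 0 < C ∧ ∃ x₁ : ℝ, ∀ x : ℝ, x₁ ≤ x →
    |∑ p ∈ primesLe x, Real.log p - x| ≤ C * x / Real.log x ^ (m - 1) + 2 * √x * Real.log x + 1 := by
  obtain ⟨C, hC, x1, h⟩ := cLambdaSub_sum_bound m hm
  refine ⟨C, hC, max x1 1, fun x hx => ?_⟩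
  have hx1 : 1 ≤ x := (le_max_right _ _).trans hx
  have h1 := h x ((le_max_left _ _).trans hx)
  have e : ∑ n ∈ Finset.range (⌊x⌋₊ + 1), cLambdaSub n = ((Chebyshev.psi x - ⌊x⌋₊ : ℝ) : ℂ) := by
    simp only [cLambdaSub, Pi.sub_apply, Finset.sum_sub_distrib]
    rw [Finset.sum_range_succ' (fun n : ℕ => if n = 0 then (0 : ℂ) else 1)]
    simp [cLambda, ← sum_vonMangoldt_eq_psi]
  rw [e, Complex.norm_real, Real.norm_eq_abs] at h1
  rw [sum_primesLe_log_eq_theta]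
  have h2 := Chebyshev.psi_sub_theta_le hx1
  have h3 := Chebyshev.theta_le_psi x
  have h4 := Nat.floor_le (zero_le_one.trans hx1)
  have h5 := Nat.lt_floor_add_one x
  rw [abs_le] at h1 ⊢
  constructor <;> linarith [h1.1, h1.2]

lemma totient_mul_Ef_eq {x : ℝ} {q ℓ : ℕ} [NeZero q] (h : Nat.gcd ℓ q = 1) :
    ((q.totient * Ef x q ℓ : ℝ) : ℂ) =
      ∑ χ : DirichletCharacter ℂ q, χ (ℓ : ZMod q)⁻¹ * ∑ p ∈ primesLe x, χ p * (Real.log p : ℂ) - x := by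
  have hu : IsUnit (ℓ : ZMod q) := (ZMod.isUnit_iff_coprime ℓ q).2 h
  have ht : (q.totient : ℂ) ≠ 0 := by exact_mod_cast (Nat.totient_pos.2 (NeZero.pos q)).ne'
  have e : ∑ χ : DirichletCharacter ℂ q, χ (ℓ : ZMod q)⁻¹ * ∑ p ∈ primesLe x, χ p * (Real.log p : ℂ)
      = ∑ p ∈ primesLe x, (if (ℓ : ZMod q) = p then (q.totient : ℂ) else 0) * (Real.log p : ℂ) := by
    simp_rw [Finset.mul_sum]
    rw [Finset.sum_comm]
    refine Finset.sum_congr rfl fun p _ => ?_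
    rw [← sum_char_inv_mul_char_eq ℂ hu, Finset.sum_mul]
    exact Finset.sum_congr rfl fun χ _ => by ring
  rw [e, Ef]
  push_cast
  rw [mul_sub, mul_div_cancel₀ _ ht, Finset.mul_sum]
  congr 1
  simp only [ite_mul, zero_mul]
  rw [← Finset.sum_filter, primesLe, Finset.filter_filter]
  refine Finset.sum_congr (Finset.ext fun p => ?_) fun _ _ => rfl
  simp only [Finset.mem_filter]
  rw [ZMod.natCast_eq_natCast_iff', eq_comm (a := ℓ % q)]

lemma abs_Ef_le {x M : ℝ} {q ℓ : ℕ} [NeZero q] (h : Nat.gcd ℓ q = 1)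
    (h1 : ‖∑ p ∈ primesLe x, (1 : DirichletCharacter ℂ q) p * (Real.log p : ℂ) - x‖ ≤ M)
    (h2 : ∀ χ : DirichletCharacter ℂ q, χ ≠ 1 → ‖∑ p ∈ primesLe x, χ p * (Real.log p : ℂ)‖ ≤ M) :
    |Ef x q ℓ| ≤ M := by
  have hu : IsUnit (ℓ : ZMod q) := (ZMod.isUnit_iff_coprime ℓ q).2 h
  have ht : (0 : ℝ) < q.totient := by exact_mod_cast Nat.totient_pos.2 (NeZero.pos q)
  have e := totient_mul_Ef_eq (x := x) h
  rw [← Finset.add_sum_erase _ _ (Finset.mem_univ (1 : DirichletCharacter ℂ q))] at e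
  have hl : (1 : DirichletCharacter ℂ q) (ℓ : ZMod q)⁻¹ = 1 := by
    obtain ⟨u, hu'⟩ := hu
    rw [← hu', ZMod.inv_coe_unit]
    exact MulChar.one_apply_coe _
  rw [hl, one_mul, add_sub_right_comm] at e
  have hb := congrArg norm e
  rw [Complex.norm_real, Real.norm_eq_abs, abs_mul, abs_of_pos ht] at hb
  have hcard : (Finset.univ.erase (1 : DirichletCharacter ℂ q)).card = q.totient - 1 := by
    rw [Finset.card_erase_of_mem (Finset.mem_univ _), ← card_eq_totient_of_hasEnoughRootsOfUnity ℂ q,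
      Nat.card_eq_fintype_card, Finset.card_univ]
  refine le_of_mul_le_mul_left ?_ ht
  rw [hb]
  refine (norm_add_le _ _).trans ?_
  calc _ ≤ M + ∑ χ ∈ Finset.univ.erase (1 : DirichletCharacter ℂ q), M := by
        refine add_le_add h1 (norm_sum_le_of_le _ fun χ hχ => ?_)
        rw [norm_mul]
        refine (mul_le_of_le_one_left (norm_nonneg _) (χ.norm_le_one _)).trans ?_
        exact h2 χ (Finset.ne_of_mem_erase hχ)
    _ = q.totient * M := by
        rw [Finset.sum_const, hcard, nsmul_eq_mul, Nat.cast_sub (Nat.totient_pos.2 (NeZero.pos q))]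
        push_cast; ring

lemma norm_principal_sub_le {x : ℝ} {q : ℕ} [NeZero q] (hx : 1 ≤ x) :
    ‖∑ p ∈ primesLe x, (1 : DirichletCharacter ℂ q) p * (Real.log p : ℂ) - (∑ p ∈ primesLe x, Real.log p : ℝ)‖
      ≤ q * Real.log x := by
  rw [Complex.ofReal_sum, ← Finset.sum_sub_distrib]
  have hL := Real.log_nonneg hx
  have hz : ∀ p ∈ primesLe x, p ∉ q.primeFactors →
      (1 : DirichletCharacter ℂ q) p * (Real.log p : ℂ) - (Real.log p : ℂ) = 0 := by
    intro p hp hpq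
    have hpp := ((mem_primesLe (by linarith)).1 hp).2
    rw [MulChar.one_apply ((ZMod.isUnit_prime_iff_not_dvd hpp).2 fun hd =>
      hpq (Nat.mem_primeFactors.2 ⟨hpp, hd, NeZero.ne q⟩)), one_mul, sub_self]
  rw [← Finset.sum_filter_add_sum_filter_not (primesLe x) (fun p => p ∈ q.primeFactors),
    Finset.sum_eq_zero (s := (primesLe x).filter (fun p => ¬ p ∈ q.primeFactors))
      (fun p hp => hz p (Finset.mem_filter.1 hp).1 (Finset.mem_filter.1 hp).2), add_zero]
  calc _ ≤ ∑ p ∈ (primesLe x).filter (fun p => p ∈ q.primeFactors), Real.log x := by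
        refine norm_sum_le_of_le _ fun p hp => ?_
        have hp' := Finset.mem_filter.1 hp
        have hpp := (mem_primesLe (by linarith)).1 hp'.1
        have : ¬ IsUnit (p : ZMod q) := fun hu =>
          (ZMod.isUnit_prime_iff_not_dvd hpp.2).1 hu (Nat.dvd_of_mem_primeFactors hp'.2)
        rw [MulChar.map_nonunit _ this, zero_mul, zero_sub, norm_neg, Complex.norm_real,
          Real.norm_of_nonneg (Real.log_natCast_nonneg p)]
        exact Real.log_le_log (by exact_mod_cast hpp.2.pos) hpp.1
    _ ≤ q * Real.log x := by
        rw [Finset.sum_const, nsmul_eq_mul]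
        gcongr
        calc _ ≤ (Finset.Icc 1 q).card := Finset.card_le_card fun p hp => by
              have := (Finset.mem_filter.1 hp).2
              exact Finset.mem_Icc.2 ⟨(Nat.prime_of_mem_primeFactors this).pos,
                Nat.le_of_mem_primeFactors this⟩
          _ = q := by simp

/-- The Siegel–Walfisz theorem. -/
theorem siegelWalfisz (N A : ℕ) : ∃ K : ℝ, 0 < K ∧ ∃ x₀ : ℝ, ∀ x : ℝ, x₀ ≤ x → ∀ q : ℕ, 1 ≤ q →
    (q : ℝ) ≤ Real.log x ^ N → ∀ ℓ : ℕ, Nat.gcd ℓ q = 1 → |Ef x q ℓ| ≤ K * x / Real.log x ^ A := by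
  obtain ⟨C, hC, x1, h1⟩ := twistLambda_sum_bound (N + A + 1) (by omega)
  obtain ⟨C', hC', x2, h2⟩ := theta_sub_bound (N + A + 1) (by omega)
  obtain ⟨x3, h3⟩ := eventually_atTop.1 (eventually_log_pow_le (2 * (N + A + 1)) 1 one_pos)
  refine ⟨C + C' + 4, by positivity, max (max x1 x2) (max x3 3), fun x hx q hq1 hqN ℓ hℓ => ?_⟩
  have : NeZero q := ⟨by omega⟩
  have h1 := h1 q
  have hx1 : x1 ≤ x := (le_max_left _ _).trans ((le_max_left _ _).trans hx)
  have hx2 : x2 ≤ x := (le_max_right _ _).trans ((le_max_left _ _).trans hx)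
  have h3 := h3 x ((le_max_left _ _).trans ((le_max_right _ _).trans hx))
  have hx3 : 3 ≤ x := (le_max_right _ _).trans ((le_max_right _ _).trans hx)
  have h2 := h2 x hx2
  rw [Nat.add_sub_cancel] at h2
  set L := Real.log x with hL
  have hL1 : 1 ≤ L := by
    rw [hL, Real.le_log_iff_exp_le (by linarith)]; linarith [Real.exp_one_lt_d9]
  have hL0 : 0 < L := by linarith
  have hs : L ^ (N + A + 1) ≤ √x := by
    refine Real.le_sqrt_of_sq_le ?_
    rw [← pow_mul, mul_comm _ 2]; linarith
  have hss : √x * √x = x := Real.mul_self_sqrt (by linarith)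
  have hs1 : √x * L ≤ x / L ^ A := by
    rw [le_div_iff₀ (by positivity)]
    have : L * L ^ A ≤ L ^ (N + A + 1) := by
      rw [← pow_succ']; exact pow_le_pow_right₀ hL1 (by omega)
    have := mul_le_mul_of_nonneg_left (this.trans hs) (Real.sqrt_nonneg x)
    nlinarith
  have hq2 : q * L + 1 ≤ 2 * (x / L ^ A) := by
    rw [← mul_div_assoc, le_div_iff₀ (by positivity)]
    have a1 : q * L * L ^ A ≤ L ^ (N + A + 1) := by
      calc _ ≤ L ^ N * L * L ^ A := by gcongr
        _ = _ := by ring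
    have a2 : L ^ A ≤ L ^ (N + A + 1) := pow_le_pow_right₀ hL1 (by omega)
    have a3 : √x ≤ x := by
      have : 1 ≤ √x := Real.one_le_sqrt.2 (by linarith)
      nlinarith
    nlinarith
  have hqC : ∀ D : ℝ, 0 < D → D * q * x / L ^ (N + A) ≤ D * (x / L ^ A) := by
    intro D hD
    rw [pow_add, div_le_iff₀ (by positivity)]
    calc D * q * x ≤ D * L ^ N * x := by gcongr
      _ = _ := by field_simp
  have hC'2 : C' * x / L ^ (N + A) ≤ C' * (x / L ^ A) := by
    refine le_trans ?_ (hqC C' hC')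
    have : (1 : ℝ) ≤ q := by exact_mod_cast hq1
    gcongr
    nlinarith
  have hxA : 0 < x / L ^ A := by positivity
  rw [mul_div_assoc]
  have hC1 : 0 < C * (x / L ^ A) := by positivity
  have hC2 : 0 < C' * (x / L ^ A) := by positivity
  refine abs_Ef_le hℓ ?_ fun χ hχ => ?_
  · have b1 := norm_principal_sub_le (q := q) (x := x) (by linarith)
    have b2 := norm_sub_le_norm_sub_add_norm_sub
      (∑ p ∈ primesLe x, (1 : DirichletCharacter ℂ q) p * (Real.log p : ℂ))
      ((∑ p ∈ primesLe x, Real.log p : ℝ) : ℂ) (x : ℂ)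
    rw [← Complex.ofReal_sub (∑ p ∈ primesLe x, Real.log p), Complex.norm_real, Real.norm_eq_abs] at b2
    linarith
  · have b1 := norm_sum_mul_vonMangoldt_sub_le (x := x) (by linarith) (b := fun n => χ n)
      (fun n => χ.norm_le_one _)
    have b2 := h1 χ hχ x hx1
    rw [Nat.add_sub_cancel] at b2
    have b3 := norm_sub_norm_le (∑ p ∈ primesLe x, χ p * (Real.log p : ℂ))
      (∑ n ∈ Finset.range (⌊x⌋₊ + 1), χ n * (vonMangoldt n : ℂ))
    rw [norm_sub_rev] at b3
    have b4 : ‖∑ n ∈ Finset.range (⌊x⌋₊ + 1), χ n * (vonMangoldt n : ℂ)‖ ≤ C * q * x / L ^ (N + A) := b2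
    have := hqC C hC
    linarith

end

section

open Finset ComplexConjugate

/-- The additive character `e(x) = exp(2πix)`. -/
noncomputable def eexp (x : ℝ) : ℂ := Complex.exp (Complex.I * ((2 * Real.pi * x : ℝ) : ℂ))

lemma eexp_add (x y : ℝ) : eexp (x + y) = eexp x * eexp y := by
  rw [eexp, eexp, eexp, ← Complex.exp_add]; congr 1; push_cast; ring

lemma eexp_zero : eexp 0 = 1 := by simp [eexp]

lemma norm_eexp (x : ℝ) : ‖eexp x‖ = 1 := by
  rw [eexp, mul_comm, Complex.norm_exp_ofReal_mul_I]

lemma eexp_intCast (n : ℤ) : eexp n = 1 := by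
  rw [eexp, Complex.exp_eq_one_iff]
  exact ⟨n, by push_cast; ring⟩

lemma eexp_natCast (n : ℕ) : eexp n = 1 := by exact_mod_cast eexp_intCast n

lemma eexp_neg (x : ℝ) : eexp (-x) = (eexp x)⁻¹ := by
  rw [eexp, eexp, ← Complex.exp_neg]; congr 1; push_cast; ring

lemma conj_eexp (x : ℝ) : conj (eexp x) = eexp (-x) := by
  rw [eexp_neg, ← Complex.inv_eq_conj (norm_eexp x)]

lemma eexp_sub (x y : ℝ) : eexp (x - y) = eexp x * conj (eexp y) := by
  rw [conj_eexp, ← eexp_add, sub_eq_add_neg]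

lemma norm_eexp_sub_one_le (x : ℝ) : ‖eexp x - 1‖ ≤ 2 * Real.pi * |x| := by
  refine Real.norm_exp_I_mul_ofReal_sub_one_le.trans (le_of_eq ?_)
  rw [Real.norm_eq_abs, abs_mul, abs_of_pos Real.two_pi_pos]

lemma norm_eexp_sub_le (x y : ℝ) : ‖eexp x - eexp y‖ ≤ 2 * Real.pi * |x - y| := by
  have : eexp x - eexp y = eexp y * (eexp (x - y) - 1) := by
    rw [mul_sub, ← eexp_add, add_sub_cancel, mul_one]
  rw [this, norm_mul, norm_eexp, one_mul]
  exact norm_eexp_sub_one_le _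

lemma le_norm_eexp_sub_one {x : ℝ} (hx : |x| ≤ 1 / 2) : 4 * |x| ≤ ‖eexp x - 1‖ := by
  rw [eexp, Complex.norm_exp_I_mul_ofReal_sub_one, norm_mul, Real.norm_ofNat, Real.norm_eq_abs]
  have h : |Real.sin (2 * Real.pi * x / 2)| = Real.sin (Real.pi * |x|) := by
    rw [show 2 * Real.pi * x / 2 = Real.pi * x by ring]
    rcases le_total 0 x with h0 | h0
    · rw [abs_of_nonneg h0] at hx ⊢
      exact abs_of_nonneg (Real.sin_nonneg_of_nonneg_of_le_pi (by positivity) (by nlinarith [Real.pi_pos]))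
    · rw [abs_of_nonpos h0] at hx ⊢
      rw [← abs_neg, ← Real.sin_neg, show -(Real.pi * x) = Real.pi * -x by ring]
      exact abs_of_nonneg (Real.sin_nonneg_of_nonneg_of_le_pi
        (mul_nonneg Real.pi_pos.le (by linarith)) (by nlinarith [Real.pi_pos]))
  rw [h]
  have := Real.mul_le_sin (x := Real.pi * |x|) (by positivity) (by nlinarith [Real.pi_pos])
  have e : 2 / Real.pi * (Real.pi * |x|) = 2 * |x| := by field_simp
  linarith

/-- A discrete Kusmin–Landau bound with controlled second differences. -/
lemma norm_sum_eexp_le_of_diff {φ : ℕ → ℝ} {a b : ℕ} (hab : a ≤ b) {θ κ : ℝ} (hθ : 0 < θ)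
    (h1 : ∀ n, a ≤ n → n ≤ b → θ ≤ |φ (n + 1) - φ n| ∧ |φ (n + 1) - φ n| ≤ 1 / 2)
    (h2 : ∀ n, a ≤ n → n < b → |φ (n + 2) - φ (n + 1) - (φ (n + 1) - φ n)| ≤ κ) :
    ‖∑ n ∈ Ico a b, eexp (φ n)‖ ≤ 1 / θ + (b - a : ℝ) * (κ / θ ^ 2) := by
  set w : ℕ → ℂ := fun n => (eexp (φ (n + 1) - φ n) - 1)⁻¹ with hw
  have hd : ∀ n, a ≤ n → n ≤ b → 4 * θ ≤ ‖eexp (φ (n + 1) - φ n) - 1‖ := fun n hn hnb =>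
    (mul_le_mul_of_nonneg_left (h1 n hn hnb).1 (by norm_num)).trans (le_norm_eexp_sub_one (h1 n hn hnb).2)
  have hwb : ∀ n, a ≤ n → n ≤ b → ‖w n‖ ≤ 1 / (4 * θ) := fun n hn hnb => by
    rw [hw, norm_inv, ← one_div]
    exact one_div_le_one_div_of_le (by positivity) (hd n hn hnb)
  have hz : ∀ n, a ≤ n → n ≤ b → eexp (φ n) = w n * (eexp (φ (n + 1)) - eexp (φ n)) := fun n hn hnb => by
    have hne : eexp (φ (n + 1) - φ n) - 1 ≠ 0 := norm_pos_iff.1 (by linarith [hd n hn hnb])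
    rw [hw]
    have : eexp (φ (n + 1)) - eexp (φ n) = (eexp (φ (n + 1) - φ n) - 1) * eexp (φ n) := by
      rw [sub_mul, ← eexp_add, one_mul, sub_add_cancel]
    rw [this, ← mul_assoc]
    simp only
    rw [inv_mul_cancel₀ hne, one_mul]
  have key : ∀ m, a ≤ m → m ≤ b → ‖∑ n ∈ Ico a m, eexp (φ n) - w m * eexp (φ m) + w a * eexp (φ a)‖
      ≤ (m - a : ℝ) * (κ / θ ^ 2) := by
    intro m hm
    induction m, hm using Nat.le_induction with
    | base => intro _; simp
    | succ m hm ih =>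
      intro hmb
      have ih := ih (by omega)
      rw [Finset.sum_Ico_succ_top hm]
      have e : ∑ n ∈ Ico a m, eexp (φ n) + eexp (φ m) - w (m + 1) * eexp (φ (m + 1)) + w a * eexp (φ a)
          = (∑ n ∈ Ico a m, eexp (φ n) - w m * eexp (φ m) + w a * eexp (φ a))
            + (w m - w (m + 1)) * eexp (φ (m + 1)) := by
        linear_combination hz m hm (by omega)
      rw [e]
      refine (norm_add_le _ _).trans ?_
      have hwd : ‖(w m - w (m + 1)) * eexp (φ (m + 1))‖ ≤ κ / θ ^ 2 := by
        have d1 := hd m hm (by omega)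
        have d2 := hd (m + 1) (by omega) hmb
        have n1 : eexp (φ (m + 1) - φ m) - 1 ≠ 0 := norm_pos_iff.1 (by linarith)
        have n2 : eexp (φ (m + 1 + 1) - φ (m + 1)) - 1 ≠ 0 := norm_pos_iff.1 (by linarith)
        have e2 : w m - w (m + 1) = (eexp (φ (m + 1 + 1) - φ (m + 1)) - eexp (φ (m + 1) - φ m))
            / ((eexp (φ (m + 1) - φ m) - 1) * (eexp (φ (m + 1 + 1) - φ (m + 1)) - 1)) := by
          simp only [hw]; field_simp; ring
        rw [norm_mul, norm_eexp, mul_one, e2, norm_div, norm_mul]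
        have hk := h2 m hm (by omega)
        have hk0 : 0 ≤ κ := (abs_nonneg _).trans hk
        have hnum := (norm_eexp_sub_le (φ (m + 1 + 1) - φ (m + 1)) (φ (m + 1) - φ m)).trans
          (mul_le_mul_of_nonneg_left hk Real.two_pi_pos.le)
        calc _ ≤ 2 * Real.pi * κ / (4 * θ * (4 * θ)) := by gcongr
          _ ≤ 16 * κ / (4 * θ * (4 * θ)) := by gcongr; linarith [Real.pi_lt_four]
          _ = _ := by field_simp; ring
      push_cast
      calc _ ≤ (m - a : ℝ) * (κ / θ ^ 2) + κ / θ ^ 2 := add_le_add ih hwd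
        _ = _ := by ring
  have hk := key b hab le_rfl
  have wa := hwb a le_rfl hab
  have wb := hwb b hab le_rfl
  have e : ∑ n ∈ Ico a b, eexp (φ n) = (∑ n ∈ Ico a b, eexp (φ n) - w b * eexp (φ b) + w a * eexp (φ a))
      + w b * eexp (φ b) - w a * eexp (φ a) := by ring
  rw [e]
  refine (norm_sub_le _ _).trans ((add_le_add (norm_add_le _ _) le_rfl).trans ?_)
  rw [norm_mul, norm_mul, norm_eexp, norm_eexp, mul_one, mul_one]
  have : 1 / (4 * θ) + 1 / (4 * θ) ≤ 1 / θ := by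
    have : 0 < 1 / θ := by positivity
    have e : 1 / (4 * θ) = 1 / θ / 4 := by field_simp
    rw [e]; linarith
  linarith

lemma norm_sum_sq_le_card_mul {ι : Type*} (s : Finset ι) (f : ι → ℂ) :
    ‖∑ i ∈ s, f i‖ ^ 2 ≤ s.card * ∑ i ∈ s, ‖f i‖ ^ 2 := by
  refine le_trans ?_ (sq_sum_le_card_mul_sum_sq (s := s) (f := fun i => ‖f i‖))
  gcongr
  exact norm_sum_le _ _

lemma ofReal_norm_sum_sq {ι : Type*} (s : Finset ι) (f : ι → ℂ) :
    ((‖∑ i ∈ s, f i‖ ^ 2 : ℝ) : ℂ) = ∑ i ∈ s, ∑ j ∈ s, f i * conj (f j) := by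
  rw [← Complex.normSq_eq_norm_sq, ← Complex.mul_conj, map_sum, Finset.sum_mul_sum]

/-- Van der Corput's inequality with shifts that are multiples of `h`. -/
lemma norm_sum_sq_le_vanDerCorput {z : ℕ → ℂ} (hz : ∀ n, ‖z n‖ ≤ 1) {a b h M : ℕ} (hab : a ≤ b) (hM : 1 ≤ M)
    (hha : h * M ≤ a) {T : ℝ} (hT0 : 0 ≤ T)
    (hT : ∀ d, 1 ≤ d → d < M → ‖∑ n ∈ Ico a (b - h * d), z (n + h * d) * conj (z n)‖ ≤ T) :
    ‖∑ n ∈ Ico a b, z n‖ ^ 2 ≤ ((b - a : ℝ) + h * M) * ((b - a : ℝ) / M + T) := by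
  set w : ℕ → ℂ := fun n => if a ≤ n ∧ n < b then z n else 0 with hw
  set R := Ico (a - h * M) b with hR
  have hw1 : ∀ n, ‖w n‖ ≤ 1 := fun n => by
    simp only [hw]; split_ifs
    · exact hz n
    · simp
  have hw0 : ∀ n, n ∉ Ico a b → w n = 0 := fun n hn => if_neg (fun h => hn (Finset.mem_Ico.2 h))
  have hwz : ∀ n, n ∈ Ico a b → w n = z n := fun n hn => if_pos (Finset.mem_Ico.1 hn)
  have hshift : ∀ (F : ℕ → ℂ) (i : ℕ), i < M → (∀ n, n ∉ Ico a b → F n = 0) →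
      ∑ m ∈ R, F (m + h * i) = ∑ n ∈ Ico a b, F n := by
    intro F i hi hF
    have hle : h * i ≤ h * M := Nat.mul_le_mul_left _ hi.le
    rw [hR, Finset.sum_Ico_add' F (a - h * M) b (h * i)]
    refine (Finset.sum_subset (Finset.Ico_subset_Ico (by omega) (by omega)) fun n _ hn => hF n hn).symm
  have hS : (M : ℂ) * ∑ n ∈ Ico a b, z n = ∑ m ∈ R, ∑ i ∈ range M, w (m + h * i) := by
    rw [Finset.sum_comm, Finset.sum_congr rfl fun i hi => hshift w i (Finset.mem_range.1 hi) hw0,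
      Finset.sum_const, Finset.card_range, nsmul_eq_mul, Finset.sum_congr rfl hwz]
  have hcorr : ∀ i ∈ range M, ∀ j ∈ range M, ‖∑ m ∈ R, w (m + h * i) * conj (w (m + h * j))‖ ≤
      (if i = j then (b - a : ℝ) else 0) + T := by
    have main : ∀ i j, i < j → j < M → ‖∑ m ∈ R, w (m + h * j) * conj (w (m + h * i))‖ ≤ T := by
      intro i j hij hj
      have e1 : ∑ m ∈ R, w (m + h * j) * conj (w (m + h * i)) =
          ∑ n ∈ Ico a b, w (n + h * (j - i)) * conj (w n) := by
        rw [← hshift (fun n => w (n + h * (j - i)) * conj (w n)) i (by omega)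
          (fun n hn => by simp [hw0 n hn])]
        refine Finset.sum_congr rfl fun m _ => ?_
        rw [add_assoc, ← mul_add, Nat.add_sub_cancel' hij.le]
      have e2 : ∑ n ∈ Ico a b, w (n + h * (j - i)) * conj (w n) =
          ∑ n ∈ Ico a (b - h * (j - i)), z (n + h * (j - i)) * conj (z n) := by
        rw [← Finset.sum_subset (Finset.Ico_subset_Ico le_rfl (Nat.sub_le b (h * (j - i))))]
        · refine Finset.sum_congr rfl fun n hn => ?_
          rw [Finset.mem_Ico] at hn
          rw [hwz _ (Finset.mem_Ico.2 ⟨by omega, by omega⟩), hwz n (Finset.mem_Ico.2 ⟨hn.1, by omega⟩)]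
        · intro n hn hn'
          rw [Finset.mem_Ico] at hn hn'
          rw [hw0 (n + h * (j - i)) (by rw [Finset.mem_Ico]; omega), zero_mul]
      rw [e1, e2]
      exact hT _ (by omega) (by omega)
    intro i hi j hj
    rw [Finset.mem_range] at hi hj
    have hba : (0 : ℝ) ≤ b - a := by rw [sub_nonneg]; exact_mod_cast hab
    rcases lt_trichotomy i j with hij | hij | hij
    · rw [if_neg hij.ne, zero_add, ← Complex.norm_conj, map_sum]
      simp_rw [map_mul, Complex.conj_conj, mul_comm (conj (w _))]
      exact main i j hij hj
    · subst hij
      rw [if_pos rfl, hshift (fun n => w n * conj (w n)) i hi (fun n hn => by simp [hw0 n hn])]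
      refine le_trans (norm_sum_le_of_le (n := fun _ => (1 : ℝ)) _ fun n _ => ?_) ?_
      · rw [norm_mul, Complex.norm_conj]
        exact mul_le_one₀ (hw1 n) (norm_nonneg _) (hw1 n)
      · rw [Finset.sum_const, Nat.card_Ico, nsmul_eq_mul, mul_one, Nat.cast_sub hab]
        linarith
    · rw [if_neg hij.ne', zero_add]
      exact main j i hij hi
  have hba : (0 : ℝ) ≤ b - a := by rw [sub_nonneg]; exact_mod_cast hab
  have hM0 : (0 : ℝ) < M := by exact_mod_cast hM
  have hcard : (R.card : ℝ) = (b - a : ℝ) + h * M := by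
    rw [hR, Nat.card_Ico, Nat.cast_sub (by omega), Nat.cast_sub hha]; push_cast; ring
  have h2 : ∑ m ∈ R, ‖∑ i ∈ range M, w (m + h * i)‖ ^ 2 ≤ M * (b - a : ℝ) + M ^ 2 * T := by
    have e : ((∑ m ∈ R, ‖∑ i ∈ range M, w (m + h * i)‖ ^ 2 : ℝ) : ℂ) =
        ∑ i ∈ range M, ∑ j ∈ range M, ∑ m ∈ R, w (m + h * i) * conj (w (m + h * j)) := by
      rw [Complex.ofReal_sum]
      simp_rw [ofReal_norm_sum_sq]
      rw [Finset.sum_comm]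
      exact Finset.sum_congr rfl fun i _ => Finset.sum_comm
    have hn : ∑ m ∈ R, ‖∑ i ∈ range M, w (m + h * i)‖ ^ 2 =
        ‖((∑ m ∈ R, ‖∑ i ∈ range M, w (m + h * i)‖ ^ 2 : ℝ) : ℂ)‖ := by
      rw [Complex.norm_real, Real.norm_of_nonneg (Finset.sum_nonneg fun _ _ => by positivity)]
    rw [hn, e]
    calc _ ≤ ∑ i ∈ range M, ∑ j ∈ range M, ((if i = j then (b - a : ℝ) else 0) + T) :=
          norm_sum_le_of_le _ fun i hi => norm_sum_le_of_le _ fun j hj => hcorr i hi j hj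
      _ = M * (b - a : ℝ) + M ^ 2 * T := by
          simp_rw [Finset.sum_add_distrib, Finset.sum_ite_eq]
          rw [Finset.sum_congr rfl fun i hi => if_pos hi]
          simp
          ring
  have h1 := norm_sum_sq_le_card_mul R fun m => ∑ i ∈ range M, w (m + h * i)
  rw [← hS, norm_mul, mul_pow, hcard, Complex.norm_natCast] at h1
  have h3 : (M : ℝ) ^ 2 * ‖∑ n ∈ Ico a b, z n‖ ^ 2 ≤
      (M : ℝ) ^ 2 * (((b - a : ℝ) + h * M) * ((b - a : ℝ) / M + T)) := by
    refine h1.trans ((mul_le_mul_of_nonneg_left h2 (by positivity)).trans (le_of_eq ?_))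
    field_simp
  exact le_of_mul_le_mul_left h3 (by positivity)

end

section

open Finset ComplexConjugate

/-- Iterated forward differences with the given list of shifts. -/
def shiftDiff : List ℕ → (ℝ → ℝ) → ℝ → ℝ
  | [], g => g
  | h :: hs, g => fun t => shiftDiff hs g (t + h) - shiftDiff hs g t

lemma hasDerivAt_shiftDiff {F : ℕ → ℝ → ℝ} (hF : ∀ j t, 0 < t → HasDerivAt (F j) (F (j + 1) t) t)
    (hs : List ℕ) (j : ℕ) {t : ℝ} (ht : 0 < t) :
    HasDerivAt (shiftDiff hs (F j)) (shiftDiff hs (F (j + 1)) t) t := by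
  induction hs generalizing t with
  | nil => exact hF j t ht
  | cons h hs ih =>
    have h0 : (0 : ℝ) ≤ h := by positivity
    exact ((ih (by linarith)).comp_add_const t (h : ℝ)).sub (ih ht)

lemma exists_shiftDiff_eq {F : ℕ → ℝ → ℝ} (hF : ∀ j t, 0 < t → HasDerivAt (F j) (F (j + 1) t) t)
    (hs : List ℕ) (j : ℕ) {t : ℝ} (ht : 0 < t) :
    ∃ ξ, t ≤ ξ ∧ ξ ≤ t + hs.sum ∧ shiftDiff hs (F j) t = hs.prod * F (j + hs.length) ξ := by
  induction hs generalizing t j with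
  | nil => exact ⟨t, le_rfl, by simp, by simp [shiftDiff]⟩
  | cons h hs ih =>
    have hsum : (0 : ℝ) ≤ hs.sum := by positivity
    rcases Nat.eq_zero_or_pos h with rfl | hh
    · refine ⟨t, le_rfl, ?_, by simp [shiftDiff]⟩
      rw [List.sum_cons, zero_add]; linarith
    · have hh' : (0 : ℝ) < h := by exact_mod_cast hh
      obtain ⟨ξ, hξ, e⟩ := exists_hasDerivAt_eq_slope (shiftDiff hs (F j)) (shiftDiff hs (F (j + 1)))
        (show t < t + h by linarith)
        (fun u hu => (hasDerivAt_shiftDiff hF hs j (ht.trans_le hu.1)).continuousAt.continuousWithinAt)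
        (fun u hu => hasDerivAt_shiftDiff hF hs j (ht.trans hu.1))
      obtain ⟨ζ, h1, h2, h3⟩ := ih (j + 1) (ht.trans hξ.1)
      refine ⟨ζ, hξ.1.le.trans h1, ?_, ?_⟩
      · rw [List.sum_cons, Nat.cast_add]; linarith [hξ.2]
      · rw [h3, add_sub_cancel_left, eq_div_iff hh'.ne'] at e
        rw [shiftDiff]
        simp only
        rw [← e, List.length_cons, List.prod_cons, show j + (hs.length + 1) = j + 1 + hs.length by ring]
        push_cast; ring

/-- The `j`-th derivative of `γ t ^ c`. -/
noncomputable def powFam (c γ : ℝ) (j : ℕ) (t : ℝ) : ℝ := γ * (∏ i ∈ range j, (c - i)) * t ^ (c - j)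

lemma hasDerivAt_powFam (c γ : ℝ) (j : ℕ) (t : ℝ) (ht : 0 < t) :
    HasDerivAt (powFam c γ j) (powFam c γ (j + 1) t) t := by
  have h := (Real.hasDerivAt_rpow_const (p := c - j) (Or.inl ht.ne')).const_mul (γ * ∏ i ∈ range j, (c - i))
  refine h.congr_deriv ?_
  rw [powFam, prod_range_succ, Nat.cast_succ, ← sub_sub]; ring

lemma powFam_bounds {c : ℝ} (hcne : ∀ n : ℤ, c ≠ n) (m : ℕ) : ∃ b B : ℝ, 0 < b ∧ 0 < B ∧
    ∀ γ X ξ : ℝ, 0 < γ → 0 < X → X ≤ ξ → ξ ≤ 4 * X →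
      b * (γ * X ^ c) / X ^ m ≤ |powFam c γ m ξ| ∧ |powFam c γ m ξ| ≤ B * (γ * X ^ c) / X ^ m := by
  set P := |∏ i ∈ range m, (c - i)| with hP
  have hP0 : 0 < P := abs_pos.2 (prod_ne_zero_iff.2 fun i _ => sub_ne_zero.2 (by exact_mod_cast hcne i))
  set W := (4 : ℝ) ^ |c - m| with hW
  have hW0 : 0 < W := by positivity
  refine ⟨P * W⁻¹, P * W, by positivity, by positivity, fun γ X ξ hγ hX h1 h2 => ?_⟩
  obtain ⟨u, rfl⟩ : ∃ u, ξ = X * u := ⟨ξ / X, by field_simp⟩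
  have hu1 : 1 ≤ u := by nlinarith
  have hu4 : u ≤ 4 := by nlinarith
  have hu : 0 < u := by linarith
  have b1 : u ^ (c - m) ≤ W :=
    (Real.rpow_le_rpow_of_exponent_le hu1 (le_abs_self _)).trans
      (Real.rpow_le_rpow hu.le hu4 (abs_nonneg _))
  have b2 : W⁻¹ ≤ u ^ (c - m) := by
    refine le_trans ?_ (Real.rpow_le_rpow_of_exponent_le hu1 (neg_abs_le (c - m)))
    rw [Real.rpow_neg hu.le]
    exact inv_anti₀ (by positivity) (Real.rpow_le_rpow hu.le hu4 (abs_nonneg _))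
  have e : |powFam c γ m (X * u)| = P * u ^ (c - m) * (γ * X ^ c) / X ^ m := by
    rw [powFam, abs_mul, abs_mul, abs_of_pos hγ, ← hP, abs_of_pos (by positivity),
      Real.mul_rpow hX.le hu.le, Real.rpow_sub hX, Real.rpow_natCast]
    field_simp
  rw [e]
  constructor <;> gcongr

lemma norm_sum_shiftDiff_le {c : ℝ} (hcne : ∀ n : ℤ, c ≠ n) (k : ℕ) : ∃ B C : ℝ, 0 < B ∧ 0 < C ∧
    ∀ (γ X : ℝ) (hs : List ℕ) (a b : ℕ), 0 < γ → 1 ≤ X → hs.length = k → (hs.sum : ℝ) + 2 ≤ X →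
      1 ≤ hs.prod → X ≤ a → (b : ℝ) ≤ 3 * X → B * (hs.prod * (γ * X ^ c)) / X ^ (k + 1) ≤ 1 / 2 →
      ‖∑ n ∈ Ico a b, eexp (shiftDiff hs (powFam c γ 0) n)‖ ≤ C * (X ^ (k + 1) / (hs.prod * (γ * X ^ c))) := by
  obtain ⟨b1, B1, hb1, hB1, h1⟩ := powFam_bounds hcne (k + 1)
  obtain ⟨b2, B2, hb2, hB2, h2⟩ := powFam_bounds hcne (k + 2)
  refine ⟨B1, (1 + 2 * (B2 / b1)) / b1, hB1, by positivity, ?_⟩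
  intro γ X hs a b hγ hX hk hsum hprod hXa hbX hB
  rcases le_or_gt b a with hba | hab
  · rw [Ico_eq_empty_of_le hba, sum_empty, norm_zero]; positivity
  have hX0 : 0 < X := by linarith
  have hp : (1 : ℝ) ≤ hs.prod := by exact_mod_cast hprod
  set p : ℝ := (hs.prod : ℝ) with hpd
  set F := γ * X ^ c with hF
  have hF0 : 0 < F := by positivity
  set θ := p * (b1 * F / X ^ (k + 1)) with hθ
  set κ := p * (B2 * F / X ^ (k + 2)) with hκ
  have hθ0 : 0 < θ := by positivity
  set φ : ℕ → ℝ := fun n => shiftDiff hs (powFam c γ 0) n with hφ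
  have hd1 : ∀ n : ℕ, a ≤ n → n ≤ b → θ ≤ |φ (n + 1) - φ n| ∧ |φ (n + 1) - φ n| ≤ 1 / 2 := by
    intro n hn hnb
    have hna : (a : ℝ) ≤ n := by exact_mod_cast hn
    have hnb' : (n : ℝ) ≤ b := by exact_mod_cast hnb
    obtain ⟨ξ, l1, l2, l3⟩ := exists_shiftDiff_eq (hasDerivAt_powFam c γ) (1 :: hs) 0 (t := n) (by linarith)
    rw [zero_add, List.length_cons, List.prod_cons, one_mul, hk] at l3
    have e : φ (n + 1) - φ n = p * powFam c γ (k + 1) ξ := by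
      rw [← l3]; simp [hφ, shiftDiff]
    simp only [List.sum_cons, Nat.cast_add, Nat.cast_one] at l2
    obtain ⟨m1, m2⟩ := h1 γ X ξ hγ hX0 (by linarith) (by linarith)
    rw [e, abs_mul, abs_of_pos (by linarith)]
    refine ⟨by rw [hθ]; gcongr, (mul_le_mul_of_nonneg_left m2 (by linarith)).trans ?_⟩
    refine le_trans (le_of_eq ?_) hB
    ring
  have hd2 : ∀ n : ℕ, a ≤ n → n < b → |φ (n + 2) - φ (n + 1) - (φ (n + 1) - φ n)| ≤ κ := by
    intro n hn hnb
    have hna : (a : ℝ) ≤ n := by exact_mod_cast hn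
    have hnb' : (n : ℝ) ≤ b := by exact_mod_cast hnb.le
    obtain ⟨ξ, l1, l2, l3⟩ := exists_shiftDiff_eq (hasDerivAt_powFam c γ) (1 :: 1 :: hs) 0 (t := n) (by linarith)
    rw [zero_add, List.length_cons, List.length_cons, List.prod_cons, List.prod_cons, one_mul, one_mul, hk] at l3
    have e : φ (n + 2) - φ (n + 1) - (φ (n + 1) - φ n) = p * powFam c γ (k + 2) ξ := by
      rw [← l3]; simp only [hφ, shiftDiff]; push_cast
      rw [show (n : ℝ) + 1 + 1 = n + 2 by ring]
    simp only [List.sum_cons, Nat.cast_add, Nat.cast_one] at l2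
    obtain ⟨m1, m2⟩ := h2 γ X ξ hγ hX0 (by linarith) (by linarith)
    rw [e, abs_mul, abs_of_pos (by linarith), hκ]
    gcongr
  have hmain := norm_sum_eexp_le_of_diff hab.le hθ0 hd1 hd2
  refine hmain.trans ?_
  have hlen : (b - a : ℝ) ≤ 2 * X := by linarith
  calc _ ≤ 1 / θ + (2 * X) * (κ / θ ^ 2) := by gcongr
    _ = _ := by rw [hθ, hκ]; field_simp; ring

end

section

open Finset ComplexConjugate Filter

lemma half_le_natFloor {y : ℝ} (hy : 1 ≤ y) : y / 2 ≤ ⌊y⌋₊ := by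
  have h1 := Nat.lt_floor_add_one y
  have h2 : (1 : ℝ) ≤ ⌊y⌋₊ := by exact_mod_cast (Nat.one_le_floor_iff y).2 hy
  linarith

lemma eventually_le_rpow {ρ : ℝ} (hρ : 0 < ρ) (B : ℝ) : ∃ X₀ : ℝ, 1 ≤ X₀ ∧ ∀ X : ℝ, X₀ ≤ X → B ≤ X ^ ρ := by
  obtain ⟨X1, h⟩ := eventually_atTop.1 ((tendsto_rpow_atTop hρ).eventually_ge_atTop B)
  exact ⟨max X1 1, le_max_right _ _, fun X hX => h X ((le_max_left _ _).trans hX)⟩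

lemma list_prod_le_pow {hs : List ℕ} {H : ℝ} (h : ∀ x ∈ hs, (x : ℝ) ≤ H) : (hs.prod : ℝ) ≤ H ^ hs.length := by
  induction hs with
  | nil => simp
  | cons x hs ih =>
    have h1 := ih fun y hy => h y (List.mem_cons_of_mem _ hy)
    have h2 := h x List.mem_cons_self
    rw [List.prod_cons, List.length_cons, pow_succ', Nat.cast_mul]
    exact mul_le_mul h2 h1 (by positivity) ((Nat.cast_nonneg x).trans h2)

lemma list_sum_le_mul {hs : List ℕ} {H : ℝ} (h : ∀ x ∈ hs, (x : ℝ) ≤ H) : (hs.sum : ℝ) ≤ hs.length * H := by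
  induction hs with
  | nil => simp
  | cons x hs ih =>
    have h1 := ih fun y hy => h y (List.mem_cons_of_mem _ hy)
    have h2 := h x List.mem_cons_self
    rw [List.sum_cons, List.length_cons, Nat.cast_add, Nat.cast_succ]
    linarith

lemma list_pow_le_prod {hs : List ℕ} {m : ℕ} (h : ∀ x ∈ hs, m ≤ x) : m ^ hs.length ≤ hs.prod := by
  induction hs with
  | nil => simp
  | cons x hs ih =>
    rw [List.prod_cons, List.length_cons, pow_succ']
    exact Nat.mul_le_mul (h x List.mem_cons_self) (ih fun y hy => h y (List.mem_cons_of_mem _ hy))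

lemma norm_sum_shiftDiff_le_rpow {c : ℝ} (hcne : ∀ n : ℤ, c ≠ n) {ρ : ℝ} (hρ : 0 < ρ) (hρ4 : ρ ≤ 1 / 4)
    (k i : ℕ) : ∃ D X₀ : ℝ, 1 ≤ D ∧ 1 ≤ X₀ ∧ ∀ (X γ : ℝ) (hs : List ℕ) (a b : ℕ), X₀ ≤ X → 0 < γ →
      hs.length + i = k → (∀ h ∈ hs, ⌊X ^ (1 / 2 : ℝ)⌋₊ ≤ h) → (∀ h ∈ hs, (h : ℝ) ≤ X ^ (1 / 2 + ρ)) →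
      γ * X ^ c ≤ X ^ ((k : ℝ) / 2 + 1 - (k + 1) * ρ) → X ^ ((k : ℝ) / 2 + 1) ≤ X ^ (3 / 4 : ℝ) * (γ * X ^ c) →
      X ≤ a → (b : ℝ) ≤ 3 * X →
      ‖∑ n ∈ Ico a b, eexp (shiftDiff hs (powFam c γ 0) n)‖ ≤ D * X ^ (1 - ρ / 2 ^ i) := by
  induction i with
  | zero =>
    obtain ⟨B, C, hB, hC, h⟩ := norm_sum_shiftDiff_le hcne k
    obtain ⟨X1, hX1, hX1'⟩ := eventually_le_rpow hρ (2 * B)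
    obtain ⟨X2, hX2, hX2'⟩ := eventually_le_rpow (show (0 : ℝ) < 1 / 4 by norm_num) (k + 2)
    refine ⟨max 1 (C * 2 ^ k), max X1 X2, le_max_left _ _, hX1.trans (le_max_left _ _), ?_⟩
    intro X γ hs a b hX hγ hlen hlo hhi hF1 hF2 hXa hbX
    rw [add_zero] at hlen
    have hXX1 := hX1' X ((le_max_left _ _).trans hX)
    have hXX2 := hX2' X ((le_max_right _ _).trans hX)
    have hXge : 1 ≤ X := hX1.trans ((le_max_left _ _).trans hX)
    have hX0 : 0 < X := by linarith
    set F := γ * X ^ c with hFd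
    have hF0 : 0 < F := by positivity
    have hsum : (hs.sum : ℝ) + 2 ≤ X := by
      have h1 := list_sum_le_mul hhi
      rw [hlen] at h1
      have h2 : X ^ (1 / 2 + ρ) ≤ X ^ (3 / 4 : ℝ) := Real.rpow_le_rpow_of_exponent_le hXge (by linarith)
      have h3 : 1 ≤ X ^ (3 / 4 : ℝ) := Real.one_le_rpow hXge (by norm_num)
      have h4 : X ^ (1 / 4 : ℝ) * X ^ (3 / 4 : ℝ) = X := by
        rw [← Real.rpow_add hX0]; norm_num
      have h5 : (0 : ℝ) ≤ k := by positivity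
      calc (hs.sum : ℝ) + 2 ≤ k * X ^ (3 / 4 : ℝ) + 2 * X ^ (3 / 4 : ℝ) := by nlinarith
        _ = (k + 2) * X ^ (3 / 4 : ℝ) := by ring
        _ ≤ X ^ (1 / 4 : ℝ) * X ^ (3 / 4 : ℝ) := by gcongr
        _ = X := h4
    have hY1 : 1 ≤ X ^ (1 / 2 : ℝ) := Real.one_le_rpow hXge (by norm_num)
    have hfl := half_le_natFloor hY1
    have hfl1 : 1 ≤ ⌊X ^ (1 / 2 : ℝ)⌋₊ := (Nat.one_le_floor_iff _).2 hY1
    have hplo := list_pow_le_prod hlo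
    rw [hlen] at hplo
    have hplo' : (X ^ (1 / 2 : ℝ) / 2) ^ k ≤ hs.prod := by
      calc _ ≤ ((⌊X ^ (1 / 2 : ℝ)⌋₊ : ℝ)) ^ k := by gcongr
        _ ≤ hs.prod := by exact_mod_cast hplo
    have hphi := list_prod_le_pow hhi
    rw [hlen] at hphi
    have hm := h γ X hs a b hγ hXge hlen hsum ((Nat.one_le_pow _ _ hfl1).trans hplo) hXa hbX ?_
    · refine hm.trans ?_
      calc C * (X ^ (k + 1) / (hs.prod * F)) ≤ C * (X ^ (k + 1) / ((X ^ (1 / 2 : ℝ) / 2) ^ k * F)) := by gcongr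
        _ = C * 2 ^ k * (X ^ ((k : ℝ) / 2 + 1) / F) := by
            have e : X ^ (k + 1) = (X ^ (1 / 2 : ℝ)) ^ k * X ^ ((k : ℝ) / 2 + 1) := by
              rw [← Real.rpow_natCast, ← Real.rpow_natCast, ← Real.rpow_mul hX0.le, ← Real.rpow_add hX0]
              congr 1; push_cast; ring
            rw [e, div_pow]; field_simp
        _ ≤ C * 2 ^ k * X ^ (3 / 4 : ℝ) := by
            gcongr
            rwa [div_le_iff₀ hF0]
        _ ≤ max 1 (C * 2 ^ k) * X ^ (1 - ρ / 2 ^ 0) := by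
            gcongr
            · exact le_max_right _ _
            · rw [pow_zero, div_one]; linarith
    · calc B * (hs.prod * F) / X ^ (k + 1)
          ≤ B * ((X ^ (1 / 2 + ρ)) ^ k * X ^ ((k : ℝ) / 2 + 1 - (k + 1) * ρ)) / X ^ (k + 1) := by gcongr
        _ = B / X ^ ρ := by
            have e : (X ^ (1 / 2 + ρ)) ^ k * X ^ ((k : ℝ) / 2 + 1 - (k + 1) * ρ) * X ^ ρ = X ^ (k + 1) := by
              rw [← Real.rpow_natCast, ← Real.rpow_natCast, ← Real.rpow_mul hX0.le, ← Real.rpow_add hX0,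
                ← Real.rpow_add hX0]
              congr 1; push_cast; ring
            rw [← e]; field_simp
        _ ≤ 1 / 2 := by
            rw [div_le_div_iff₀ (by positivity) (by norm_num)]; linarith
  | succ i ih =>
    obtain ⟨D, X1, hD, hX1, h⟩ := ih
    refine ⟨3 * (4 + D), X1, by linarith, hX1, ?_⟩
    intro X γ hs a b hX hγ hlen hlo hhi hF1 hF2 hXa hbX
    have hXge : 1 ≤ X := hX1.trans hX
    have hX0 : 0 < X := by linarith
    rcases le_or_gt b a with hba | hab
    · rw [Ico_eq_empty_of_le hba, sum_empty, norm_zero]; positivity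
    set h0 := ⌊X ^ (1 / 2 : ℝ)⌋₊ with hh0
    set M := ⌊X ^ ρ⌋₊ with hM
    have hXρ : 1 ≤ X ^ ρ := Real.one_le_rpow hXge hρ.le
    have hM1 : 1 ≤ M := (Nat.one_le_floor_iff _).2 hXρ
    have hM2 : X ^ ρ / 2 ≤ M := half_le_natFloor hXρ
    have hM3 : (M : ℝ) ≤ X ^ ρ := Nat.floor_le (by positivity)
    have hh3 : (h0 : ℝ) ≤ X ^ (1 / 2 : ℝ) := Nat.floor_le (by positivity)
    have hhM : (h0 : ℝ) * M ≤ X ^ (1 / 2 + ρ) := by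
      rw [Real.rpow_add hX0]; gcongr
    have hhX : (h0 : ℝ) * M ≤ X := by
      refine hhM.trans ((Real.rpow_le_rpow_of_exponent_le hXge (show 1 / 2 + ρ ≤ 1 by linarith)).trans ?_)
      rw [Real.rpow_one]
    have hi : (0 : ℝ) < 2 ^ i := by positivity
    have hmain := norm_sum_sq_le_vanDerCorput (z := fun n => eexp (shiftDiff hs (powFam c γ 0) n))
      (fun n => (norm_eexp _).le) hab.le hM1 (h := h0) (by exact_mod_cast hhX.trans hXa)
      (T := D * X ^ (1 - ρ / 2 ^ i)) (by positivity) (fun d hd hdM => ?_)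
    · have hba : (b - a : ℝ) ≤ 2 * X := by linarith
      have hba0 : (0 : ℝ) ≤ b - a := by rw [sub_nonneg]; exact_mod_cast hab.le
      have hpow : X ^ (1 - ρ) ≤ X ^ (1 - ρ / 2 ^ i) := by
        apply Real.rpow_le_rpow_of_exponent_le hXge
        have : ρ / 2 ^ i ≤ ρ := div_le_self hρ.le (one_le_pow₀ (by norm_num))
        linarith
      have hXM : (b - a : ℝ) / M ≤ 4 * X ^ (1 - ρ / 2 ^ i) := by
        calc _ ≤ 2 * X / (X ^ ρ / 2) := by gcongr
          _ = 4 * X ^ (1 - ρ) := by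
            rw [Real.rpow_sub hX0, Real.rpow_one]; field_simp; norm_num
          _ ≤ _ := by gcongr
      have hsq : X * X ^ (1 - ρ / 2 ^ i) = (X ^ (1 - ρ / 2 ^ (i + 1))) ^ 2 := by
        rw [← Real.rpow_natCast (X ^ (1 - ρ / 2 ^ (i + 1))) 2, ← Real.rpow_mul hX0.le]
        nth_rw 1 [← Real.rpow_one X]
        rw [← Real.rpow_add hX0]
        congr 1
        rw [pow_succ]; field_simp; push_cast; ring
      refine (pow_le_pow_iff_left₀ (norm_nonneg _) (by positivity) two_ne_zero).1 ?_
      calc _ ≤ _ := hmain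
        _ ≤ (2 * X + X) * (4 * X ^ (1 - ρ / 2 ^ i) + D * X ^ (1 - ρ / 2 ^ i)) := by gcongr
        _ = 3 * (4 + D) * (X * X ^ (1 - ρ / 2 ^ i)) := by ring
        _ ≤ (3 * (4 + D)) ^ 2 * (X * X ^ (1 - ρ / 2 ^ i)) := by
            gcongr; nlinarith
        _ = _ := by rw [hsq]; ring
    · have hstep := h X γ (h0 * d :: hs) a (b - h0 * d) hX hγ (by rw [List.length_cons]; omega) ?_ ?_ hF1 hF2 hXa ?_
      · refine le_trans (le_of_eq ?_) hstep
        congr 1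
        refine Finset.sum_congr rfl fun n _ => ?_
        simp only [shiftDiff]
        rw [eexp_sub]; push_cast; rfl
      · intro x hx
        rcases List.mem_cons.1 hx with rfl | hx
        · exact Nat.le_mul_of_pos_right _ hd
        · exact hlo x hx
      · intro x hx
        rcases List.mem_cons.1 hx with rfl | hx
        · refine le_trans ?_ hhM
          exact_mod_cast Nat.mul_le_mul_left _ hdM.le
        · exact hhi x hx
      · refine le_trans ?_ hbX
        exact_mod_cast Nat.sub_le _ _

/-- Power saving for `∑ e(γ n ^ c)`. -/
theorem exists_expSum_bound {c : ℝ} (hcne : ∀ n : ℤ, c ≠ n) : ∃ σ C X₀ : ℝ, 0 < σ ∧ 1 ≤ C ∧ 1 ≤ X₀ ∧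
    ∀ (X γ : ℝ) (a b : ℕ), X₀ ≤ X → 0 < γ → γ * X ^ c ≤ X ^ (c + 1) → X ≤ a → (b : ℝ) ≤ 3 * X →
      ‖∑ n ∈ Ico a b, eexp (γ * (n : ℝ) ^ c)‖ ≤ C * (X / (γ * X ^ c) + X ^ (1 - σ)) := by
  obtain ⟨K, hK⟩ := exists_nat_ge (2 * c + 1)
  have hK0 : (0 : ℝ) ≤ K := by positivity
  set ρ : ℝ := 1 / (4 * (K + 1)) with hρd
  have hρ : 0 < ρ := by positivity
  have hρ4 : (K + 1) * ρ = 1 / 4 := by rw [hρd]; field_simp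
  have hρ4' : ρ ≤ 1 / 4 := by nlinarith
  choose D X1 hD hX1 h using fun k => norm_sum_shiftDiff_le_rpow hcne hρ hρ4' k k
  obtain ⟨B, C0, hB, hC0, h0⟩ := norm_sum_shiftDiff_le hcne 0
  obtain ⟨X2, hX2, hX2'⟩ := eventually_le_rpow hρ (2 * B)
  refine ⟨ρ / 2 ^ K, max C0 (∑ k ∈ range (K + 1), D k), max (max X2 2) (∑ k ∈ range (K + 1), X1 k), by positivity,
    ?_, (by norm_num : (1 : ℝ) ≤ 2).trans ((le_max_right _ _).trans (le_max_left _ _)), ?_⟩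
  · refine ((hD 0).trans ?_).trans (le_max_right _ _)
    exact single_le_sum (f := D) (fun i _ => zero_le_one.trans (hD i)) (by simp)
  intro X γ a b hX hγ hFc hXa hbX
  have hX2X := hX2' X (((le_max_left _ _).trans (le_max_left _ _)).trans hX)
  have hXge : 2 ≤ X := ((le_max_right _ _).trans (le_max_left _ _)).trans hX
  have hX0 : 0 < X := by linarith
  have hX1' : 1 ≤ X := by linarith
  set F := γ * X ^ c with hF
  have hF0 : 0 < F := by positivity
  set C := max C0 (∑ k ∈ range (K + 1), D k) with hC
  have hCC : C0 ≤ C := le_max_left _ _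
  have hCp : 0 < C := hC0.trans_le hCC
  have hfam : ∀ n : ℕ, γ * (n : ℝ) ^ c = shiftDiff [] (powFam c γ 0) n := fun n => by
    simp [shiftDiff, powFam]
  simp_rw [hfam]
  have hex : ∃ k : ℕ, F ≤ X ^ ((k : ℝ) / 2 + 1 - (k + 1) * ρ) := by
    refine ⟨K, hFc.trans (Real.rpow_le_rpow_of_exponent_le hX1' ?_)⟩
    rw [hρ4]; linarith
  classical
  have hle : Nat.find hex ≤ K := Nat.find_le (by
    refine hFc.trans (Real.rpow_le_rpow_of_exponent_le hX1' ?_)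
    rw [hρ4]; linarith)
  have hspec := Nat.find_spec hex
  have hmin := fun m hm => Nat.find_min hex (m := m) hm
  set k := Nat.find hex with hk
  rcases Nat.eq_zero_or_pos k with hk0 | hkpos
  · rw [hk0] at hspec
    norm_num at hspec
    refine (h0 γ X [] a b hγ hX1' rfl (by simpa using hXge) (by simp) hXa hbX ?_).trans ?_
    · simp only [List.prod_nil, Nat.cast_one, one_mul, zero_add, pow_one]
      rw [div_le_iff₀ hX0]
      calc B * F ≤ B * X ^ (1 - ρ) := by gcongr
        _ = B / X ^ ρ * X := by rw [Real.rpow_sub hX0, Real.rpow_one]; ring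
        _ ≤ 1 / 2 * X := by
          refine mul_le_mul_of_nonneg_right ?_ hX0.le
          rw [div_le_div_iff₀ (by positivity) (by norm_num)]; linarith
    · simp only [List.prod_nil, Nat.cast_one, one_mul, zero_add, pow_one]
      have : 0 ≤ X ^ (1 - ρ / 2 ^ K) := by positivity
      have : 0 ≤ X / F := by positivity
      gcongr
      linarith
  · have hm := hmin (k - 1) (by omega)
    rw [not_le, Nat.cast_sub hkpos] at hm
    have hkK : (k : ℝ) ≤ K := by exact_mod_cast hle
    have hlow : X ^ ((k : ℝ) / 2 + 1) ≤ X ^ (3 / 4 : ℝ) * F := by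
      refine le_trans ?_ (mul_le_mul_of_nonneg_left hm.le (by positivity))
      rw [← Real.rpow_add hX0]
      apply Real.rpow_le_rpow_of_exponent_le hX1'
      push_cast
      nlinarith
    have hXk : X1 k ≤ X := by
      refine le_trans ?_ ((le_max_right _ _).trans hX)
      exact single_le_sum (f := X1) (fun i _ => zero_le_one.trans (hX1 i)) (by simp; omega)
    refine (h k X γ [] a b hXk hγ (by simp) (by simp) (by simp) hspec hlow hXa hbX).trans ?_
    have hDk : D k ≤ C := by
      refine le_trans ?_ (le_max_right _ _)
      exact single_le_sum (f := D) (fun i _ => zero_le_one.trans (hD i)) (by simp; omega)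
    calc D k * X ^ (1 - ρ / 2 ^ k) ≤ C * X ^ (1 - ρ / 2 ^ K) := by
          gcongr
          · norm_num
      _ ≤ _ := by
          have : 0 ≤ X / F := by positivity
          gcongr
          linarith

end

section

open Finset ComplexConjugate

/-- The `n` with `Q < ⌊n ^ c⌋ ≤ 2 Q`. -/
noncomputable def powRange (c : ℝ) (Q : ℕ) : Finset ℕ :=
  Ico ⌈((Q : ℝ) + 1) ^ (1 / c)⌉₊ ⌈(2 * (Q : ℝ) + 1) ^ (1 / c)⌉₊

theorem mem_powRange {c : ℝ} (hc : 0 < c) {Q n : ℕ} : n ∈ powRange c Q ↔ ⌊(n : ℝ) ^ c⌋₊ ∈ Ioc Q (2 * Q) := by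
  have h1 : ∀ y : ℝ, 0 ≤ y → (⌈y ^ (1 / c)⌉₊ ≤ n ↔ y ≤ (n : ℝ) ^ c) := fun y hy => by
    rw [Nat.ceil_le, one_div, Real.rpow_inv_le_iff_of_pos hy (by positivity) hc]
  have h2 := h1 (2 * (Q : ℝ) + 1) (by positivity)
  rw [powRange, mem_Ico, mem_Ioc, h1 _ (by positivity), ← not_le, h2, ← Nat.lt_succ_iff, Nat.succ_eq_add_one,
    Nat.floor_lt (by positivity), Nat.lt_iff_add_one_le, Nat.le_floor_iff (by positivity), not_le]
  push_cast
  rfl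

theorem mul_rpow_le_rpow_sub {c : ℝ} (hc : 1 < c) {X x y : ℝ} (hX : 0 < X) (hx : X ≤ x) (hxy : x ≤ y) :
    (y - x) * X ^ (c - 1) ≤ y ^ c - x ^ c := by
  rcases hxy.eq_or_lt with rfl | hlt
  · simp
  have hx0 : 0 < x := hX.trans_le hx
  obtain ⟨ξ, hξ, he⟩ := exists_hasDerivAt_eq_slope (fun t : ℝ => t ^ c) (fun t => c * t ^ (c - 1)) hlt
    (ContinuousOn.rpow_const continuousOn_id fun t ht => Or.inr (by linarith))
    (fun t ht => Real.hasDerivAt_rpow_const (Or.inl (by linarith [ht.1])))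
  have hyx : 0 < y - x := by linarith
  rw [eq_div_iff hyx.ne'] at he
  rw [← he, mul_comm]
  refine mul_le_mul_of_nonneg_right ?_ hyx.le
  have hξ0 : 0 < ξ := by linarith [hξ.1]
  calc X ^ (c - 1) ≤ ξ ^ (c - 1) := Real.rpow_le_rpow hX.le (by linarith [hξ.1]) (by linarith)
    _ ≤ c * ξ ^ (c - 1) := by
      have : 0 ≤ ξ ^ (c - 1) := by positivity
      nlinarith

theorem injOn_floor_rpow {c : ℝ} (hc : 1 < c) : Set.InjOn (fun n : ℕ => ⌊(n : ℝ) ^ c⌋₊) {n | 1 ≤ n} := by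
  have key : ∀ m n : ℕ, 1 ≤ m → m < n → ⌊(m : ℝ) ^ c⌋₊ < ⌊(n : ℝ) ^ c⌋₊ := by
    intro m n hm hmn
    have h := mul_rpow_le_rpow_sub hc (X := 1) one_pos (x := m) (y := n) (by exact_mod_cast hm) (by exact_mod_cast hmn.le)
    rw [Real.one_rpow, mul_one] at h
    have h1 : (m : ℝ) + 1 ≤ n := by exact_mod_cast hmn
    rw [Nat.lt_iff_add_one_le, Nat.le_floor_iff (by positivity)]
    have := Nat.floor_le (show (0 : ℝ) ≤ (m : ℝ) ^ c by positivity)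
    push_cast
    linarith
  intro m hm n hn h
  rcases lt_trichotomy m n with h1 | h1 | h1
  · exact absurd h (key m n hm h1).ne
  · exact h1
  · exact absurd h (key n m hn h1).ne'

theorem one_le_of_mem_powRange {c : ℝ} (hc : 0 < c) {Q n : ℕ} (h : n ∈ powRange c Q) : 1 ≤ n := by
  by_contra hn
  have : n = 0 := by omega
  subst this
  rw [mem_powRange hc, Nat.cast_zero, Real.zero_rpow hc.ne'] at h
  simp at h

theorem SQ_eq_image {c : ℝ} (hc : 1 < c) (Q : ℕ) : SQ c Q = (powRange c Q).image fun n : ℕ => ⌊(n : ℝ) ^ c⌋₊ := by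
  ext q
  simp only [SQ, mem_filter, mem_image, mem_powRange (zero_lt_one.trans hc)]
  constructor
  · rintro ⟨h, n, rfl⟩
    exact ⟨n, h, rfl⟩
  · rintro ⟨n, h, rfl⟩
    exact ⟨h, n, rfl⟩

theorem card_SQ {c : ℝ} (hc : 1 < c) (Q : ℕ) : (SQ c Q).card = (powRange c Q).card := by
  rw [SQ_eq_image hc]
  exact card_image_of_injOn fun m hm n hn h =>
    injOn_floor_rpow hc (one_le_of_mem_powRange (by linarith) hm) (one_le_of_mem_powRange (by linarith) hn) h

theorem powRange_bounds {c : ℝ} (hc : 1 < c) {Q : ℕ} (hQ : 1 ≤ Q) (hX : 2 ≤ (Q : ℝ) ^ (1 / c)) :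
    (Q : ℝ) ^ (1 / c) ≤ ⌈((Q : ℝ) + 1) ^ (1 / c)⌉₊ ∧ (⌈(2 * (Q : ℝ) + 1) ^ (1 / c)⌉₊ : ℝ) ≤ 3 * (Q : ℝ) ^ (1 / c) ∧
    ((2 : ℝ) ^ (1 / c) - 1) * (Q : ℝ) ^ (1 / c) - 2 ≤ (powRange c Q).card ∧
    ((powRange c Q).card : ℝ) ≤ 2 * (Q : ℝ) ^ (1 / c) := by
  have hQ0 : (1 : ℝ) ≤ Q := by exact_mod_cast hQ
  have hQ1 : (0 : ℝ) < Q := by linarith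
  have hc0 : 0 ≤ 1 / c := by positivity
  have hc1 : 1 / c ≤ 1 := by rw [div_le_one (by linarith)]; exact hc.le
  set X := (Q : ℝ) ^ (1 / c) with hXd
  have hXQ : X ≤ Q := by
    calc X ≤ (Q : ℝ) ^ (1 : ℝ) := Real.rpow_le_rpow_of_exponent_le hQ0 hc1
      _ = Q := Real.rpow_one _
  have hXQ' : X / Q ≤ 1 := by rwa [div_le_one hQ1]
  have key : ∀ t : ℝ, 1 ≤ t → (t * Q + 1) ^ (1 / c) ≤ t * X + 1 := fun t ht => by
    have e : t * Q + 1 = (t + 1 / Q) * Q := by field_simp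
    have h1 : 1 ≤ t + 1 / Q := by
      have : (0 : ℝ) ≤ 1 / Q := by positivity
      linarith
    rw [e, Real.mul_rpow (by positivity) (by positivity)]
    calc (t + 1 / Q) ^ (1 / c) * X ≤ (t + 1 / Q) ^ (1 : ℝ) * X := by
          gcongr
      _ = t * X + X / Q := by rw [Real.rpow_one]; ring
      _ ≤ t * X + 1 := by linarith
  have k1 := key 1 le_rfl
  have k2 := key 2 (by norm_num)
  rw [one_mul] at k1
  have a1 : X ≤ ⌈((Q : ℝ) + 1) ^ (1 / c)⌉₊ := by
    refine le_trans ?_ (Nat.le_ceil _)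
    exact Real.rpow_le_rpow (by positivity) (by linarith) hc0
  have a2 : (⌈((Q : ℝ) + 1) ^ (1 / c)⌉₊ : ℝ) < ((Q : ℝ) + 1) ^ (1 / c) + 1 := Nat.ceil_lt_add_one (by positivity)
  have b1 : (2 : ℝ) ^ (1 / c) * X ≤ ⌈(2 * (Q : ℝ) + 1) ^ (1 / c)⌉₊ := by
    refine le_trans ?_ (Nat.le_ceil _)
    rw [← Real.mul_rpow (by norm_num) (by positivity)]
    exact Real.rpow_le_rpow (by positivity) (by linarith) hc0
  have b2 : (⌈(2 * (Q : ℝ) + 1) ^ (1 / c)⌉₊ : ℝ) < (2 * (Q : ℝ) + 1) ^ (1 / c) + 1 := Nat.ceil_lt_add_one (by positivity)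
  have hab : ⌈((Q : ℝ) + 1) ^ (1 / c)⌉₊ ≤ ⌈(2 * (Q : ℝ) + 1) ^ (1 / c)⌉₊ := by
    apply Nat.ceil_le_ceil
    exact Real.rpow_le_rpow (by positivity) (by linarith) hc0
  have hcard : ((powRange c Q).card : ℝ) = ⌈(2 * (Q : ℝ) + 1) ^ (1 / c)⌉₊ - ⌈((Q : ℝ) + 1) ^ (1 / c)⌉₊ := by
    rw [powRange, Nat.card_Ico, Nat.cast_sub hab]
  refine ⟨a1, by linarith, ?_, ?_⟩
  · rw [hcard]; linarith
  · rw [hcard]; linarith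

theorem card_le_of_sub_le {s : Finset ℕ} {D : ℝ} (hD : 0 ≤ D) (h : ∀ x ∈ s, ∀ y ∈ s, x ≤ y → (y : ℝ) - x ≤ D) :
    (s.card : ℝ) ≤ D + 1 := by
  rcases s.eq_empty_or_nonempty with rfl | hs
  · simp; linarith
  have h1 : s ⊆ Icc (s.min' hs) (s.max' hs) := fun x hx => mem_Icc.2 ⟨s.min'_le x hx, s.le_max' x hx⟩
  have h2 := card_le_card h1
  have h3 : s.min' hs ≤ s.max' hs := s.min'_le _ (s.max'_mem hs)
  rw [Nat.card_Icc] at h2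
  have h4 := h _ (s.min'_mem hs) _ (s.max'_mem hs) h3
  have h5 : (s.card : ℝ) + s.min' hs ≤ s.max' hs + 1 := by
    have : s.card + s.min' hs ≤ s.max' hs + 1 := by omega
    exact_mod_cast this
  linarith

open scoped Classical in
/-- Counting when some small combination `h₁ + h₂ α` is close to zero. -/
theorem card_filter_le_of_smallComb {c : ℝ} (hc : 1 < c) {Q J : ℕ} {X α η γ : ℝ} (h₁ h₂ : ℤ) (hQ : 1 ≤ Q)
    (hX : 1 ≤ X) (hXc : X ^ c = Q) (hγd : γ = h₁ + h₂ * α) (hh : |(h₂ : ℝ)| ≤ J) (hη : 0 ≤ η) (hJη : J * η ≤ 1 / 2)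
    (hγ : 1 / (2 * Q) ≤ γ) {s : Finset ℕ} (hs : ∀ n ∈ s, X ≤ n) (hsQ : ∀ n ∈ s, ⌊(n : ℝ) ^ c⌋₊ ≤ 2 * Q)
    (hsη : ∀ n ∈ s, ∃ m : ℤ, |(⌊(n : ℝ) ^ c⌋₊ : ℝ) * α - m| ≤ η) :
    (s.card : ℝ) ≤ 16 * J * η * X + 4 * (Q * γ) + 4 := by
  have hX0 : 0 < X := by linarith
  have hQ0 : (0 : ℝ) < Q := by exact_mod_cast hQ
  have hγ0 : 0 < γ := lt_of_lt_of_le (by positivity) hγ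
  have hm : ∀ n ∈ s, ∃ m : ℕ, |(⌊(n : ℝ) ^ c⌋₊ : ℝ) * γ - m| ≤ J * η := by
    intro n hn
    obtain ⟨m, hm⟩ := hsη n hn
    have h1 : |(⌊(n : ℝ) ^ c⌋₊ : ℝ) * γ - ((⌊(n : ℝ) ^ c⌋₊ * h₁ + h₂ * m : ℤ) : ℝ)| ≤ J * η := by
      have e : (⌊(n : ℝ) ^ c⌋₊ : ℝ) * γ - ((⌊(n : ℝ) ^ c⌋₊ * h₁ + h₂ * m : ℤ) : ℝ)
          = h₂ * ((⌊(n : ℝ) ^ c⌋₊ : ℝ) * α - m) := by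
        rw [hγd]; push_cast; ring
      rw [e, abs_mul]
      gcongr
    have h2 : (0 : ℤ) ≤ ⌊(n : ℝ) ^ c⌋₊ * h₁ + h₂ * m := by
      have h3 := (abs_le.1 h1).2
      have h4 : (0 : ℝ) ≤ (⌊(n : ℝ) ^ c⌋₊ : ℝ) * γ := by positivity
      have h5 : (-1 : ℝ) < ((⌊(n : ℝ) ^ c⌋₊ * h₁ + h₂ * m : ℤ) : ℝ) := by linarith
      have h6 : (-1 : ℤ) < ⌊(n : ℝ) ^ c⌋₊ * h₁ + h₂ * m := by exact_mod_cast h5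
      omega
    obtain ⟨k, hk⟩ := Int.eq_ofNat_of_zero_le h2
    refine ⟨k, ?_⟩
    rw [hk] at h1
    exact_mod_cast h1
  choose! m hm using hm
  set L := ⌊2 * Q * γ + 1⌋₊ with hL
  have hmaps : ∀ n ∈ s, m n ∈ range (L + 1) := fun n hn => by
    rw [mem_range, Nat.lt_succ_iff, hL, Nat.le_floor_iff (by positivity)]
    have h1 := (abs_le.1 (hm n hn)).1
    have h2 : (⌊(n : ℝ) ^ c⌋₊ : ℝ) ≤ 2 * Q := by exact_mod_cast hsQ n hn
    have h3 : (⌊(n : ℝ) ^ c⌋₊ : ℝ) * γ ≤ 2 * Q * γ := by gcongr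
    linarith
  have hXc1 : X ^ (c - 1) * X = Q := by
    rw [← hXc]
    nth_rw 2 [← Real.rpow_one X]
    rw [← Real.rpow_add hX0]; congr 1; ring
  have hP1 : 1 ≤ X ^ (c - 1) := Real.one_le_rpow hX (by linarith)
  set P := X ^ (c - 1) with hP
  have hfib : ∀ k ∈ range (L + 1), (((s.filter fun n => m n = k).card : ℝ)) ≤ (2 * J * η / γ + 1) / P + 1 := by
    intro k _
    refine card_le_of_sub_le (by positivity) fun x hx y hy hxy => ?_
    rw [mem_filter] at hx hy
    have h1 := abs_le.1 (hm x hx.1)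
    have h2 := abs_le.1 (hm y hy.1)
    rw [hx.2] at h1
    rw [hy.2] at h2
    have h3 := mul_rpow_le_rpow_sub hc hX0 (hs x hx.1) (y := y) (by exact_mod_cast hxy)
    have h4 : (y : ℝ) ^ c < ⌊(y : ℝ) ^ c⌋₊ + 1 := Nat.lt_floor_add_one _
    have h5 : (⌊(x : ℝ) ^ c⌋₊ : ℝ) ≤ (x : ℝ) ^ c := Nat.floor_le (by positivity)
    have h6 : (⌊(y : ℝ) ^ c⌋₊ : ℝ) - ⌊(x : ℝ) ^ c⌋₊ ≤ 2 * J * η / γ := by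
      rw [le_div_iff₀ hγ0]; linarith [h1.1, h2.2]
    rw [le_div_iff₀ (by positivity)]
    linarith
  have hcard := card_eq_sum_card_fiberwise (f := m) (t := range (L + 1)) (s := s) hmaps
  have hL1 : ((L + 1 : ℕ) : ℝ) ≤ 2 * Q * γ + 2 := by
    push_cast
    linarith [Nat.floor_le (show 0 ≤ 2 * Q * γ + 1 by positivity)]
  calc (s.card : ℝ) = ∑ k ∈ range (L + 1), ((s.filter fun n => m n = k).card : ℝ) := by
        rw [hcard]; push_cast; rfl
    _ ≤ ∑ k ∈ range (L + 1), ((2 * J * η / γ + 1) / P + 1) := sum_le_sum hfib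
    _ = ((L + 1 : ℕ) : ℝ) * ((2 * J * η / γ + 1) / P + 1) := by rw [sum_const, card_range, nsmul_eq_mul]
    _ ≤ (2 * Q * γ + 2) * ((2 * J * η / γ + 1) / P + 1) := by gcongr
    _ = (4 * J * η * Q / P + 4 * J * η * (1 / γ) / P) + (2 * Q * γ + 2) * (1 / P + 1) := by
        field_simp
        ring
    _ ≤ (4 * J * η * Q / P + 4 * J * η * (2 * Q) / P) + (2 * Q * γ + 2) * (1 + 1) := by
        have h1 : 1 / γ ≤ 2 * Q := by
          rw [div_le_iff₀ (by positivity)] at hγ ⊢; linarith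
        have h2 : 1 / P ≤ 1 := by rwa [div_le_one (by positivity)]
        gcongr
    _ = 12 * J * η * X + 4 * (Q * γ) + 4 := by
        rw [← hXc1]; field_simp; ring
    _ ≤ _ := by
        have : 0 ≤ J * η * X := by positivity
        linarith

end

section

open Finset ComplexConjugate

theorem norm_sum_eexp_of_real_eq (s : Finset ℕ) (f : ℕ → ℝ) :
    ‖∑ n ∈ s, eexp (-f n)‖ = ‖∑ n ∈ s, eexp (f n)‖ := by
  rw [← RCLike.norm_conj (∑ n ∈ s, eexp (f n)), map_sum]
  simp_rw [conj_eexp]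

/-- The two-dimensional Fejér-type sum is large at points near the lattice. -/
theorem le_norm_sum_sum_eexp {J : ℕ} (hJ : 1 ≤ J) {u v : ℝ} (hu : ∃ m : ℤ, |u - m| ≤ 1 / (32 * J))
    (hv : ∃ m : ℤ, |v - m| ≤ 1 / (32 * J)) :
    (J : ℝ) ^ 4 / 4 ≤ ‖∑ h ∈ range J ×ˢ range J, eexp (h.1 * u + h.2 * v)‖ ^ 2 := by
  obtain ⟨m, hm⟩ := hu
  obtain ⟨k, hk⟩ := hv
  have hJ0 : (0 : ℝ) < J := by exact_mod_cast hJ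
  have hterm : ∀ h ∈ range J ×ˢ range J, ‖eexp (h.1 * u + h.2 * v) - 1‖ ≤ 1 / 2 := by
    intro h hh
    rw [mem_product, mem_range, mem_range] at hh
    have e : eexp (h.1 * u + h.2 * v) = eexp (h.1 * (u - m) + h.2 * (v - k)) := by
      have e1 : h.1 * u + h.2 * v = (h.1 * (u - m) + h.2 * (v - k)) + ((h.1 * m + h.2 * k : ℤ) : ℝ) := by
        push_cast; ring
      rw [e1, eexp_add, eexp_intCast, mul_one]
    rw [e]
    refine (norm_eexp_sub_one_le _).trans ?_
    have h1 : (h.1 : ℝ) ≤ J := by exact_mod_cast hh.1.le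
    have h2 : (h.2 : ℝ) ≤ J := by exact_mod_cast hh.2.le
    have h3 : |(h.1 : ℝ) * (u - m) + h.2 * (v - k)| ≤ J * (1 / (32 * J)) + J * (1 / (32 * J)) := by
      refine (abs_add_le _ _).trans ?_
      rw [abs_mul, abs_mul, Nat.abs_cast, Nat.abs_cast]
      gcongr
    have h4 : (J : ℝ) * (1 / (32 * J)) + J * (1 / (32 * J)) = 1 / 16 := by field_simp; norm_num
    rw [h4] at h3
    have := Real.pi_lt_four
    have := Real.pi_pos
    nlinarith
  have h1 : ‖∑ h ∈ range J ×ˢ range J, (eexp (h.1 * u + h.2 * v) - 1)‖ ≤ (J : ℝ) ^ 2 * (1 / 2) := by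
    refine (norm_sum_le_of_le _ hterm).trans (le_of_eq ?_)
    rw [sum_const, card_product, card_range, nsmul_eq_mul]; push_cast; ring
  rw [sum_sub_distrib, sum_const, card_product, card_range] at h1
  have h2 : (J : ℝ) ^ 2 / 2 ≤ ‖∑ h ∈ range J ×ˢ range J, eexp (h.1 * u + h.2 * v)‖ := by
    have h3 := norm_sub_norm_le ((J * J) • (1 : ℂ)) (∑ h ∈ range J ×ˢ range J, eexp (h.1 * u + h.2 * v))
    rw [norm_sub_rev] at h3
    have h4 : ‖(J * J) • (1 : ℂ)‖ = (J : ℝ) ^ 2 := by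
      rw [nsmul_eq_mul, mul_one, Complex.norm_natCast]; push_cast; ring
    rw [h4] at h3
    linarith
  calc (J : ℝ) ^ 4 / 4 = ((J : ℝ) ^ 2 / 2) ^ 2 := by ring
    _ ≤ _ := by gcongr

/-- Mean square of the Fejér-type sum in terms of exponential sums. -/
theorem sum_norm_sum_sum_eexp_sq_le {J : ℕ} (I : Finset ℕ) (u v : ℕ → ℝ) {T : ℝ} (hT : 0 ≤ T)
    (h : ∀ h₁ h₂ : ℤ, |h₁| ≤ J → |h₂| ≤ J → (h₁ ≠ 0 ∨ h₂ ≠ 0) → ‖∑ n ∈ I, eexp (h₁ * u n + h₂ * v n)‖ ≤ T) :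
    ∑ n ∈ I, ‖∑ h ∈ range J ×ˢ range J, eexp (h.1 * u n + h.2 * v n)‖ ^ 2 ≤ (J : ℝ) ^ 2 * I.card + (J : ℝ) ^ 4 * T := by
  set S := range J ×ˢ range J with hS
  have hSc : (S.card : ℝ) = (J : ℝ) ^ 2 := by rw [hS, card_product, card_range]; push_cast; ring
  have e : ((∑ n ∈ I, ‖∑ h ∈ S, eexp (h.1 * u n + h.2 * v n)‖ ^ 2 : ℝ) : ℂ)
      = ∑ x ∈ S, ∑ y ∈ S, ∑ n ∈ I, eexp (((x.1 : ℤ) - y.1 : ℤ) * u n + ((x.2 : ℤ) - y.2 : ℤ) * v n) := by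
    rw [Complex.ofReal_sum]
    simp_rw [ofReal_norm_sum_sq]
    rw [sum_comm]
    refine sum_congr rfl fun x _ => ?_
    rw [sum_comm]
    refine sum_congr rfl fun y _ => sum_congr rfl fun n _ => ?_
    rw [← eexp_sub]
    congr 1; push_cast; ring
  have hnn : 0 ≤ ∑ n ∈ I, ‖∑ h ∈ S, eexp (h.1 * u n + h.2 * v n)‖ ^ 2 := sum_nonneg fun _ _ => by positivity
  rw [← Real.norm_of_nonneg hnn, ← Complex.norm_real, e]
  have hb : ∀ x ∈ S, ∀ y ∈ S, ‖∑ n ∈ I, eexp (((x.1 : ℤ) - y.1 : ℤ) * u n + ((x.2 : ℤ) - y.2 : ℤ) * v n)‖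
      ≤ T + if x = y then (I.card : ℝ) else 0 := by
    intro x hx y hy
    by_cases hxy : x = y
    · rw [if_pos hxy]
      refine (norm_sum_le_of_le _ fun n _ => (norm_eexp _).le).trans ?_
      rw [sum_const, nsmul_eq_mul, mul_one]; linarith
    · rw [if_neg hxy, add_zero]
      rw [hS, mem_product, mem_range, mem_range] at hx hy
      refine h _ _ ?_ ?_ ?_
      · rw [abs_le]; omega
      · rw [abs_le]; omega
      · by_contra! hcon
        exact hxy (Prod.ext (by omega) (by omega))
  refine (norm_sum_le_of_le _ fun x hx => norm_sum_le_of_le _ (hb x hx)).trans (le_of_eq ?_)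
  simp_rw [sum_add_distrib, sum_ite_eq]
  rw [sum_congr rfl (g := fun x => (I.card : ℝ)) (s₁ := S) (f := fun x => if x ∈ S then (I.card : ℝ) else 0)
    (fun x hx => if_pos hx) (s₂ := S)]
  simp only [sum_const, nsmul_eq_mul, hSc]
  ring

/-- Counting `n` with `⌊g n⌋ α` near an integer, given bounds for exponential sums. -/
theorem card_le_of_expSum_bound {J : ℕ} (hJ : 64 ≤ J) (I s : Finset ℕ) (hsI : s ⊆ I) (g : ℕ → ℝ) {α η T : ℝ}
    (hg : ∀ n ∈ s, 0 ≤ g n) (hα0 : 0 ≤ α) (hα1 : α ≤ 1)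
    (hη : η ≤ 1 / (64 * J)) (hT : 0 ≤ T) (hs : ∀ n ∈ s, ∃ m : ℤ, |(⌊g n⌋₊ : ℝ) * α - m| ≤ η)
    (h : ∀ h₁ h₂ : ℤ, |h₁| ≤ J → |h₂| ≤ J → (h₁ ≠ 0 ∨ h₂ ≠ 0) → ‖∑ n ∈ I, eexp ((h₁ + h₂ * α) * g n)‖ ≤ T) :
    (s.card : ℝ) ≤ 256 * (I.card / J + J * T) := by
  have hJ0 : (0 : ℝ) < J := by exact_mod_cast (show 0 < J by omega)
  set M := 64 * J with hM
  have hM0 : (0 : ℝ) < M := by exact_mod_cast (show 0 < M by omega)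
  have hMJ : (M : ℝ) = 64 * J := by rw [hM]; push_cast; rfl
  set W : ℕ → ℕ → ℝ := fun j n =>
    ‖∑ h ∈ range J ×ˢ range J, eexp (h.1 * (g n - j / M) + h.2 * (α * (g n - j / M)))‖ ^ 2 with hW
  have hpt : ∀ n ∈ s, (J : ℝ) ^ 4 / 4 ≤ ∑ j ∈ range M, W j n := by
    intro n hn
    set q := ⌊g n⌋₊ with hq
    have hq1 : (q : ℝ) ≤ g n := Nat.floor_le (hg n hn)
    have hq2 : g n < q + 1 := Nat.lt_floor_add_one _
    set j := ⌊M * (g n - q)⌋₊ with hj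
    have hj1 : (j : ℝ) ≤ M * (g n - q) := Nat.floor_le (by apply mul_nonneg hM0.le; linarith)
    have hj2 : M * (g n - q) < j + 1 := Nat.lt_floor_add_one _
    have hjM : j < M := by
      have : (j : ℝ) < M := by nlinarith
      exact_mod_cast this
    have hd1 : 0 ≤ g n - q - j / M := by
      rw [sub_nonneg, div_le_iff₀ hM0]; linarith
    have hd2 : g n - q - j / M ≤ 1 / M := by
      rw [sub_le_iff_le_add, ← add_div, le_div_iff₀ hM0]; linarith
    have hM64 : (1 : ℝ) / M = 1 / (64 * J) := by rw [hMJ]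
    have h32 : (1 : ℝ) / (32 * J) = 1 / (64 * J) + 1 / (64 * J) := by field_simp; norm_num
    have hJp : (0 : ℝ) ≤ 1 / (64 * J) := by positivity
    refine (le_norm_sum_sum_eexp (J := J) (by omega) (u := g n - j / M) (v := α * (g n - j / M)) ?_ ?_).trans
      (single_le_sum (f := fun j => W j n) (fun i _ => by positivity) (mem_range.2 hjM))
    · refine ⟨q, ?_⟩
      rw [abs_le]; push_cast
      constructor <;> linarith
    · obtain ⟨m, hm⟩ := hs n hn
      refine ⟨m, ?_⟩
      have e : α * (g n - j / M) - m = (q * α - m) + α * (g n - q - j / M) := by ring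
      rw [e]
      refine (abs_add_le _ _).trans ?_
      have h1 : |α * (g n - q - j / M)| ≤ 1 / M := by
        rw [abs_of_nonneg (by positivity)]
        nlinarith
      linarith
  have hmean : ∀ j ∈ range M, ∑ n ∈ I, W j n ≤ (J : ℝ) ^ 2 * I.card + (J : ℝ) ^ 4 * T := by
    intro j _
    refine sum_norm_sum_sum_eexp_sq_le I (fun n => g n - j / M) (fun n => α * (g n - j / M)) hT fun h₁ h₂ a b hne => ?_
    refine le_trans (le_of_eq ?_) (h h₁ h₂ a b hne)
    have e : ∀ n, eexp (h₁ * (g n - j / M) + h₂ * (α * (g n - j / M)))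
        = eexp (-((h₁ + h₂ * α) * (j / M))) * eexp ((h₁ + h₂ * α) * g n) := fun n => by
      rw [← eexp_add]; congr 1; ring
    simp_rw [e]
    rw [← mul_sum, norm_mul, norm_eexp, one_mul]
  have hfin : (s.card : ℝ) * ((J : ℝ) ^ 4 / 4) ≤ M * ((J : ℝ) ^ 2 * I.card + (J : ℝ) ^ 4 * T) := by
    calc (s.card : ℝ) * ((J : ℝ) ^ 4 / 4) = ∑ n ∈ s, (J : ℝ) ^ 4 / 4 := by rw [sum_const, nsmul_eq_mul]
      _ ≤ ∑ n ∈ s, ∑ j ∈ range M, W j n := sum_le_sum hpt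
      _ ≤ ∑ n ∈ I, ∑ j ∈ range M, W j n :=
          sum_le_sum_of_subset_of_nonneg hsI fun n _ _ => sum_nonneg fun j _ => by positivity
      _ = ∑ j ∈ range M, ∑ n ∈ I, W j n := sum_comm
      _ ≤ ∑ j ∈ range M, ((J : ℝ) ^ 2 * I.card + (J : ℝ) ^ 4 * T) := sum_le_sum hmean
      _ = _ := by rw [sum_const, card_range, nsmul_eq_mul]
  rw [hMJ] at hfin
  have h1 : (s.card : ℝ) ≤ (64 * J) * ((J : ℝ) ^ 2 * I.card + (J : ℝ) ^ 4 * T) / ((J : ℝ) ^ 4 / 4) := by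
    rwa [le_div_iff₀ (by positivity)]
  refine h1.trans (le_of_eq ?_)
  field_simp
  ring

end

section

open Finset ComplexConjugate

theorem le_abs_smallComb {a r J : ℕ} (hr : J < r) (har : a.Coprime r) {h₁ h₂ : ℤ} (hh2 : |h₂| ≤ J)
    (hne : h₁ ≠ 0 ∨ h₂ ≠ 0) : 1 / (r : ℝ) ≤ |(h₁ : ℝ) + h₂ * (a / r)| := by
  have hr0 : (0 : ℝ) < r := by exact_mod_cast (show 0 < r by omega)
  have hz : h₁ * r + h₂ * a ≠ 0 := by
    intro h0
    have hd : (r : ℤ) ∣ h₂ * a := ⟨-h₁, by linarith⟩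
    have hd2 : (r : ℤ) ∣ h₂ := IsCoprime.dvd_of_dvd_mul_right (Nat.isCoprime_iff_coprime.2 har.symm) hd
    have h2 : h₂ = 0 := by
      apply Int.eq_zero_of_abs_lt_dvd hd2
      have : (J : ℤ) < r := by exact_mod_cast hr
      omega
    subst h2
    have h3 : h₁ * (r : ℤ) = 0 := by linarith
    rcases mul_eq_zero.1 h3 with h | h
    · rcases hne with h' | h' <;> simp_all
    · omega
  have e : (h₁ : ℝ) + h₂ * (a / r) = ((h₁ * r + h₂ * a : ℤ) : ℝ) / r := by
    push_cast; field_simp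
  rw [e, abs_div, abs_of_pos hr0]
  gcongr
  exact_mod_cast Int.one_le_abs hz

set_option maxHeartbeats 1000000 in
open scoped Classical in
/-- Counting `q ∈ S_Q` with `q a / r` close to an integer. -/
theorem exists_count_bound {c : ℝ} (hc : 1 < c) (hcne : ∀ n : ℤ, c ≠ n) : ∃ C : ℝ, ∃ J₀ E : ℕ, 0 < C ∧
    ∀ (J Q a r : ℕ) (η : ℝ), J₀ ≤ J → J ^ E ≤ Q → a ≤ r → a.Coprime r → J < r → r ≤ 2 * Q → 0 ≤ η →
      η ≤ 1 / (J : ℝ) ^ 2 →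
      (((SQ c Q).filter fun q : ℕ => ∃ m : ℤ, |(q : ℝ) * (a / r) - m| ≤ η).card : ℝ) ≤ C * (SQ c Q).card / J := by
  obtain ⟨σ, C, X₀, hσ, hC, hX₀, hexp⟩ := exists_expSum_bound hcne
  have hc0 : 0 < c := by linarith
  set κ : ℝ := (2 : ℝ) ^ (1 / c) - 1 with hκ
  have hκ0 : 0 < κ := by
    have : (1 : ℝ) < (2 : ℝ) ^ (1 / c) := Real.one_lt_rpow (by norm_num) (by positivity)
    linarith
  obtain ⟨J₁, hJ₁⟩ := exists_nat_ge (max X₀ (4 / κ))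
  obtain ⟨E, hE⟩ := exists_nat_ge (max (5 * c) (3 * c / σ))
  refine ⟨512 * (1 + C) * (2 / κ), max 64 J₁, E, by positivity, ?_⟩
  intro J Q a r η hJ hQ har hcop hr hrQ hη0 hη
  have hJ64 : 64 ≤ J := (le_max_left _ _).trans hJ
  have hJ64' : (64 : ℝ) ≤ J := by exact_mod_cast hJ64
  have hJ0 : (0 : ℝ) < J := by linarith
  have hJ1 : (1 : ℝ) ≤ J := by linarith
  have hJJ₁ : (J₁ : ℝ) ≤ J := by exact_mod_cast (le_max_right _ _).trans hJ
  have hQ1 : 1 ≤ Q := (Nat.one_le_pow _ _ (by omega)).trans hQ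
  have hQ0 : (0 : ℝ) < Q := by exact_mod_cast hQ1
  set X := (Q : ℝ) ^ (1 / c) with hX
  have hX0 : 0 < X := by positivity
  have hXc : X ^ c = Q := by rw [hX, ← Real.rpow_mul hQ0.le, one_div_mul_cancel hc0.ne', Real.rpow_one]
  have hXJ : (J : ℝ) ^ ((E : ℝ) / c) ≤ X := by
    have h1 : ((J : ℝ) ^ E) ≤ Q := by exact_mod_cast hQ
    rw [hX]
    calc (J : ℝ) ^ ((E : ℝ) / c) = ((J : ℝ) ^ E) ^ (1 / c) := by
          rw [← Real.rpow_natCast, ← Real.rpow_mul hJ0.le]; congr 1; ring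
      _ ≤ _ := by gcongr
  have hXJ5 : (J : ℝ) ^ 5 ≤ X := by
    refine le_trans ?_ hXJ
    rw [← Real.rpow_natCast]
    apply Real.rpow_le_rpow_of_exponent_le hJ1
    rw [le_div_iff₀ hc0]; push_cast
    exact (le_max_left _ _).trans hE
  have hXσ : (J : ℝ) ^ 3 ≤ X ^ σ := by
    calc (J : ℝ) ^ 3 = ((J : ℝ) ^ (3 / σ)) ^ σ := by
          rw [← Real.rpow_mul hJ0.le, div_mul_cancel₀ _ hσ.ne', ← Real.rpow_natCast]; norm_num
      _ ≤ X ^ σ := by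
        gcongr
        refine le_trans ?_ hXJ
        apply Real.rpow_le_rpow_of_exponent_le hJ1
        rw [le_div_iff₀ hc0]
        refine le_trans (le_of_eq ?_) ((le_max_right _ _).trans hE)
        ring
  have hJX : (J : ℝ) ≤ X := (le_self_pow₀ hJ1 (by norm_num)).trans hXJ5
  have hX64 : 64 ≤ X := hJ64'.trans hJX
  obtain ⟨hb1, hb2, hb3, hb4⟩ := powRange_bounds hc hQ1 (by rw [← hX]; linarith)
  rw [← hX] at hb1 hb2 hb3 hb4
  have hXX₀ : X₀ ≤ X := (le_max_left _ _).trans (hJ₁.trans (hJJ₁.trans hJX))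
  have hXκ : 4 / κ ≤ X := (le_max_right _ _).trans (hJ₁.trans (hJJ₁.trans hJX))
  have hcardX : X ≤ 2 / κ * (SQ c Q).card := by
    rw [card_SQ hc, div_mul_eq_mul_div, le_div_iff₀ hκ0]
    rw [div_le_iff₀ hκ0] at hXκ
    rw [← hκ] at hb3
    linarith
  set α : ℝ := (a : ℝ) / r with hα
  have hr0 : (0 : ℝ) < r := by exact_mod_cast (show 0 < r by omega)
  have hα0 : 0 ≤ α := by positivity
  have hα1 : α ≤ 1 := by rw [hα, div_le_one hr0]; exact_mod_cast har
  set s := (powRange c Q).filter fun n : ℕ => ∃ m : ℤ, |(⌊(n : ℝ) ^ c⌋₊ : ℝ) * α - m| ≤ η with hs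
  have hsc : ((SQ c Q).filter fun q : ℕ => ∃ m : ℤ, |(q : ℝ) * α - m| ≤ η).card ≤ s.card := by
    rw [SQ_eq_image hc, filter_image, hs]
    exact card_image_le
  have hsη : ∀ n ∈ s, ∃ m : ℤ, |(⌊(n : ℝ) ^ c⌋₊ : ℝ) * α - m| ≤ η := fun n hn => (mem_filter.1 hn).2
  have hsub : s ⊆ powRange c Q := filter_subset _ _
  have hsX : ∀ n ∈ s, X ≤ n := fun n hn => by
    have h1 := hsub hn
    rw [powRange, mem_Ico] at h1
    exact hb1.trans (by exact_mod_cast h1.1)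
  have hsQ : ∀ n ∈ s, ⌊(n : ℝ) ^ c⌋₊ ≤ 2 * Q := fun n hn => (mem_Ioc.1 ((mem_powRange hc0).1 (hsub hn))).2
  suffices hmain : (s.card : ℝ) ≤ 512 * (1 + C) * X / J by
    calc _ ≤ (s.card : ℝ) := by exact_mod_cast hsc
      _ ≤ 512 * (1 + C) * X / J := hmain
      _ ≤ 512 * (1 + C) * (2 / κ * (SQ c Q).card) / J := by gcongr
      _ = _ := by ring
  have hr2 : 1 / (2 * (Q : ℝ)) ≤ 1 / r := by
    apply one_div_le_one_div_of_le hr0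
    exact_mod_cast hrQ
  have hJη : J * η ≤ 1 / J := by
    calc J * η ≤ J * (1 / (J : ℝ) ^ 2) := by gcongr
      _ = 1 / J := by field_simp
  by_cases hcase : ∃ h₁ h₂ : ℤ, |h₁| ≤ J ∧ |h₂| ≤ J ∧ (h₁ ≠ 0 ∨ h₂ ≠ 0) ∧ |(h₁ : ℝ) + h₂ * α| < (J : ℝ) ^ 3 / Q
  · have hcase' : ∃ h₁ h₂ : ℤ, |h₂| ≤ J ∧ 1 / (2 * Q) ≤ (h₁ : ℝ) + h₂ * α ∧ (h₁ : ℝ) + h₂ * α < (J : ℝ) ^ 3 / Q := by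
      obtain ⟨h₁, h₂, _, hh2, hne, hlt⟩ := hcase
      have hge := hr2.trans (le_abs_smallComb hr hcop hh2 hne)
      rcases le_total 0 ((h₁ : ℝ) + h₂ * α) with hp | hp
      · rw [← hα, abs_of_nonneg hp] at hge
        rw [abs_of_nonneg hp] at hlt
        exact ⟨h₁, h₂, hh2, hge, hlt⟩
      · rw [← hα, abs_of_nonpos hp] at hge
        rw [abs_of_nonpos hp] at hlt
        refine ⟨-h₁, -h₂, by rwa [abs_neg], ?_, ?_⟩
        · push_cast; linarith
        · push_cast; linarith
    obtain ⟨h₁, h₂, hh2, hge, hlt⟩ := hcase'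
    have hJhalf : (1 : ℝ) / J ≤ 1 / 2 := one_div_le_one_div_of_le (by norm_num) (by linarith)
    have hA := card_filter_le_of_smallComb hc h₁ h₂ hQ1 (by linarith) hXc rfl (by exact_mod_cast hh2) hη0
      (hJη.trans hJhalf) hge hsX hsQ hsη
    rw [lt_div_iff₀ hQ0] at hlt
    have hJ3 : 4 * (J : ℝ) ^ 3 + 4 ≤ X / J := by
      rw [le_div_iff₀ hJ0]
      have h1 : (1 : ℝ) ≤ J ^ 3 := one_le_pow₀ hJ1
      have h2 : (4 * (J : ℝ) ^ 3 + 4) * J ≤ (J ^ 3 * 64) * J := by gcongr; linarith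
      have h3 : (J : ℝ) ^ 3 * 64 * J ≤ J ^ 3 * J * J := by gcongr
      calc _ ≤ _ := h2
        _ ≤ _ := h3
        _ = (J : ℝ) ^ 5 := by ring
        _ ≤ X := hXJ5
    calc (s.card : ℝ) ≤ 16 * (J * η) * X + (4 * (J : ℝ) ^ 3 + 4) := by linarith
      _ ≤ 16 * (1 / J) * X + X / J := by gcongr
      _ = 17 * X / J := by ring
      _ ≤ 512 * (1 + C) * X / J := by gcongr; linarith
  · push Not at hcase
    have hη64 : η ≤ 1 / (64 * J) := by
      refine hη.trans (one_div_le_one_div_of_le (by positivity) ?_)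
      rw [sq]; gcongr
    have hTbd : ∀ γ : ℝ, (J : ℝ) ^ 3 / Q ≤ γ → γ ≤ 2 * J →
        ‖∑ n ∈ powRange c Q, eexp (γ * (n : ℝ) ^ c)‖ ≤ C * (2 * X / J ^ 3) := by
      intro γ hγ1 hγ2
      have hγ0 : 0 < γ := lt_of_lt_of_le (by positivity) hγ1
      refine (hexp X γ _ _ hXX₀ hγ0 ?_ hb1 hb2).trans ?_
      · rw [Real.rpow_add hX0, Real.rpow_one, mul_comm (X ^ c)]
        gcongr
        refine hγ2.trans (le_trans ?_ hXJ5)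
        calc (2 : ℝ) * J ≤ J * J := by gcongr; linarith
          _ = J ^ 2 := by ring
          _ ≤ J ^ 5 := pow_le_pow_right₀ hJ1 (by norm_num)
      · gcongr
        have h1 : X / (γ * X ^ c) ≤ X / J ^ 3 := by
          rw [hXc]
          rw [div_le_iff₀ hQ0] at hγ1
          gcongr
        have h2 : X ^ (1 - σ) ≤ X / J ^ 3 := by
          rw [Real.rpow_sub hX0, Real.rpow_one]
          gcongr
        calc _ ≤ X / J ^ 3 + X / J ^ 3 := add_le_add h1 h2
          _ = _ := by ring
    have hB := card_le_of_expSum_bound hJ64 (powRange c Q) s hsub (fun n => (n : ℝ) ^ c) (α := α) (η := η)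
      (T := C * (2 * X / J ^ 3)) (fun n _ => by positivity) hα0 hα1 hη64 (by positivity) hsη ?_
    · refine hB.trans ?_
      have h1 : (J : ℝ) * (C * (2 * X / J ^ 3)) ≤ 2 * C * X / J := by
        rw [show (J : ℝ) * (C * (2 * X / J ^ 3)) = 2 * C * X / J ^ 2 by field_simp]
        gcongr
        exact le_self_pow₀ hJ1 (by norm_num)
      calc 256 * ((powRange c Q).card / J + J * (C * (2 * X / J ^ 3)))
          ≤ 256 * (2 * X / J + 2 * C * X / J) := by gcongr
        _ = _ := by ring
    · intro h₁ h₂ hh1 hh2 hne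
      have hlow := hcase h₁ h₂ hh1 hh2 hne
      have hup : |(h₁ : ℝ) + h₂ * α| ≤ 2 * J := by
        have e1 : |(h₁ : ℝ)| ≤ J := by exact_mod_cast hh1
        have e2 : |(h₂ : ℝ)| ≤ J := by exact_mod_cast hh2
        refine (abs_add_le _ _).trans ?_
        rw [abs_mul, abs_of_nonneg hα0]
        nlinarith
      rcases le_total 0 ((h₁ : ℝ) + h₂ * α) with hp | hp
      · rw [abs_of_nonneg hp] at hlow hup
        exact hTbd _ hlow hup
      · rw [abs_of_nonpos hp] at hlow hup
        rw [← norm_sum_eexp_of_real_eq]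
        simp_rw [← neg_mul]
        exact hTbd _ hlow hup

end

section

open Finset ComplexConjugate

/-- `∑_{p ≤ x} log p e(p α)`. -/
noncomputable def thetaHat (x α : ℝ) : ℂ := ∑ p ∈ primesLe x, (Real.log p : ℂ) * eexp (p * α)

/-- Ramanujan's sum. -/
noncomputable def ramSum (q a : ℕ) : ℂ := ∑ b ∈ (range q).filter (fun b => q.Coprime b), eexp (b * ((a : ℝ) / q))

/-- The exponential sum over primes minus its expected main term at `a / q`. -/
noncomputable def primeErr (x : ℝ) (q a : ℕ) : ℂ :=
  thetaHat x ((a : ℝ) / q) - ((x / Nat.totient q : ℝ) : ℂ) * ramSum q a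

theorem eexp_eq_one_iff {x : ℝ} : eexp x = 1 ↔ ∃ k : ℤ, x = k := by
  constructor
  · intro h
    have h1 := le_norm_eexp_sub_one (x := x - round x) (by simpa using abs_sub_round x)
    have h2 : eexp (x - round x) = 1 := by
      rw [eexp_sub, eexp_intCast, h]; simp
    rw [h2, sub_self, norm_zero] at h1
    have h3 : x - round x = 0 := by
      rw [← abs_eq_zero]; linarith [abs_nonneg (x - round x)]
    exact ⟨round x, by linarith⟩
  · rintro ⟨k, rfl⟩
    exact eexp_intCast k

theorem eexp_natCast_mul (n : ℕ) (x : ℝ) : eexp (n * x) = eexp x ^ n := by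
  induction n with
  | zero => simp [eexp_zero]
  | succ n ih => rw [pow_succ, ← ih, ← eexp_add]; congr 1; push_cast; ring

theorem sum_range_eexp {q : ℕ} (hq : 0 < q) (k : ℤ) :
    ∑ a ∈ range q, eexp (a * ((k : ℝ) / q)) = if (q : ℤ) ∣ k then (q : ℂ) else 0 := by
  have hq0 : (q : ℝ) ≠ 0 := by exact_mod_cast hq.ne'
  split_ifs with h
  · obtain ⟨m, rfl⟩ := h
    rw [sum_congr rfl (g := fun _ => (1 : ℂ)) fun a _ => ?_]
    · simp
    · rw [eexp_eq_one_iff]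
      exact ⟨a * m, by push_cast; field_simp⟩
  · have hne : eexp ((k : ℝ) / q) ≠ 1 := by
      rw [Ne, eexp_eq_one_iff]
      rintro ⟨m, hm⟩
      rw [div_eq_iff hq0] at hm
      exact h ⟨m, by rw [mul_comm]; exact_mod_cast hm⟩
    simp_rw [eexp_natCast_mul]
    rw [geom_sum_eq hne, ← eexp_natCast_mul]
    have : (q : ℝ) * (k / q) = k := by field_simp
    rw [this, eexp_intCast, sub_self, zero_div]

/-- Parseval's identity on `ℤ / q`. -/
theorem sum_norm_sq_dft {q : ℕ} (hq : 0 < q) (w : ℕ → ℝ) :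
    ∑ a ∈ range q, ‖∑ b ∈ range q, (w b : ℂ) * eexp (b * ((a : ℝ) / q))‖ ^ 2 = q * ∑ b ∈ range q, w b ^ 2 := by
  have e : ((∑ a ∈ range q, ‖∑ b ∈ range q, (w b : ℂ) * eexp (b * ((a : ℝ) / q))‖ ^ 2 : ℝ) : ℂ)
      = ((q * ∑ b ∈ range q, w b ^ 2 : ℝ) : ℂ) := by
    rw [Complex.ofReal_sum]
    simp_rw [ofReal_norm_sum_sq]
    rw [sum_comm, Complex.ofReal_mul, Complex.ofReal_sum, mul_sum]
    refine sum_congr rfl fun b hb => ?_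
    rw [sum_comm]
    have h1 : ∀ b' ∈ range q, ∑ a ∈ range q, (w b : ℂ) * eexp (b * ((a : ℝ) / q)) * conj ((w b' : ℂ) * eexp (b' * ((a : ℝ) / q)))
        = if b = b' then (q : ℂ) * (w b : ℂ) ^ 2 else 0 := by
      intro b' hb'
      have h2 : ∀ a ∈ range q, (w b : ℂ) * eexp (b * ((a : ℝ) / q)) * conj ((w b' : ℂ) * eexp (b' * ((a : ℝ) / q)))
          = (w b : ℂ) * (w b' : ℂ) * eexp (a * (((b : ℤ) - b' : ℤ) / q : ℝ)) := by
        intro a _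
        rw [map_mul, Complex.conj_ofReal]
        have : (a : ℝ) * (((b : ℤ) - b' : ℤ) / q : ℝ) = b * ((a : ℝ) / q) - b' * ((a : ℝ) / q) := by
          push_cast; ring
        rw [this, eexp_sub]; ring
      rw [sum_congr rfl h2, ← mul_sum, sum_range_eexp hq]
      have h3 : (q : ℤ) ∣ (b : ℤ) - b' ↔ b = b' := by
        rw [mem_range] at hb hb'
        constructor
        · intro h
          have := Int.eq_zero_of_abs_lt_dvd h (by rw [abs_lt]; omega)
          omega
        · rintro rfl; simp
      by_cases hbb : b = b'
      · rw [if_pos (h3.2 hbb), if_pos hbb, hbb]; ring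
      · rw [if_neg (mt h3.1 hbb), if_neg hbb, mul_zero]
    rw [sum_congr rfl h1, sum_ite_eq, if_pos hb]
    push_cast; rfl
  exact_mod_cast e

theorem eexp_natCast_mul_div_eq {q : ℕ} (hq : 0 < q) (p a : ℕ) :
    eexp (p * ((a : ℝ) / q)) = eexp ((p % q : ℕ) * ((a : ℝ) / q)) := by
  have hq0 : (q : ℝ) ≠ 0 := by exact_mod_cast hq.ne'
  have h : (p : ℝ) = (q : ℝ) * (p / q : ℕ) + (p % q : ℕ) := by exact_mod_cast (Nat.div_add_mod p q).symm
  have e : (p : ℝ) * ((a : ℝ) / q) = (p % q : ℕ) * ((a : ℝ) / q) + ((p / q * a : ℕ) : ℝ) := by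
    rw [h]; push_cast; field_simp; ring
  rw [e, eexp_add, eexp_natCast, mul_one]

/-- Primes in a residue class minus the expected main term. -/
noncomputable def residueErr (x : ℝ) (q b : ℕ) : ℝ :=
  ∑ p ∈ (primesLe x).filter (fun p => p % q = b), Real.log p - if q.Coprime b then x / Nat.totient q else 0

theorem thetaHat_eq_sum_residues {q : ℕ} (hq : 0 < q) (x : ℝ) (a : ℕ) :
    thetaHat x ((a : ℝ) / q) = ∑ b ∈ range q,
      ((∑ p ∈ (primesLe x).filter (fun p => p % q = b), Real.log p : ℝ) : ℂ) * eexp (b * ((a : ℝ) / q)) := by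
  rw [thetaHat, ← sum_fiberwise_of_maps_to (s := primesLe x) (t := range q) (g := fun p => p % q)
    (fun p _ => mem_range.2 (Nat.mod_lt _ hq))]
  refine sum_congr rfl fun b _ => ?_
  rw [Complex.ofReal_sum, sum_mul]
  refine sum_congr rfl fun p hp => ?_
  rw [eexp_natCast_mul_div_eq hq, (mem_filter.1 hp).2]

theorem primeErr_eq_sum_residueErr {q : ℕ} (hq : 0 < q) (x : ℝ) (a : ℕ) :
    primeErr x q a = ∑ b ∈ range q, (residueErr x q b : ℂ) * eexp (b * ((a : ℝ) / q)) := by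
  simp_rw [residueErr, Complex.ofReal_sub, sub_mul]
  rw [sum_sub_distrib, primeErr, ← thetaHat_eq_sum_residues hq, ramSum, sum_filter, mul_sum]
  congr 1
  refine sum_congr rfl fun b _ => ?_
  split_ifs <;> simp

theorem Ef_eq_residueErr {x : ℝ} {q ℓ : ℕ} (h : Nat.gcd ℓ q = 1) : Ef x q ℓ = residueErr x q (ℓ % q) := by
  have hc : q.Coprime (ℓ % q) := by
    rw [Nat.Coprime, Nat.gcd_comm, ← Nat.gcd_rec, Nat.gcd_comm]
    exact h
  rw [Ef, residueErr, if_pos hc, primesLe, filter_filter]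

theorem varSum_le {q : ℕ} (hq : 0 < q) (x : ℝ) : varSum x q ≤ 1 / q * ∑ a ∈ range q, ‖primeErr x q a‖ ^ 2 := by
  have hq0 : (q : ℝ) ≠ 0 := by exact_mod_cast hq.ne'
  simp_rw [primeErr_eq_sum_residueErr hq]
  rw [sum_norm_sq_dft hq, ← mul_assoc, one_div_mul_cancel hq0, one_mul, varSum]
  have hinj : Set.InjOn (fun ℓ => ℓ % q) ((Icc 1 q).filter (fun ℓ => Nat.gcd ℓ q = 1)) := by
    intro a ha b hb hab
    have ha1 := mem_Icc.1 (mem_filter.1 ha).1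
    have hb1 := mem_Icc.1 (mem_filter.1 hb).1
    have h1 : (q : ℤ) ∣ (b : ℤ) - a := (Nat.modEq_iff_dvd (n := q)).1 hab
    have := Int.eq_zero_of_abs_lt_dvd h1 (by rw [abs_lt]; omega)
    omega
  calc ∑ ℓ ∈ (Icc 1 q).filter (fun ℓ => Nat.gcd ℓ q = 1), Ef x q ℓ ^ 2
      = ∑ ℓ ∈ (Icc 1 q).filter (fun ℓ => Nat.gcd ℓ q = 1), residueErr x q (ℓ % q) ^ 2 :=
        sum_congr rfl fun ℓ hℓ => by rw [Ef_eq_residueErr (mem_filter.1 hℓ).2]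
    _ = ∑ b ∈ ((Icc 1 q).filter (fun ℓ => Nat.gcd ℓ q = 1)).image (fun ℓ => ℓ % q), residueErr x q b ^ 2 :=
        (sum_image (f := fun b => residueErr x q b ^ 2) hinj).symm
    _ ≤ _ := sum_le_sum_of_subset_of_nonneg
        (fun b hb => by
          obtain ⟨ℓ, _, rfl⟩ := mem_image.1 hb
          exact mem_range.2 (Nat.mod_lt _ hq)) fun _ _ _ => sq_nonneg _

end

section

open Finset ComplexConjugate

theorem sum_coprime_eq_sum_units {q : ℕ} [NeZero q] (F : ZMod q → ℂ) :
    ∑ b ∈ (range q).filter (fun b => q.Coprime b), F b = ∑ u : (ZMod q)ˣ, F u := by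
  symm
  refine sum_nbij (fun u => (u : ZMod q).val) ?_ ?_ ?_ ?_
  · intro u _
    rw [mem_filter, mem_range]
    exact ⟨ZMod.val_lt _, (ZMod.val_coe_unit_coprime u).symm⟩
  · intro u _ v _ h
    exact Units.ext (ZMod.val_injective q h)
  · intro b hb
    rw [mem_coe, mem_filter, mem_range] at hb
    refine ⟨ZMod.unitOfCoprime b hb.2.symm, mem_coe.2 (mem_univ _), ?_⟩
    simp [ZMod.val_natCast, Nat.mod_eq_of_lt hb.1]
  · intro u _
    rw [ZMod.natCast_zmod_val]

theorem sum_comp_eq_of_surjective {G H : Type*} [Group G] [Fintype G] [Group H] [Fintype H] (f : G →* H)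
    (hf : Function.Surjective f) (F : H → ℂ) :
    (Fintype.card H : ℂ) * ∑ g, F (f g) = Fintype.card G * ∑ h, F h := by
  classical
  have hfib : ∀ h : H, (univ.filter fun g => f g = h).card = (univ.filter fun g => f g = 1).card := fun h =>
    MonoidHom.card_fiber_eq_of_mem_range f (hf h) (hf 1)
  set k := (univ.filter fun g => f g = 1).card with hk
  have hG : Fintype.card G = Fintype.card H * k := by
    rw [← card_univ, card_eq_sum_card_fiberwise (f := f) (t := univ) (fun _ _ => mem_coe.2 (mem_univ _))]
    simp_rw [hfib]
    rw [sum_const, smul_eq_mul, card_univ]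
  have h2 : ∑ g, F (f g) = k * ∑ h, F h := by
    rw [← sum_fiberwise (s := univ) (g := f), mul_sum]
    refine sum_congr rfl fun h _ => ?_
    rw [sum_congr rfl (g := fun _ => F h) fun g hg => by rw [(mem_filter.1 hg).2], sum_const, hfib, nsmul_eq_mul]
  rw [h2, hG]; push_cast; ring

theorem sum_coprime_of_dvd {r q : ℕ} (hq : 0 < q) (h : r ∣ q) (F : ZMod r → ℂ) :
    (Nat.totient r : ℂ) * ∑ b ∈ (range q).filter (fun b => q.Coprime b), F b =
      Nat.totient q * ∑ b ∈ (range r).filter (fun b => r.Coprime b), F b := by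
  have : NeZero q := ⟨hq.ne'⟩
  have : NeZero r := ⟨(Nat.pos_of_dvd_of_pos h hq).ne'⟩
  have h1 := sum_coprime_eq_sum_units (q := q) fun z => F (ZMod.castHom h (ZMod r) z)
  simp only [map_natCast] at h1
  rw [h1, sum_coprime_eq_sum_units (q := r) F, ← ZMod.card_units_eq_totient r, ← ZMod.card_units_eq_totient q]
  exact sum_comp_eq_of_surjective (ZMod.unitsMap h) (ZMod.unitsMap_surjective h) fun v => F v

theorem ramSum_div_gcd {q a : ℕ} (hq : 0 < q) :
    (Nat.totient (q / a.gcd q) : ℂ) * ramSum q a = Nat.totient q * ramSum (q / a.gcd q) (a / a.gcd q) := by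
  set g := a.gcd q with hg
  have hg0 : 0 < g := Nat.gcd_pos_of_pos_right _ hq
  have hr : 0 < q / g := Nat.div_pos (Nat.le_of_dvd hq (Nat.gcd_dvd_right _ _)) hg0
  have hqd : q / g ∣ q := Nat.div_dvd_of_dvd (Nat.gcd_dvd_right _ _)
  have h := sum_coprime_of_dvd hq hqd fun z => eexp (z.val * (((a / g : ℕ) : ℝ) / (q / g : ℕ)))
  simp only [ZMod.val_natCast] at h
  simp_rw [← eexp_natCast_mul_div_eq hr] at h
  rw [ramSum, ramSum, ← h]
  congr 1
  refine sum_congr rfl fun b _ => ?_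
  rw [Nat.cast_div (Nat.gcd_dvd_left _ _) (by exact_mod_cast hg0.ne'),
    Nat.cast_div (Nat.gcd_dvd_right _ _) (by exact_mod_cast hg0.ne'), div_div_div_cancel_right₀]
  exact_mod_cast hg0.ne'

theorem primeErr_div_gcd {q a : ℕ} (hq : 0 < q) (x : ℝ) :
    primeErr x q a = primeErr x (q / a.gcd q) (a / a.gcd q) := by
  have h := ramSum_div_gcd (a := a) hq
  rw [primeErr, primeErr]
  set g := a.gcd q with hg
  have hg0 : 0 < g := Nat.gcd_pos_of_pos_right _ hq
  have hr : 0 < q / g := Nat.div_pos (Nat.le_of_dvd hq (Nat.gcd_dvd_right _ _)) hg0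
  have h1 : (Nat.totient q : ℂ) ≠ 0 := by exact_mod_cast (Nat.totient_pos.2 hq).ne'
  have h2 : (Nat.totient (q / g) : ℂ) ≠ 0 := by exact_mod_cast (Nat.totient_pos.2 hr).ne'
  congr 1
  · rw [Nat.cast_div (Nat.gcd_dvd_left _ _) (by exact_mod_cast hg0.ne'),
      Nat.cast_div (Nat.gcd_dvd_right _ _) (by exact_mod_cast hg0.ne'), div_div_div_cancel_right₀]
    exact_mod_cast hg0.ne'
  · push_cast
    rw [div_mul_eq_mul_div, div_mul_eq_mul_div, div_eq_div_iff h1 h2]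
    linear_combination (x : ℂ) * h

theorem sum_nthRootsFinset {n : ℕ} (hn : 0 < n) :
    ∑ z ∈ Polynomial.nthRootsFinset n (1 : ℂ), z = if n = 1 then 1 else 0 := by
  split_ifs with h
  · subst h
    have : Polynomial.nthRootsFinset 1 (1 : ℂ) = {1} := by
      ext z
      rw [Polynomial.mem_nthRootsFinset one_pos, pow_one, mem_singleton]
    rw [this, sum_singleton]
  · have hζ := Complex.isPrimitiveRoot_exp n hn.ne'
    set ζ := Complex.exp (2 * Real.pi * Complex.I / n) with hζd
    have hζ0 : ζ ≠ 0 := Complex.exp_ne_zero _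
    have hζ1 : ζ ≠ 1 := hζ.ne_one (by omega)
    have key : ∑ z ∈ Polynomial.nthRootsFinset n (1 : ℂ), ζ * z = ∑ z ∈ Polynomial.nthRootsFinset n (1 : ℂ), z := by
      refine sum_nbij' (fun z => ζ * z) (fun z => ζ⁻¹ * z) ?_ ?_ ?_ ?_ ?_
      · intro z hz
        rw [Polynomial.mem_nthRootsFinset hn] at hz ⊢
        rw [mul_pow, hζ.pow_eq_one, hz, one_mul]
      · intro z hz
        rw [Polynomial.mem_nthRootsFinset hn] at hz ⊢
        rw [mul_pow, inv_pow, hζ.pow_eq_one, hz, inv_one, one_mul]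
      · intro z _
        field_simp
      · intro z _
        field_simp
      · intro z _; rfl
    rw [← mul_sum] at key
    have h3 : (ζ - 1) * ∑ z ∈ Polynomial.nthRootsFinset n (1 : ℂ), z = 0 := by rw [sub_mul, key]; ring
    exact (mul_eq_zero.1 h3).resolve_left (sub_ne_zero.2 hζ1)

theorem sum_primitiveRoots_eq_moebius {n : ℕ} (hn : 0 < n) :
    ∑ z ∈ primitiveRoots n ℂ, z = (ArithmeticFunction.moebius n : ℂ) := by
  classical
  have h := (ArithmeticFunction.sum_eq_iff_sum_mul_moebius_eq (R := ℂ)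
    (f := fun n => ∑ z ∈ primitiveRoots n ℂ, z) (g := fun n => if n = 1 then 1 else 0)).1 (fun m hm => by
      rw [← sum_nthRootsFinset hm, IsPrimitiveRoot.nthRoots_one_eq_biUnion_primitiveRoots, sum_biUnion]
      intro i _ j _ hij
      exact IsPrimitiveRoot.disjoint hij) n hn
  rw [← h, sum_eq_single (n, 1)]
  · simp
  · intro y hy hne
    rw [Nat.mem_divisorsAntidiagonal] at hy
    rw [if_neg, mul_zero]
    intro h1
    apply hne
    rw [h1, mul_one] at hy
    exact Prod.ext hy.1 h1
  · intro hcon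
    exact absurd (Nat.mem_divisorsAntidiagonal.2 ⟨mul_one n, hn.ne'⟩) hcon

theorem norm_ramSum_le_one {r a : ℕ} (hr : 0 < r) (ha : a.Coprime r) : ‖ramSum r a‖ ≤ 1 := by
  have : NeZero r := ⟨hr.ne'⟩
  have hζ : IsPrimitiveRoot (eexp ((a : ℝ) / r)) r := by
    have := Complex.isPrimitiveRoot_exp_of_coprime a r hr.ne' ha
    convert this using 1
    rw [eexp]; congr 1; push_cast; ring
  have e : ramSum r a = ∑ z ∈ primitiveRoots r ℂ, z := by
    rw [ramSum]
    refine sum_nbij (fun b : ℕ => eexp (b * ((a : ℝ) / r))) ?_ ?_ ?_ ?_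
    · intro b hb
      rw [mem_filter] at hb
      rw [mem_primitiveRoots hr, eexp_natCast_mul]
      exact hζ.pow_of_coprime b hb.2.symm
    · intro b hb b' hb' h
      rw [mem_coe, mem_filter, mem_range] at hb hb'
      simp only [eexp_natCast_mul] at h
      exact hζ.pow_inj hb.1 hb'.1 h
    · intro z hz
      rw [mem_coe, mem_primitiveRoots hr, hζ.isPrimitiveRoot_iff] at hz
      obtain ⟨i, hi, hc, h⟩ := hz
      refine ⟨i, mem_coe.2 (mem_filter.2 ⟨mem_range.2 hi, hc.symm⟩), ?_⟩
      simp only [eexp_natCast_mul]; exact h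
    · intro b _; rfl
  rw [e, sum_primitiveRoots_eq_moebius hr, Complex.norm_intCast]
  exact_mod_cast ArithmeticFunction.abs_moebius_le_one

theorem norm_primeErr_le_of_Ef {r : ℕ} (hr : 0 < r) {x M : ℝ} (hx : 0 ≤ x) (hM : 0 ≤ M)
    (h : ∀ b : ℕ, Nat.gcd b r = 1 → |Ef x r b| ≤ M) (a : ℕ) : ‖primeErr x r a‖ ≤ r * (M + 2 * r ^ 2) := by
  have hr1 : (1 : ℝ) ≤ r := by exact_mod_cast hr
  rw [primeErr_eq_sum_residueErr hr]
  have hb : ∀ b ∈ range r, ‖(residueErr x r b : ℂ) * eexp (b * ((a : ℝ) / r))‖ ≤ M + 2 * r ^ 2 := by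
    intro b hb
    rw [mem_range] at hb
    rw [norm_mul, norm_eexp, mul_one, Complex.norm_real, Real.norm_eq_abs]
    by_cases hc : r.Coprime b
    · have h1 := h b hc.symm
      rw [Ef_eq_residueErr hc.symm, Nat.mod_eq_of_lt hb] at h1
      have : (0 : ℝ) ≤ 2 * r ^ 2 := by positivity
      linarith
    · rw [residueErr, if_neg hc, sub_zero]
      have hsub : (primesLe x).filter (fun p => p % r = b) ⊆ range (r + 1) := by
        intro p hp
        rw [mem_filter, mem_primesLe hx] at hp
        rw [mem_range, Nat.lt_succ_iff]
        by_contra hlt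
        have hp' := hp.1.2
        apply hc
        rw [← hp.2, Nat.Coprime, Nat.gcd_comm, ← Nat.gcd_rec]
        exact Nat.Coprime.symm ((Nat.Prime.coprime_iff_not_dvd hp').2 fun hd => by
          have := Nat.le_of_dvd hr hd
          omega)
      have hle : ∑ p ∈ (primesLe x).filter (fun p => p % r = b), Real.log p ≤ (r + 1) * r := by
        calc _ ≤ ∑ p ∈ (primesLe x).filter (fun p => p % r = b), (r : ℝ) := by
              refine sum_le_sum fun p hp => ?_
              have h1 : p ≤ r := Nat.lt_succ_iff.1 (mem_range.1 (hsub hp))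
              have h2 : (p : ℝ) ≤ r := by exact_mod_cast h1
              linarith [Real.log_le_self (Nat.cast_nonneg (α := ℝ) p)]
          _ = ((primesLe x).filter (fun p => p % r = b)).card * (r : ℝ) := by rw [sum_const, nsmul_eq_mul]
          _ ≤ (r + 1) * r := by
              gcongr
              have := card_le_card hsub
              rw [card_range] at this
              exact_mod_cast this
      rw [abs_of_nonneg (sum_nonneg fun p _ => Real.log_natCast_nonneg p)]
      nlinarith
  refine (norm_sum_le_of_le _ hb).trans (le_of_eq ?_)
  rw [sum_const, card_range, nsmul_eq_mul]

end

section

open Finset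

theorem prod_one_sub_inv_ge (s : Finset ℕ) (hs : ∀ p ∈ s, 2 ≤ p) :
    (1 : ℝ) / (s.card + 1) ≤ ∏ p ∈ s, (1 - (p : ℝ)⁻¹) := by
  induction s using Finset.induction_on_max with
  | empty => simp
  | insert a s hlt ih =>
    have hna : a ∉ s := fun h => lt_irrefl _ (hlt a h)
    have ih' := ih fun p hp => hs p (mem_insert_of_mem hp)
    have hsub : s ⊆ Ico 2 a := fun p hp => mem_Ico.2 ⟨hs p (mem_insert_of_mem hp), hlt p hp⟩
    have hcard := card_le_card hsub
    have ha2 := hs a (mem_insert_self _ _)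
    rw [Nat.card_Ico] at hcard
    have ha : ((s.card : ℝ) + 2) ≤ a := by exact_mod_cast (show s.card + 2 ≤ a by omega)
    rw [prod_insert hna, card_insert_of_notMem hna]
    have h1 : ((s.card : ℝ) + 1) / (s.card + 2) ≤ 1 - (a : ℝ)⁻¹ := by
      have h2 : (a : ℝ)⁻¹ ≤ ((s.card : ℝ) + 2)⁻¹ := inv_anti₀ (by positivity) ha
      have h3 : ((s.card : ℝ) + 1) / (s.card + 2) = 1 - ((s.card : ℝ) + 2)⁻¹ := by field_simp; ring
      linarith
    calc (1 : ℝ) / (((s.card + 1 : ℕ) : ℝ) + 1) = ((s.card : ℝ) + 1) / (s.card + 2) * (1 / (s.card + 1)) := by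
          push_cast; field_simp; ring
      _ ≤ _ := mul_le_mul h1 ih' (by positivity) (le_trans (by positivity) h1)

theorem le_totient_mul_log {n : ℕ} (hn : 0 < n) : (n : ℝ) ≤ Nat.totient n * (Nat.log 2 n + 1) := by
  have h1 := prod_one_sub_inv_ge n.primeFactors fun p hp => (Nat.prime_of_mem_primeFactors hp).two_le
  have h2 : n.primeFactors.card ≤ Nat.log 2 n := by
    apply Nat.le_log_of_pow_le (by norm_num)
    calc 2 ^ n.primeFactors.card ≤ ∏ p ∈ n.primeFactors, p :=
          pow_card_le_prod _ _ _ fun p hp => (Nat.prime_of_mem_primeFactors hp).two_le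
      _ ≤ n := Nat.le_of_dvd hn (Nat.prod_primeFactors_dvd n)
  have h3 : (Nat.totient n : ℝ) = n * ∏ p ∈ n.primeFactors, (1 - (p : ℝ)⁻¹) := by
    have := Nat.totient_eq_mul_prod_factors n
    have h := congrArg (fun t : ℚ => (t : ℝ)) this
    push_cast at h
    exact h
  have h4 : (n.primeFactors.card : ℝ) ≤ Nat.log 2 n := by exact_mod_cast h2
  have hn0 : (0 : ℝ) < n := by exact_mod_cast hn
  rw [h3]
  calc (n : ℝ) = n * (1 / (n.primeFactors.card + 1)) * (n.primeFactors.card + 1) := by field_simp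
    _ ≤ _ := by
        gcongr
        rw [← h3]
        positivity

theorem sum_inv_totient_le {R : ℕ} (hR : 0 < R) :
    ∑ r ∈ Icc 1 R, 1 / (Nat.totient r : ℝ) ≤ (2 * Real.log R + 1) * (1 + Real.log R) := by
  have hlog : (Nat.log 2 R : ℝ) ≤ 2 * Real.log R := by
    have h1 : ((2 : ℝ) ^ Nat.log 2 R) ≤ R := by exact_mod_cast Nat.pow_log_le_self 2 hR.ne'
    have h2 := Real.log_le_log (by positivity) h1
    rw [Real.log_pow] at h2
    have := Real.log_two_gt_d9
    have h3 : (0 : ℝ) ≤ Nat.log 2 R := by positivity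
    nlinarith
  have hlR : 0 ≤ Real.log R := Real.log_natCast_nonneg R
  have hterm : ∀ r ∈ Icc 1 R, 1 / (Nat.totient r : ℝ) ≤ (2 * Real.log R + 1) * (r : ℝ)⁻¹ := by
    intro r hr
    rw [mem_Icc] at hr
    have hr0 : 0 < r := hr.1
    have h0 := le_totient_mul_log hr0
    have h1 : (0 : ℝ) < Nat.totient r := by exact_mod_cast Nat.totient_pos.2 hr0
    have h2 : (Nat.log 2 r : ℝ) ≤ Nat.log 2 R := by exact_mod_cast Nat.log_mono_right hr.2
    have h3 : (0 : ℝ) < r := by exact_mod_cast hr0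
    rw [← div_eq_mul_inv, div_le_div_iff₀ h1 h3]
    nlinarith
  refine (sum_le_sum hterm).trans ?_
  rw [← mul_sum]
  have h4 := harmonic_le_one_add_log R
  rw [harmonic_eq_sum_Icc] at h4
  push_cast at h4
  gcongr

end

section

open Finset ComplexConjugate

lemma continuous_eexp : Continuous eexp := by
  unfold eexp
  fun_prop

theorem sq_intervalIntegral_le {g : ℝ → ℝ} (hg : Continuous g) {a b : ℝ} (hab : a < b) :
    (∫ t in a..b, g t) ^ 2 ≤ (b - a) * ∫ t in a..b, g t ^ 2 := by
  set I := ∫ t in a..b, g t with hI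
  set m := I / (b - a) with hm
  have hba : 0 < b - a := sub_pos.2 hab
  have h0 : 0 ≤ ∫ t in a..b, (g t - m) ^ 2 :=
    intervalIntegral.integral_nonneg hab.le fun t _ => sq_nonneg _
  have h1 : ∫ t in a..b, (g t - m) ^ 2 = (∫ t in a..b, g t ^ 2) - 2 * m * I + m ^ 2 * (b - a) := by
    have e : ∀ t, (g t - m) ^ 2 = g t ^ 2 - 2 * m * g t + m ^ 2 := fun t => by ring
    simp_rw [e]
    rw [intervalIntegral.integral_add, intervalIntegral.integral_sub,
      intervalIntegral.integral_const_mul, intervalIntegral.integral_const, smul_eq_mul, hI]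
    · ring
    all_goals exact Continuous.intervalIntegrable (by fun_prop) _ _
  have h2 : m * (b - a) = I := by rw [hm]; field_simp
  rw [h1] at h0
  have h3 : 2 * m * I = 2 * m ^ 2 * (b - a) := by rw [← h2]; ring
  have h4 : I ^ 2 = (b - a) * (m ^ 2 * (b - a)) := by rw [← h2]; ring
  rw [h4]
  exact mul_le_mul_of_nonneg_left (by linarith) hba.le

theorem integral_eexp_intCast_mul (k : ℤ) :
    ∫ β in (-1 : ℝ)..2, eexp (k * β) = if k = 0 then 3 else 0 := by
  split_ifs with hk
  · simp only [hk, Int.cast_zero, zero_mul, eexp_zero]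
    rw [intervalIntegral.integral_const]
    norm_num
  · have hc : (2 * Real.pi * k * Complex.I : ℂ) ≠ 0 := by
      simp [hk, Real.pi_ne_zero]
    have e : ∀ β : ℝ, eexp (k * β) = Complex.exp ((2 * Real.pi * k * Complex.I : ℂ) * β) := fun β => by
      rw [eexp]; congr 1; push_cast; ring
    simp_rw [e]
    rw [integral_exp_mul_complex hc, ← e, ← e,
      show (k : ℝ) * 2 = ((k * 2 : ℤ) : ℝ) by push_cast; ring,
      show (k : ℝ) * (-1) = ((-k : ℤ) : ℝ) by push_cast; ring, eexp_intCast, eexp_intCast]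
    simp

theorem integral_norm_sq_trigPoly (s : Finset ℕ) (d : ℕ → ℂ) :
    ∫ β in (-1 : ℝ)..2, ‖∑ n ∈ s, d n * eexp (n * β)‖ ^ 2 = 3 * ∑ n ∈ s, ‖d n‖ ^ 2 := by
  have h : ((∫ β in (-1 : ℝ)..2, ‖∑ n ∈ s, d n * eexp (n * β)‖ ^ 2 : ℝ) : ℂ)
      = ((3 * ∑ n ∈ s, ‖d n‖ ^ 2 : ℝ) : ℂ) := by
    rw [← intervalIntegral.integral_ofReal]
    have e : ∀ β : ℝ, ((‖∑ n ∈ s, d n * eexp (n * β)‖ ^ 2 : ℝ) : ℂ)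
        = ∑ m ∈ s, ∑ n ∈ s, d m * conj (d n) * eexp (((m : ℤ) - n : ℤ) * β) := by
      intro β
      rw [ofReal_norm_sum_sq]
      refine sum_congr rfl fun m _ => sum_congr rfl fun n _ => ?_
      rw [show ((((m : ℤ) - n : ℤ) : ℝ) * β) = m * β - n * β by push_cast; ring, eexp_sub, map_mul]
      ring
    simp_rw [e]
    have hcont : ∀ m n : ℕ, Continuous fun β : ℝ => d m * conj (d n) * eexp (((m : ℤ) - n : ℤ) * β) :=
      fun m n => continuous_const.mul (continuous_eexp.comp (by fun_prop))
    rw [intervalIntegral.integral_finsetSum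
      fun m _ => (continuous_finsetSum _ fun n _ => hcont m n).intervalIntegrable _ _]
    rw [Complex.ofReal_mul, Complex.ofReal_sum, mul_sum]
    refine sum_congr rfl fun m hm => ?_
    rw [intervalIntegral.integral_finsetSum fun n _ => (hcont m n).intervalIntegrable _ _]
    simp_rw [intervalIntegral.integral_const_mul, integral_eexp_intCast_mul]
    rw [sum_eq_single m]
    · rw [if_pos (by simp), Complex.mul_conj']
      push_cast
      ring
    · intro n _ hnm
      rw [if_neg (by omega), mul_zero]
    · exact fun h => absurd hm h
  exact_mod_cast h

theorem norm_integral_eexp_ge {h x : ℝ} (hh : 0 < h) (hxh : 16 * x * h = 1) {n : ℕ} (hn : (n : ℝ) ≤ x) :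
    h ≤ ‖∫ t in (-h)..h, eexp (n * t)‖ := by
  have hgi : IntervalIntegrable (fun t : ℝ => eexp (n * t)) MeasureTheory.volume (-h) h :=
    (continuous_eexp.comp (by fun_prop)).intervalIntegrable _ _
  have h1 : ‖∫ t in (-h)..h, (eexp (n * t) - 1)‖ ≤ 1 / 2 * |h - -h| := by
    refine intervalIntegral.norm_integral_le_of_norm_le_const fun t ht => ?_
    rw [Set.uIoc_of_le (by linarith)] at ht
    have hta : |t| ≤ h := abs_le.2 ⟨ht.1.le, ht.2⟩
    have hn0 : (0 : ℝ) ≤ n := by positivity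
    calc ‖eexp (n * t) - 1‖ ≤ 2 * Real.pi * |n * t| := norm_eexp_sub_one_le _
      _ = 2 * Real.pi * (n * |t|) := by rw [abs_mul, abs_of_nonneg hn0]
      _ ≤ 2 * Real.pi * (x * h) := by
          have : (n : ℝ) * |t| ≤ x * h := mul_le_mul hn hta (abs_nonneg _) (hn0.trans hn)
          have := Real.pi_pos
          gcongr
      _ ≤ 1 / 2 := by
          have : x * h = 1 / 16 := by linarith
          rw [this]
          linarith [Real.pi_le_four]
  rw [intervalIntegral.integral_sub hgi (Continuous.intervalIntegrable continuous_const _ _),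
    intervalIntegral.integral_const, abs_of_pos (by linarith)] at h1
  have h2 : ‖(h - -h) • (1 : ℂ)‖ = 2 * h := by
    rw [norm_smul, Real.norm_of_nonneg (by linarith), norm_one]; ring
  have h3 := norm_sub_norm_le ((h - -h) • (1 : ℂ)) (∫ t in (-h)..h, eexp (n * t))
  rw [norm_sub_rev] at h3
  linarith

set_option maxHeartbeats 1000000 in
theorem sum_integral_interval_le {ι : Type*} (T : Finset ι) (α : ι → ℝ) {h Mult : ℝ} (hh : 0 < h)
    (hh1 : h ≤ 1 / 16) (hα : ∀ i ∈ T, α i ∈ Set.Icc (0 : ℝ) 1) (hM0 : 0 ≤ Mult)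
    (hM : ∀ i ∈ T, ((T.filter fun j => |α j - α i| ≤ 2 * h).card : ℝ) ≤ Mult)
    {g : ℝ → ℝ} (hg : Continuous g) (hg0 : ∀ t, 0 ≤ g t) :
    ∑ i ∈ T, ∫ t in (α i - h)..(α i + h), g t ≤ Mult * ∫ t in (-1 : ℝ)..2, g t := by
  classical
  have hloc := hg.locallyIntegrable (μ := MeasureTheory.volume)
  have hgi : ∀ a b : ℝ, MeasureTheory.IntegrableOn g (Set.Ioc a b) := fun a b =>
    (hloc.integrableOn_isCompact isCompact_Icc).mono_set Set.Ioc_subset_Icc_self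
  have hi : ∀ i ∈ T, ∫ t in (α i - h)..(α i + h), g t
      = ∫ t, (Set.Ioc (α i - h) (α i + h)).indicator g t := fun i _ => by
    rw [intervalIntegral.integral_of_le (by linarith), MeasureTheory.integral_indicator measurableSet_Ioc]
  rw [sum_congr rfl hi, ← MeasureTheory.integral_finsetSum _ fun i _ =>
    (MeasureTheory.integrable_indicator_iff measurableSet_Ioc).2 (hgi _ _),
    intervalIntegral.integral_of_le (by norm_num), ← MeasureTheory.integral_indicator measurableSet_Ioc,
    ← MeasureTheory.integral_const_mul]
  refine MeasureTheory.integral_mono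
    (MeasureTheory.integrable_finsetSum _ fun i _ =>
      (MeasureTheory.integrable_indicator_iff measurableSet_Ioc).2 (hgi _ _))
    (((MeasureTheory.integrable_indicator_iff measurableSet_Ioc).2 (hgi _ _)).const_mul _) fun t => ?_
  simp only [Set.indicator_apply]
  rw [← sum_filter, sum_const, nsmul_eq_mul]
  rcases (T.filter fun i => t ∈ Set.Ioc (α i - h) (α i + h)).eq_empty_or_nonempty with he | ⟨i, hi⟩
  · rw [he]
    simp only [card_empty, Nat.cast_zero, zero_mul]
    split_ifs
    · exact mul_nonneg hM0 (hg0 t)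
    · simp
  · have hi' := mem_filter.1 hi
    have ht := hi'.2
    have hαi := hα i hi'.1
    rw [Set.mem_Ioc] at ht
    rw [if_pos ⟨by linarith [hαi.1], by linarith [hαi.2]⟩]
    refine mul_le_mul_of_nonneg_right ?_ (hg0 t)
    refine le_trans ?_ (hM i hi'.1)
    norm_cast
    refine card_le_card fun j hj => ?_
    have hj' := mem_filter.1 hj
    refine mem_filter.2 ⟨hj'.1, ?_⟩
    have htj := hj'.2
    rw [Set.mem_Ioc] at htj
    rw [abs_le]
    constructor <;> linarith

set_option maxHeartbeats 1000000 in
/-- A large sieve inequality for points with bounded multiplicity. -/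
theorem large_sieve {ι : Type*} (T : Finset ι) (α : ι → ℝ) (s : Finset ℕ) (c : ℕ → ℂ) {x Mult : ℝ}
    (hx : 1 ≤ x) (hs : ∀ n ∈ s, (n : ℝ) ≤ x) (hα : ∀ i ∈ T, α i ∈ Set.Icc (0 : ℝ) 1) (hM0 : 0 ≤ Mult)
    (hM : ∀ i ∈ T, ((T.filter fun j => |α j - α i| ≤ 1 / x).card : ℝ) ≤ Mult) :
    ∑ i ∈ T, ‖∑ n ∈ s, c n * eexp (n * α i)‖ ^ 2 ≤ 96 * x * Mult * ∑ n ∈ s, ‖c n‖ ^ 2 := by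
  set h : ℝ := 1 / (16 * x) with hhdef
  have hh : 0 < h := by positivity
  have hxh : 16 * x * h = 1 := by rw [hhdef]; field_simp
  have hh1 : h ≤ 1 / 16 := by nlinarith
  have h2h : 2 * h ≤ 1 / x := by
    rw [le_div_iff₀ (by positivity)]; linarith
  set κ : ℕ → ℂ := fun n => ∫ t in (-h)..h, eexp (n * t) with hκ
  have hκge : ∀ n ∈ s, h ≤ ‖κ n‖ := fun n hn => norm_integral_eexp_ge hh hxh (hs n hn)
  have hκ0 : ∀ n ∈ s, κ n ≠ 0 := fun n hn => norm_pos_iff.1 (hh.trans_le (hκge n hn))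
  set d : ℕ → ℂ := fun n => c n / κ n with hd
  set D : ℝ → ℂ := fun β => ∑ n ∈ s, d n * eexp (n * β) with hD
  have hterm : ∀ n : ℕ, ∀ a : ℝ, Continuous fun t : ℝ => d n * eexp (n * (a + t)) := fun n a =>
    continuous_const.mul (continuous_eexp.comp (by fun_prop))
  have hDc : Continuous D := continuous_finsetSum _ fun n _ =>
    continuous_const.mul (continuous_eexp.comp (by fun_prop))
  have hS : ∀ a : ℝ, ∑ n ∈ s, c n * eexp (n * a) = ∫ t in (-h)..h, D (a + t) := by
    intro a
    rw [hD, intervalIntegral.integral_finsetSum fun n _ => (hterm n a).intervalIntegrable _ _]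
    refine sum_congr rfl fun n hn => ?_
    simp_rw [mul_add, eexp_add, ← mul_assoc]
    rw [intervalIntegral.integral_const_mul]
    change _ = d n * eexp (n * a) * κ n
    rw [hd]
    have := hκ0 n hn
    field_simp
  have hpt : ∀ i ∈ T, ‖∑ n ∈ s, c n * eexp (n * α i)‖ ^ 2
      ≤ 2 * h * ∫ t in (α i - h)..(α i + h), ‖D t‖ ^ 2 := by
    intro i _
    rw [hS]
    have hc' : Continuous fun t => ‖D (α i + t)‖ := (hDc.comp (by fun_prop)).norm
    have h1 := intervalIntegral.norm_integral_le_integral_norm (f := fun t => D (α i + t))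
      (μ := MeasureTheory.volume) (show -h ≤ h by linarith)
    have h2 := sq_intervalIntegral_le hc' (show -h < h by linarith)
    have h3 := intervalIntegral.integral_comp_add_left (a := -h) (b := h) (fun t => ‖D t‖ ^ 2) (α i)
    rw [h3, show h - -h = 2 * h by ring, ← sub_eq_add_neg] at h2
    exact (pow_le_pow_left₀ (norm_nonneg _) h1 2).trans h2
  refine (sum_le_sum hpt).trans ?_
  rw [← mul_sum]
  have hM' : ∀ i ∈ T, ((T.filter fun j => |α j - α i| ≤ 2 * h).card : ℝ) ≤ Mult := fun i hi => by
    refine le_trans ?_ (hM i hi)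
    norm_cast
    refine card_le_card fun j hj => ?_
    rw [mem_filter] at hj ⊢
    exact ⟨hj.1, hj.2.trans h2h⟩
  have h4 := sum_integral_interval_le T α hh hh1 hα hM0 hM'
    (show Continuous fun t => ‖D t‖ ^ 2 from hDc.norm.pow 2) fun t => sq_nonneg _
  rw [integral_norm_sq_trigPoly s d] at h4
  have h5 : ∑ n ∈ s, ‖d n‖ ^ 2 ≤ (1 / h ^ 2) * ∑ n ∈ s, ‖c n‖ ^ 2 := by
    rw [mul_sum]
    refine sum_le_sum fun n hn => ?_
    have := hκge n hn
    rw [hd, norm_div, div_pow, div_eq_inv_mul, one_div]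
    gcongr
  calc 2 * h * ∑ i ∈ T, ∫ t in (α i - h)..(α i + h), ‖D t‖ ^ 2
      ≤ 2 * h * (Mult * (3 * ((1 / h ^ 2) * ∑ n ∈ s, ‖c n‖ ^ 2))) := by
        refine mul_le_mul_of_nonneg_left (h4.trans ?_) (by linarith)
        gcongr
    _ = 96 * x * Mult * ∑ n ∈ s, ‖c n‖ ^ 2 := by
        rw [hhdef]; field_simp; ring

end

section

open Finset

theorem card_filter_div_gcd_le (q J : ℕ) (hq : 0 < q) :
    ((range q).filter fun a => q / a.gcd q ≤ J).card ≤ J * (J + 1) := by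
  have h : ((range q).filter fun a => q / a.gcd q ≤ J).card ≤ (range J ×ˢ range (J + 1)).card := by
    refine card_le_card_of_injOn (fun a => (a / a.gcd q, q / a.gcd q)) ?_ ?_
    · intro a ha
      have ha' := mem_filter.1 ha
      have hg : 0 < a.gcd q := Nat.gcd_pos_of_pos_right _ hq
      have hlt : a / a.gcd q < q / a.gcd q :=
        Nat.div_lt_div_of_lt_of_dvd (Nat.gcd_dvd_right _ _) (mem_range.1 ha'.1)
      simp only [coe_product, Set.mem_prod, mem_coe, mem_range]
      omega
    · intro a _ b _ hab
      simp only [Prod.mk.injEq] at hab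
      have ha := Nat.div_mul_cancel (Nat.gcd_dvd_right a q)
      have hb := Nat.div_mul_cancel (Nat.gcd_dvd_right b q)
      have h1 : 0 < q / a.gcd q :=
        Nat.div_pos (Nat.le_of_dvd hq (Nat.gcd_dvd_right _ _)) (Nat.gcd_pos_of_pos_right _ hq)
      have hgg : a.gcd q = b.gcd q := by
        rw [← hab.2] at hb
        exact Nat.eq_of_mul_eq_mul_left h1 (ha.trans hb.symm)
      rw [← Nat.div_mul_cancel (Nat.gcd_dvd_left a q), ← Nat.div_mul_cancel (Nat.gcd_dvd_left b q),
        hab.1, hgg]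
  simpa using h

theorem card_filter_div_gcd_eq_le (q r : ℕ) (hq : 0 < q) :
    ((range q).filter fun a => q / a.gcd q = r).card ≤ if r ∣ q then Nat.totient r else 0 := by
  split_ifs with h
  · have hd : q / r ∣ q := Nat.div_dvd_of_dvd h
    rw [← Nat.div_div_self h hq.ne', Nat.totient_div_of_dvd hd, Nat.div_div_self h hq.ne']
    refine card_le_card fun a ha => ?_
    rw [mem_filter] at ha ⊢
    refine ⟨ha.1, ?_⟩
    rw [Nat.gcd_comm, ← ha.2, Nat.div_div_self (Nat.gcd_dvd_right _ _) hq.ne']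
  · rw [Nat.le_zero, card_eq_zero, filter_eq_empty_iff]
    rintro a _ rfl
    exact h (Nat.div_dvd_of_dvd (Nat.gcd_dvd_right _ _))

open scoped Classical in
theorem sum_inv_totient_sq_le (S : Finset ℕ) {Q J : ℕ} (hS : ∀ q ∈ S, 0 < q ∧ q ≤ 2 * Q) {G : ℝ}
    (hG : ∀ r, J < r → r ≤ 2 * Q → ((S.filter fun q : ℕ => r ∣ q).card : ℝ) ≤ G) (hG0 : 0 ≤ G) :
    ∑ q ∈ S, ∑ a ∈ (range q).filter (fun a => J < q / a.gcd q), 1 / (Nat.totient (q / a.gcd q) : ℝ) ^ 2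
      ≤ G * ∑ r ∈ Icc 1 (2 * Q), 1 / (Nat.totient r : ℝ) := by
  have h1 : ∀ q ∈ S, ∑ a ∈ (range q).filter (fun a => J < q / a.gcd q),
      1 / (Nat.totient (q / a.gcd q) : ℝ) ^ 2
      ≤ ∑ r ∈ (Icc 1 (2 * Q)).filter (fun r => J < r), if r ∣ q then 1 / (Nat.totient r : ℝ) else 0 := by
    intro q hq
    obtain ⟨hq0, hq2⟩ := hS q hq
    rw [← sum_fiberwise_of_maps_to (t := (Icc 1 (2 * Q)).filter fun r => J < r)
      (g := fun a => q / a.gcd q)]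
    · refine sum_le_sum fun r hr => ?_
      have hr1 := (mem_Icc.1 (mem_filter.1 hr).1).1
      have hφ : (0 : ℝ) < Nat.totient r := by exact_mod_cast Nat.totient_pos.2 hr1
      have e : ∀ a ∈ ((range q).filter fun a => J < q / a.gcd q).filter (fun a => q / a.gcd q = r),
          1 / (Nat.totient (q / a.gcd q) : ℝ) ^ 2 = 1 / (Nat.totient r : ℝ) ^ 2 := fun a ha => by
        rw [(mem_filter.1 ha).2]
      rw [sum_congr rfl e, sum_const, nsmul_eq_mul]
      have hc : (((range q).filter fun a => J < q / a.gcd q).filter fun a => q / a.gcd q = r).card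
          ≤ if r ∣ q then Nat.totient r else 0 := by
        refine le_trans (card_le_card ?_) (card_filter_div_gcd_eq_le q r hq0)
        exact filter_subset_filter _ (filter_subset _ _)
      split_ifs at hc ⊢ with hd
      · have hc' : ((((range q).filter fun a => J < q / a.gcd q).filter fun a => q / a.gcd q = r).card : ℝ)
            ≤ Nat.totient r := by exact_mod_cast hc
        refine (mul_le_mul_of_nonneg_right hc' (by positivity)).trans (le_of_eq ?_)
        field_simp
      · rw [Nat.le_zero.1 hc]; simp
    · intro a ha
      have ha' := mem_filter.1 ha
      exact mem_filter.2 ⟨mem_Icc.2 ⟨by omega, (Nat.div_le_self _ _).trans hq2⟩, ha'.2⟩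
  refine (sum_le_sum h1).trans ?_
  rw [sum_comm, mul_sum]
  refine le_trans (sum_le_sum (g := fun r => G * (1 / (Nat.totient r : ℝ))) fun r hr => ?_)
    (sum_le_sum_of_subset_of_nonneg (filter_subset _ _) fun r _ _ => by positivity)
  have hr' := mem_filter.1 hr
  rw [← sum_filter, sum_const, nsmul_eq_mul]
  exact mul_le_mul_of_nonneg_right (hG r hr'.2 (mem_Icc.1 hr'.1).2) (by positivity)

open scoped Classical in
set_option maxHeartbeats 1000000 in
theorem sum_thetaHat_sq_le (S : Finset ℕ) {Q J : ℕ} (hS : ∀ q ∈ S, 0 < q ∧ q ≤ 2 * Q) {G x : ℝ}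
    (hG0 : 0 ≤ G) (hx : 1 ≤ x) (hη : 2 * (Q : ℝ) / x < 1 / 2)
    (hG : ∀ a r : ℕ, a ≤ r → a.Coprime r → J < r → r ≤ 2 * Q →
      ((S.filter fun q : ℕ => ∃ m : ℤ, |(q : ℝ) * (a / r) - m| ≤ 2 * Q / x).card : ℝ) ≤ G) :
    ∑ q ∈ S, ∑ a ∈ (range q).filter (fun a => J < q / a.gcd q), ‖thetaHat x ((a : ℝ) / q)‖ ^ 2
      ≤ 96 * x * G * ∑ p ∈ primesLe x, Real.log p ^ 2 := by
  have hx0 : 0 < x := by linarith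
  rw [sum_sigma' S (fun q => (range q).filter fun a => J < q / a.gcd q)
    (fun q a => ‖thetaHat x ((a : ℝ) / q)‖ ^ 2)]
  set T := S.sigma fun q => (range q).filter fun a => J < q / a.gcd q with hT
  have key := large_sieve T (fun i => (i.2 : ℝ) / i.1) (primesLe x) (fun p => (Real.log p : ℂ)) hx
    (fun n hn => ((mem_primesLe hx0.le).1 hn).1) ?_ hG0 ?_
  · have e : ∑ p ∈ primesLe x, ‖(Real.log p : ℂ)‖ ^ 2 = ∑ p ∈ primesLe x, Real.log p ^ 2 :=
      sum_congr rfl fun p _ => by rw [Complex.norm_real, Real.norm_eq_abs, sq_abs]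
    rw [e] at key
    exact key
  · intro i hi
    have hi' := mem_sigma.1 hi
    have hq0 : (0 : ℝ) < i.1 := by exact_mod_cast (hS _ hi'.1).1
    have hlt : (i.2 : ℝ) < i.1 := by exact_mod_cast mem_range.1 (mem_filter.1 hi'.2).1
    exact ⟨by positivity, by rw [div_le_one hq0]; exact hlt.le⟩
  · intro i hi
    have hi' := mem_sigma.1 hi
    obtain ⟨hq0, hq2⟩ := hS _ hi'.1
    have hi2 := mem_filter.1 hi'.2
    have hg : 0 < i.2.gcd i.1 := Nat.gcd_pos_of_pos_right _ hq0
    have hlt : i.2 / i.2.gcd i.1 < i.1 / i.2.gcd i.1 :=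
      Nat.div_lt_div_of_lt_of_dvd (Nat.gcd_dvd_right _ _) (mem_range.1 hi2.1)
    have hα : ((i.2 / i.2.gcd i.1 : ℕ) : ℝ) / ((i.1 / i.2.gcd i.1 : ℕ) : ℝ) = (i.2 : ℝ) / i.1 := by
      have hg' : ((i.2.gcd i.1 : ℕ) : ℝ) ≠ 0 := by exact_mod_cast hg.ne'
      rw [Nat.cast_div (Nat.gcd_dvd_left _ _) hg', Nat.cast_div (Nat.gcd_dvd_right _ _) hg',
        div_div_div_cancel_right₀ hg']
    have hGi := hG (i.2 / i.2.gcd i.1) (i.1 / i.2.gcd i.1) hlt.le (Nat.coprime_div_gcd_div_gcd hg)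
      hi2.2 ((Nat.div_le_self _ _).trans hq2)
    rw [hα] at hGi
    refine le_trans ?_ hGi
    norm_cast
    have hnear : ∀ j ∈ T, |(j.2 : ℝ) / j.1 - (i.2 : ℝ) / i.1| ≤ 1 / x →
        |(j.1 : ℝ) * ((i.2 : ℝ) / i.1) - j.2| ≤ 2 * Q / x := by
      intro j hj hji
      obtain ⟨hj0, hj2⟩ := hS _ (mem_sigma.1 hj).1
      have hj0' : (0 : ℝ) < j.1 := by exact_mod_cast hj0
      have hj2' : (j.1 : ℝ) ≤ 2 * Q := by exact_mod_cast hj2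
      have e : (j.1 : ℝ) * ((i.2 : ℝ) / i.1) - j.2 = -(j.1 * ((j.2 : ℝ) / j.1 - (i.2 : ℝ) / i.1)) := by
        rw [mul_sub, mul_div_cancel₀ _ hj0'.ne']; ring
      rw [e, abs_neg, abs_mul, abs_of_pos hj0']
      calc (j.1 : ℝ) * |(j.2 : ℝ) / j.1 - (i.2 : ℝ) / i.1| ≤ 2 * Q * (1 / x) :=
            mul_le_mul hj2' hji (abs_nonneg _) (by positivity)
        _ = 2 * Q / x := by ring
    refine card_le_card_of_injOn (fun j => j.1) ?_ ?_
    · intro j hj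
      have hj' := mem_filter.1 hj
      refine mem_filter.2 ⟨(mem_sigma.1 hj'.1).1, (j.2 : ℤ), ?_⟩
      exact_mod_cast hnear j hj'.1 hj'.2
    · rintro ⟨q, a⟩ hj ⟨q', b⟩ hk hjk
      simp only at hjk
      subst hjk
      have h1 := hnear _ (mem_filter.1 hj).1 (mem_filter.1 hj).2
      have h2 := hnear _ (mem_filter.1 hk).1 (mem_filter.1 hk).2
      simp only at h1 h2
      have h3 : |(a : ℝ) - b| < 1 := by
        rw [abs_le] at h1 h2
        rw [abs_lt]
        constructor <;> linarith
      have h4 : |(a : ℤ) - b| < 1 := by exact_mod_cast h3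
      have : a = b := by
        have := Int.abs_lt_one_iff.1 h4
        omega
      rw [this]

open scoped Classical in
set_option maxHeartbeats 1000000 in
theorem sum_varSum_le_of_count (S : Finset ℕ) {Q J : ℕ} (hQ : 0 < Q)
    (hS : ∀ q ∈ S, Q < q ∧ q ≤ 2 * Q) {G x M : ℝ} (hG0 : 0 ≤ G) (hM0 : 0 ≤ M) (hx : 1 ≤ x) (hJ : 1 ≤ J)
    (hη : 2 * (Q : ℝ) / x < 1 / 2)
    (hSW : ∀ r : ℕ, 1 ≤ r → r ≤ J → ∀ b, Nat.gcd b r = 1 → |Ef x r b| ≤ M)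
    (hG : ∀ a r : ℕ, a ≤ r → a.Coprime r → J < r → r ≤ 2 * Q →
      ((S.filter fun q : ℕ => ∃ m : ℤ, |(q : ℝ) * (a / r) - m| ≤ 2 * Q / x).card : ℝ) ≤ G) :
    ∑ q ∈ S, varSum x q ≤ 1 / Q * (S.card * (J * (J + 1) * (J * (M + 2 * J ^ 2)) ^ 2)
      + 2 * (96 * x * G * ∑ p ∈ primesLe x, Real.log p ^ 2)
      + 2 * (x ^ 2 * (G * ∑ r ∈ Icc 1 (2 * Q), 1 / (Nat.totient r : ℝ)))) := by
  have hS' : ∀ q ∈ S, 0 < q ∧ q ≤ 2 * Q := fun q hq => ⟨hQ.trans (hS q hq).1, (hS q hq).2⟩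
  have hx0 : 0 < x := by linarith
  have hQ' : (0 : ℝ) < Q := by exact_mod_cast hQ
  have hdiv : ∀ r, J < r → r ≤ 2 * Q → ((S.filter fun q : ℕ => r ∣ q).card : ℝ) ≤ G := by
    intro r hr hr2
    refine le_trans ?_ (hG 1 r (by omega) (Nat.coprime_one_left r) hr hr2)
    refine Nat.cast_le.2 (card_le_card fun q hq => ?_)
    obtain ⟨hqS, k, rfl⟩ := mem_filter.1 hq
    refine mem_filter.2 ⟨hqS, (k : ℤ), ?_⟩
    have hr0 : (r : ℝ) ≠ 0 := by exact_mod_cast (show r ≠ 0 by omega)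
    have : ((r * k : ℕ) : ℝ) * (((1 : ℕ) : ℝ) / r) - ((k : ℤ) : ℝ) = 0 := by
      push_cast; field_simp; ring
    rw [this, abs_zero]
    positivity
  have hpt : ∀ q ∈ S, varSum x q ≤ 1 / Q * ((J * (J + 1) * (J * (M + 2 * J ^ 2)) ^ 2)
      + 2 * (∑ a ∈ (range q).filter (fun a => J < q / a.gcd q), ‖thetaHat x ((a : ℝ) / q)‖ ^ 2)
      + 2 * (x ^ 2 * ∑ a ∈ (range q).filter (fun a => J < q / a.gcd q),
          1 / (Nat.totient (q / a.gcd q) : ℝ) ^ 2)) := by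
    intro q hq
    obtain ⟨hq0, hq2⟩ := hS' q hq
    have hq0' : (0 : ℝ) < q := by exact_mod_cast hq0
    have hQq : (Q : ℝ) ≤ q := by exact_mod_cast (hS q hq).1.le
    refine (varSum_le hq0 x).trans ?_
    refine mul_le_mul (one_div_le_one_div_of_le hQ' hQq) ?_ (by positivity) (by positivity)
    rw [← sum_filter_add_sum_filter_not (range q) fun a => q / a.gcd q ≤ J, add_assoc]
    refine add_le_add ?_ ?_
    · have h1 : ∀ a ∈ (range q).filter (fun a => q / a.gcd q ≤ J),
          ‖primeErr x q a‖ ^ 2 ≤ (J * (M + 2 * J ^ 2)) ^ 2 := by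
        intro a ha
        have ha' := mem_filter.1 ha
        have hr : 0 < q / a.gcd q :=
          Nat.div_pos (Nat.le_of_dvd hq0 (Nat.gcd_dvd_right _ _)) (Nat.gcd_pos_of_pos_right _ hq0)
        rw [primeErr_div_gcd hq0]
        refine pow_le_pow_left₀ (norm_nonneg _) ?_ 2
        refine (norm_primeErr_le_of_Ef hr hx0.le hM0 (hSW _ hr ha'.2) _).trans ?_
        have : ((q / a.gcd q : ℕ) : ℝ) ≤ J := by exact_mod_cast ha'.2
        gcongr
      refine (sum_le_sum h1).trans ?_
      rw [sum_const, nsmul_eq_mul]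
      have hc : (((range q).filter fun a => q / a.gcd q ≤ J).card : ℝ) ≤ J * (J + 1) := by
        exact_mod_cast card_filter_div_gcd_le q J hq0
      gcongr
    · simp only [not_le]
      rw [mul_sum, mul_sum, mul_sum, ← sum_add_distrib]
      refine sum_le_sum fun a ha => ?_
      have hr : 0 < q / a.gcd q :=
        Nat.div_pos (Nat.le_of_dvd hq0 (Nat.gcd_dvd_right _ _)) (Nat.gcd_pos_of_pos_right _ hq0)
      have hg : 0 < a.gcd q := Nat.gcd_pos_of_pos_right _ hq0
      have hα : ((a / a.gcd q : ℕ) : ℝ) / ((q / a.gcd q : ℕ) : ℝ) = (a : ℝ) / q := by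
        have hg' : ((a.gcd q : ℕ) : ℝ) ≠ 0 := by exact_mod_cast hg.ne'
        rw [Nat.cast_div (Nat.gcd_dvd_left _ _) hg', Nat.cast_div (Nat.gcd_dvd_right _ _) hg',
          div_div_div_cancel_right₀ hg']
      have hφ : (0 : ℝ) < Nat.totient (q / a.gcd q) := by exact_mod_cast Nat.totient_pos.2 hr
      rw [primeErr_div_gcd hq0, primeErr, hα]
      have h2 := norm_sub_le (thetaHat x ((a : ℝ) / q))
        (((x / Nat.totient (q / a.gcd q) : ℝ) : ℂ) * ramSum (q / a.gcd q) (a / a.gcd q))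
      have h3 : ‖((x / Nat.totient (q / a.gcd q) : ℝ) : ℂ) * ramSum (q / a.gcd q) (a / a.gcd q)‖
          ≤ x / Nat.totient (q / a.gcd q) := by
        rw [norm_mul, Complex.norm_real, Real.norm_of_nonneg (by positivity)]
        exact mul_le_of_le_one_right (by positivity)
          (norm_ramSum_le_one hr (Nat.coprime_div_gcd_div_gcd hg))
      have h4 : (x : ℝ) ^ 2 * (1 / (Nat.totient (q / a.gcd q) : ℝ) ^ 2)
          = (x / Nat.totient (q / a.gcd q)) ^ 2 := by rw [div_pow]; ring
      rw [h4]
      have h5 := h2.trans (add_le_add_right h3 _)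
      refine (pow_le_pow_left₀ (norm_nonneg _) h5 2).trans ?_
      nlinarith [sq_nonneg (‖thetaHat x ((a : ℝ) / q)‖ - x / Nat.totient (q / a.gcd q))]
  refine (sum_le_sum hpt).trans ?_
  rw [← mul_sum, sum_add_distrib, sum_add_distrib, sum_const, nsmul_eq_mul, ← mul_sum, ← mul_sum,
    ← mul_sum]
  have h6 := sum_thetaHat_sq_le S hS' hG0 hx hη hG
  have h7 := sum_inv_totient_sq_le S hS' hdiv hG0
  gcongr

end

section

open Finset Filter

theorem bounds_of_mem_SQ {c : ℝ} {Q q : ℕ} (hq : q ∈ SQ c Q) : Q < q ∧ q ≤ 2 * Q := by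
  classical
  unfold SQ at hq
  exact mem_Ioc.1 (mem_filter.1 hq).1

theorem varSum_le_of_Ef_le {x M : ℝ} {q : ℕ} (h : ∀ b, Nat.gcd b q = 1 → |Ef x q b| ≤ M) :
    varSum x q ≤ q * M ^ 2 := by
  have h1 : ∀ ℓ ∈ (Icc 1 q).filter (fun ℓ => Nat.gcd ℓ q = 1), Ef x q ℓ ^ 2 ≤ M ^ 2 := fun ℓ hℓ => by
    rw [← sq_abs]
    exact pow_le_pow_left₀ (abs_nonneg _) (h ℓ (mem_filter.1 hℓ).2) 2
  refine (sum_le_sum h1).trans ?_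
  rw [sum_const, nsmul_eq_mul]
  refine mul_le_mul_of_nonneg_right ?_ (sq_nonneg _)
  have := (card_filter_le (Icc 1 q) fun ℓ => Nat.gcd ℓ q = 1)
  rw [Nat.card_Icc, Nat.add_sub_cancel] at this
  exact_mod_cast this

theorem sum_log_sq_primesLe_le {x : ℝ} (hx : 1 ≤ x) :
    ∑ p ∈ primesLe x, Real.log p ^ 2 ≤ 2 * x * Real.log x := by
  have hx0 : 0 ≤ x := by linarith
  have hL : 0 ≤ Real.log x := Real.log_nonneg hx
  have h1 : ∀ p ∈ primesLe x, Real.log p ^ 2 ≤ Real.log x * Real.log p := fun p hp => by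
    obtain ⟨hpx, hpp⟩ := (mem_primesLe hx0).1 hp
    have hp0 : (0 : ℝ) < p := by exact_mod_cast hpp.pos
    rw [sq]
    exact mul_le_mul_of_nonneg_right (Real.log_le_log hp0 hpx) (Real.log_natCast_nonneg p)
  refine (sum_le_sum h1).trans ?_
  rw [← mul_sum, sum_primesLe_log_eq_theta]
  have h2 := Chebyshev.theta_le_log4_mul_x hx0
  have h3 : Real.log 4 ≤ 2 := by
    rw [show (4 : ℝ) = 2 ^ 2 by norm_num, Real.log_pow]
    have := Real.log_two_lt_d9
    push_cast
    linarith
  have h4 : Chebyshev.theta x ≤ 2 * x := h2.trans (mul_le_mul_of_nonneg_right h3 hx0)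
  nlinarith

theorem sum_inv_totient_le_log_sq {x : ℝ} (hx : 3 ≤ x) {R : ℕ} (hR : 0 < R) (hRx : (R : ℝ) ≤ x) :
    ∑ r ∈ Icc 1 R, 1 / (Nat.totient r : ℝ) ≤ 6 * Real.log x ^ 2 := by
  have hR0 : (0 : ℝ) < R := by exact_mod_cast hR
  have h1 : Real.log R ≤ Real.log x := Real.log_le_log hR0 hRx
  have h2 : 0 ≤ Real.log R := Real.log_natCast_nonneg R
  have h3 : 1 ≤ Real.log x := by
    rw [Real.le_log_iff_exp_le (by linarith)]
    exact Real.exp_one_lt_three.le.trans hx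
  refine (sum_inv_totient_le hR).trans ?_
  nlinarith

theorem sum_varSum_SQ_le_of_small {c x L K : ℝ} {Q F A' N : ℕ} (hL : 1 ≤ L) (hQ : 0 < Q)
    (hQF : (Q : ℝ) ≤ L ^ F) (hA' : F + N ≤ A')
    (hSW : ∀ q ∈ SQ c Q, ∀ b, Nat.gcd b q = 1 → |Ef x q b| ≤ K * x / L ^ A') :
    ∑ q ∈ SQ c Q, varSum x q ≤ 1 / Q * (2 * K ^ 2 * (SQ c Q).card * (x ^ 2 / L ^ N)) := by
  have hL0 : 0 < L := by linarith
  have hQ0 : (0 : ℝ) < Q := by exact_mod_cast hQ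
  have h1 : ∀ q ∈ SQ c Q, varSum x q ≤ 1 / Q * (2 * K ^ 2 * (x ^ 2 / L ^ N)) := by
    intro q hq
    have hq2 : (q : ℝ) ≤ 2 * Q := by
      exact_mod_cast (bounds_of_mem_SQ hq).2
    refine (varSum_le_of_Ef_le (hSW q hq)).trans ?_
    have h2 : (Q : ℝ) ^ 2 * L ^ N ≤ (L ^ A') ^ 2 := by
      calc (Q : ℝ) ^ 2 * L ^ N ≤ (L ^ F) ^ 2 * (L ^ N) ^ 2 := by
            have : (1 : ℝ) ≤ L ^ N := one_le_pow₀ hL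
            gcongr
            exact le_self_pow₀ this two_ne_zero
        _ = (L ^ (F + N)) ^ 2 := by rw [pow_add]; ring
        _ ≤ (L ^ A') ^ 2 := by gcongr
    calc (q : ℝ) * (K * x / L ^ A') ^ 2 ≤ 2 * Q * (K * x / L ^ A') ^ 2 := by gcongr
      _ = 1 / Q * (2 * K ^ 2 * (x ^ 2 * (Q ^ 2 / (L ^ A') ^ 2))) := by field_simp
      _ ≤ 1 / Q * (2 * K ^ 2 * (x ^ 2 * (1 / L ^ N))) := by
          have : (Q : ℝ) ^ 2 / (L ^ A') ^ 2 ≤ 1 / L ^ N := by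
            rw [div_le_div_iff₀ (by positivity) (by positivity), one_mul]
            exact h2
          gcongr
      _ = _ := by ring
  refine (sum_le_sum h1).trans (le_of_eq ?_)
  rw [sum_const, nsmul_eq_mul]
  ring

open scoped Classical in
set_option maxHeartbeats 1000000 in
theorem sum_varSum_SQ_le_of_large {c x K C : ℝ} {Q J D A' N : ℕ} (hK : 0 < K) (hC : 0 < C)
    (hL : 8 ≤ Real.log x) (hx : 3 ≤ x) (hQ : 0 < Q) (hD : D = N + 2)
    (hJ1 : Real.log x ^ D ≤ J) (hJ2 : (J : ℝ) ≤ 2 * Real.log x ^ D)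
    (hA' : 4 * D + N ≤ 2 * A') (hxL : Real.log x ^ (2 * D + A' + 1) ≤ x)
    (hQx : (Q : ℝ) ≤ x / Real.log x ^ (2 * D + 1))
    (hSW : ∀ r : ℕ, 1 ≤ r → r ≤ J → ∀ b, Nat.gcd b r = 1 → |Ef x r b| ≤ K * x / Real.log x ^ A')
    (hcount : ∀ (a r : ℕ) (η : ℝ), a ≤ r → a.Coprime r → J < r → r ≤ 2 * Q → 0 ≤ η → η ≤ 1 / (J : ℝ) ^ 2 →
      (((SQ c Q).filter fun q : ℕ => ∃ m : ℤ, |(q : ℝ) * (a / r) - m| ≤ η).card : ℝ)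
        ≤ C * (SQ c Q).card / J) :
    ∑ q ∈ SQ c Q, varSum x q
      ≤ 1 / Q * ((32 * (K + 1) ^ 2 + 396 * C) * (SQ c Q).card * (x ^ 2 / Real.log x ^ N)) := by
  set L := Real.log x with hLdef
  set s : ℝ := ((SQ c Q).card : ℝ) with hs
  have hs0 : 0 ≤ s := by rw [hs]; positivity
  have hL0 : 0 < L := by linarith
  have hL1 : 1 ≤ L := by linarith
  have hx0 : 0 < x := by linarith
  have hQ0 : (0 : ℝ) < Q := by exact_mod_cast hQ
  have hLD : 8 ≤ L ^ D := by
    refine hL.trans ?_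
    calc L = L ^ 1 := (pow_one L).symm
      _ ≤ L ^ D := pow_le_pow_right₀ hL1 (by omega)
  have hJ8 : (8 : ℝ) ≤ J := hLD.trans hJ1
  have hJ0 : (0 : ℝ) < J := by linarith
  have hJnat : 1 ≤ J := by exact_mod_cast (show (1 : ℝ) ≤ J by linarith)
  have hJsq : (J : ℝ) ^ 2 ≤ 4 * L ^ (2 * D) := by
    calc (J : ℝ) ^ 2 ≤ (2 * L ^ D) ^ 2 := by gcongr
      _ = 4 * L ^ (2 * D) := by ring
  have h2J : 2 * (J : ℝ) ^ 2 ≤ L ^ (2 * D + 1) := by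
    rw [pow_succ L]
    have : 0 < L ^ (2 * D) := by positivity
    nlinarith
  have hη1 : 2 * (Q : ℝ) / x ≤ 1 / (J : ℝ) ^ 2 := by
    rw [le_div_iff₀ (by positivity)] at hQx
    rw [div_le_div_iff₀ hx0 (by positivity), one_mul]
    calc 2 * (Q : ℝ) * (J : ℝ) ^ 2 = Q * (2 * (J : ℝ) ^ 2) := by ring
      _ ≤ Q * L ^ (2 * D + 1) := by gcongr
      _ ≤ x := hQx
  have hη2 : 2 * (Q : ℝ) / x < 1 / 2 := by
    refine hη1.trans_lt ?_
    rw [div_lt_div_iff₀ (by positivity) (by norm_num)]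
    nlinarith
  have h2Qx : ((2 * Q : ℕ) : ℝ) ≤ x := by
    rw [div_lt_iff₀ hx0] at hη2
    push_cast
    linarith
  have hS : ∀ q ∈ SQ c Q, Q < q ∧ q ≤ 2 * Q := fun q hq => bounds_of_mem_SQ hq
  have hM0 : 0 ≤ K * x / L ^ A' := by positivity
  have hG0 : 0 ≤ C * s / J := by positivity
  have key := sum_varSum_le_of_count (SQ c Q) hQ hS (x := x) hG0 hM0 (by linarith) hJnat hη2 hSW
    fun a r har hcop hJr hr => hcount a r _ har hcop hJr hr (by positivity) hη1
  refine key.trans ?_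
  refine mul_le_mul_of_nonneg_left ?_ (by positivity)
  have hlog := sum_log_sq_primesLe_le (show 1 ≤ x by linarith)
  have htot := sum_inv_totient_le_log_sq hx (show 0 < 2 * Q by omega) h2Qx
  rw [← hLdef] at hlog htot
  have hGL : C * s / J * L ^ 2 ≤ C * s / L ^ N := by
    rw [div_mul_eq_mul_div, div_le_div_iff₀ hJ0 (by positivity)]
    calc C * s * L ^ 2 * L ^ N = C * s * L ^ D := by rw [hD, pow_add]; ring
      _ ≤ C * s * J := by gcongr
  have hMJ : K * x / L ^ A' + 2 * (J : ℝ) ^ 2 ≤ (K + 1) * x / L ^ A' := by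
    have : 2 * (J : ℝ) ^ 2 ≤ x / L ^ A' := by
      rw [le_div_iff₀ (by positivity)]
      calc 2 * (J : ℝ) ^ 2 * L ^ A' ≤ L ^ (2 * D + 1) * L ^ A' := by gcongr
        _ = L ^ (2 * D + A' + 1) := by rw [← pow_add]; congr 1; omega
        _ ≤ x := hxL
    calc K * x / L ^ A' + 2 * (J : ℝ) ^ 2 ≤ K * x / L ^ A' + x / L ^ A' := by gcongr
      _ = _ := by ring
  have hT1 : (J : ℝ) * (J + 1) * (J * (K * x / L ^ A' + 2 * (J : ℝ) ^ 2)) ^ 2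
      ≤ 32 * (K + 1) ^ 2 * (x ^ 2 / L ^ N) := by
    calc (J : ℝ) * (J + 1) * (J * (K * x / L ^ A' + 2 * (J : ℝ) ^ 2)) ^ 2
        ≤ (2 * (J : ℝ) ^ 2) * (J * ((K + 1) * x / L ^ A')) ^ 2 := by
          have : (J : ℝ) * (J + 1) ≤ 2 * (J : ℝ) ^ 2 := by nlinarith
          gcongr
      _ = 2 * ((J : ℝ) ^ 2) ^ 2 * ((K + 1) * x / L ^ A') ^ 2 := by ring
      _ ≤ 2 * (4 * L ^ (2 * D)) ^ 2 * ((K + 1) * x / L ^ A') ^ 2 := by gcongr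
      _ = 32 * (K + 1) ^ 2 * (x ^ 2 * (L ^ (4 * D) / L ^ (2 * A'))) := by
          rw [show 4 * D = 2 * D * 2 by ring, pow_mul L (2 * D) 2, mul_comm 2 A', pow_mul L A' 2]
          field_simp
          ring
      _ ≤ 32 * (K + 1) ^ 2 * (x ^ 2 * (1 / L ^ N)) := by
          have : L ^ (4 * D) / L ^ (2 * A') ≤ 1 / L ^ N := by
            rw [div_le_div_iff₀ (by positivity) (by positivity), one_mul, ← pow_add]
            exact pow_le_pow_right₀ hL1 hA'
          gcongr
      _ = _ := by ring
  have hT2 : 2 * (96 * x * (C * s / J) * ∑ p ∈ primesLe x, Real.log p ^ 2)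
      ≤ 384 * C * s * (x ^ 2 / L ^ N) := by
    calc 2 * (96 * x * (C * s / J) * ∑ p ∈ primesLe x, Real.log p ^ 2)
        ≤ 2 * (96 * x * (C * s / J) * (2 * x * L)) := by gcongr
      _ = 384 * x ^ 2 * (C * s / J * L) := by ring
      _ ≤ 384 * x ^ 2 * (C * s / J * L ^ 2) := by
          gcongr
          nlinarith
      _ ≤ 384 * x ^ 2 * (C * s / L ^ N) := by gcongr
      _ = _ := by ring
  have hT3 : 2 * (x ^ 2 * (C * s / J * ∑ r ∈ Icc 1 (2 * Q), 1 / (Nat.totient r : ℝ)))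
      ≤ 12 * C * s * (x ^ 2 / L ^ N) := by
    calc 2 * (x ^ 2 * (C * s / J * ∑ r ∈ Icc 1 (2 * Q), 1 / (Nat.totient r : ℝ)))
        ≤ 2 * (x ^ 2 * (C * s / J * (6 * L ^ 2))) := by gcongr
      _ = 12 * x ^ 2 * (C * s / J * L ^ 2) := by ring
      _ ≤ 12 * x ^ 2 * (C * s / L ^ N) := by gcongr
      _ = _ := by ring
  have hT1' := mul_le_mul_of_nonneg_left hT1 hs0
  linarith

set_option maxHeartbeats 1000000 in
theorem exists_sum_varSum_SQ_le {c : ℝ} (hc : 1 < c) (hcne : ∀ n : ℤ, c ≠ (n : ℝ)) (N : ℕ) :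
    ∃ B : ℕ, 0 < B ∧ ∃ κ : ℝ, 0 < κ ∧ ∀ᶠ x : ℝ in atTop, ∀ Q : ℕ, 0 < Q →
      (Q : ℝ) ≤ x / Real.log x ^ B →
      ∑ q ∈ SQ c Q, varSum x q ≤ 1 / Q * (κ * (SQ c Q).card * (x ^ 2 / Real.log x ^ N)) := by
  obtain ⟨C, J₀, E, hC, hcount⟩ := exists_count_bound hc hcne
  set D := N + 2 with hD
  set F := D * E + 1 with hF
  set A' := 2 * D + F + N with hA'
  obtain ⟨K, hK, x₁, hSW⟩ := siegelWalfisz (D + F + 1) A'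
  refine ⟨2 * D + 1, by omega, 32 * (K + 1) ^ 2 + 396 * C + 2 * K ^ 2, by positivity, ?_⟩
  filter_upwards [eventually_ge_atTop x₁, eventually_ge_atTop 3,
    Real.tendsto_log_atTop.eventually_ge_atTop (max (max 8 J₀) (2 ^ (E + 1))),
    eventually_log_pow_le (2 * D + A' + 1) 1 one_pos] with x hx1 hx3 hLmax hxL
  intro Q hQ hQx
  rw [one_mul] at hxL
  set L := Real.log x with hLdef
  have hL8 : 8 ≤ L := (le_max_left _ _).trans ((le_max_left _ _).trans hLmax)
  have hLJ : (J₀ : ℝ) ≤ L := (le_max_right _ _).trans ((le_max_left _ _).trans hLmax)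
  have hLE : (2 : ℝ) ^ (E + 1) ≤ L := (le_max_right _ _).trans hLmax
  have hL1 : 1 ≤ L := by linarith
  have hL0 : 0 < L := by linarith
  have hQ0 : (0 : ℝ) < Q := by exact_mod_cast hQ
  have hx0 : 0 < x := by linarith
  have hLD : L ≤ L ^ D := by
    calc L = L ^ 1 := (pow_one L).symm
      _ ≤ L ^ D := pow_le_pow_right₀ hL1 (by omega)
  set J := ⌈L ^ D⌉₊ with hJ
  have hJ1 : L ^ D ≤ J := Nat.le_ceil _
  have hJ2 : (J : ℝ) ≤ 2 * L ^ D := by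
    have := (Nat.ceil_lt_add_one (show 0 ≤ L ^ D by positivity)).le
    linarith
  have hJ₀ : J₀ ≤ J := by exact_mod_cast hLJ.trans (hLD.trans hJ1)
  have hy : 0 ≤ x ^ 2 / L ^ N := by positivity
  rcases le_or_gt (J ^ E) Q with hlarge | hsmall
  · have hSWJ : ∀ r : ℕ, 1 ≤ r → r ≤ J → ∀ b, Nat.gcd b r = 1 → |Ef x r b| ≤ K * x / L ^ A' := by
      intro r hr1 hrJ b hb
      refine hSW x hx1 r hr1 ?_ b hb
      have hrJ' : (r : ℝ) ≤ J := by exact_mod_cast hrJ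
      calc (r : ℝ) ≤ 2 * L ^ D := hrJ'.trans hJ2
        _ ≤ L * L ^ D := by gcongr; linarith
        _ = L ^ (D + 1) := by ring
        _ ≤ L ^ (D + F + 1) := pow_le_pow_right₀ hL1 (by omega)
    refine (sum_varSum_SQ_le_of_large hK hC hL8 hx3 hQ hD hJ1 hJ2 (by omega) hxL hQx hSWJ
      fun a r η h1 h2 h3 h4 h5 h6 => hcount J Q a r η hJ₀ hlarge h1 h2 h3 h4 h5 h6).trans ?_
    refine mul_le_mul_of_nonneg_left (mul_le_mul_of_nonneg_right
      (mul_le_mul_of_nonneg_right ?_ (by positivity)) hy) (by positivity)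
    nlinarith [sq_nonneg K]
  · have hQ2F : 2 * (Q : ℝ) ≤ L ^ F := by
      have h1 : (Q : ℝ) ≤ (J : ℝ) ^ E := by exact_mod_cast hsmall.le
      calc 2 * (Q : ℝ) ≤ 2 * (2 * L ^ D) ^ E := by
            have : (J : ℝ) ^ E ≤ (2 * L ^ D) ^ E := by gcongr
            linarith
        _ = 2 ^ (E + 1) * L ^ (D * E) := by rw [mul_pow, ← pow_mul]; ring
        _ ≤ L * L ^ (D * E) := by gcongr
        _ = L ^ F := by rw [hF]; ring
    have hSWq : ∀ q ∈ SQ c Q, ∀ b, Nat.gcd b q = 1 → |Ef x q b| ≤ K * x / L ^ A' := by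
      intro q hq b hb
      have hq' := bounds_of_mem_SQ hq
      have hq2 : (q : ℝ) ≤ 2 * Q := by exact_mod_cast hq'.2
      refine hSW x hx1 q (by omega) ?_ b hb
      exact hq2.trans (hQ2F.trans (pow_le_pow_right₀ hL1 (by omega)))
    refine (sum_varSum_SQ_le_of_small (N := N) hL1 hQ (F := F) (by linarith) (by omega) hSWq).trans ?_
    refine mul_le_mul_of_nonneg_left (mul_le_mul_of_nonneg_right
      (mul_le_mul_of_nonneg_right ?_ (by positivity)) hy) (by positivity)
    nlinarith [sq_nonneg (K + 1)]

end

theorem statement2 (c : ℝ) (hc : 1 < c) (hcne : ∀ n : ℤ, c ≠ (n : ℝ)) (A : ℝ) (hA : 1 < A) :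
    ∃ B : ℝ, 0 < B ∧ ∃ κ > 0, ∃ x₀ : ℝ, 2 ≤ x₀ ∧ ∀ x : ℝ, x₀ ≤ x →
      ∀ Q : ℕ, 0 < Q → (Q : ℝ) ≤ x * Real.log x ^ (-B) →
        ∑ q ∈ SQ c Q, varSum x q
          ≤ κ * (SQ c Q).card * x ^ 2 / (Q * Real.log x ^ (2 * A)) := by
  obtain ⟨B, hB, κ, hκ, hev⟩ := exists_sum_varSum_SQ_le hc hcne ⌈2 * A⌉₊
  obtain ⟨x₀, hx₀⟩ := Filter.eventually_atTop.1 hev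
  refine ⟨B, by exact_mod_cast hB, κ, hκ, max x₀ 3, (by norm_num : (2 : ℝ) ≤ 3).trans (le_max_right _ _),
    fun x hx Q hQ hQx => ?_⟩
  have hx3 : 3 ≤ x := (le_max_right _ _).trans hx
  have hL1 : 1 ≤ Real.log x := by
    rw [Real.le_log_iff_exp_le (by linarith)]
    exact Real.exp_one_lt_three.le.trans hx3
  have hL0 : 0 < Real.log x := by linarith
  have hQ0 : (0 : ℝ) < Q := by exact_mod_cast hQ
  rw [Real.rpow_neg hL0.le, Real.rpow_natCast, ← div_eq_mul_inv] at hQx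
  refine (hx₀ x ((le_max_left _ _).trans hx) Q hQ hQx).trans ?_
  have h1 : Real.log x ^ (2 * A) ≤ Real.log x ^ ⌈2 * A⌉₊ := by
    rw [← Real.rpow_natCast]
    exact Real.rpow_le_rpow_of_exponent_le hL1 (Nat.le_ceil _)
  have h2 : 0 < Real.log x ^ (2 * A) := Real.rpow_pos_of_pos hL0 _
  calc 1 / (Q : ℝ) * (κ * (SQ c Q).card * (x ^ 2 / Real.log x ^ ⌈2 * A⌉₊))
      ≤ 1 / (Q : ℝ) * (κ * (SQ c Q).card * (x ^ 2 / Real.log x ^ (2 * A))) := by gcongr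
    _ = _ := by field_simp
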